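/- Let d, m ≥ 1, let (Ω,μ) be a σ-finite measure space, let r⃗ ∈ (0,∞)^m and t⃗ ∈ (0,∞]^m with r_j < t_j for all j, set 1/r := ∑_{j=1}^m 1/r_j and 1/t := ∑_{j=1}^m 1/t_j, assume t < ∞, and let q ∈ [r,t]. Then for all p⃗ ∈ (0,∞]^m with r_j < p_j for all j and p < ∞ (1/p := ∑_{j=1}^m 1/p_j), and all w⃗ ∈ A_{p⃗,(r⃗,∞)} with w := ∏_{j=1}^m w_j, there is a constant C depending only on d, m, p⃗, q, r⃗, t⃗ such that for every finite collection 𝒟 of cubes and all jointly measurable f_j : ℝ^d × Ω → ℂ: ‖ ‖M̃^𝒟_{r⃗}(f⃗)(x,·)‖_{L^t(Ω)} ‖_{L^p_w(ℝ^d,dx)} ≤ C · [w⃗]_{p⃗,(r⃗,∞)}^{max{ max_{1≤j≤m} (1/r_j)/(1/r_j − 1/p_j), p/q }} · ∏_{j=1}^m ‖ ‖f_j(x,·)‖_{L^{t_j}(Ω)} ‖_{L^{p_j}_{w_j}(ℝ^d,dx)}. -/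

import Mathlib

open MeasureTheory ENNReal

noncomputable section

structure Cube (d : ℕ) where
  corner : Fin d → ℝ
  side : ℝ
  side_pos : 0 < side

namespace Cube
def set {d : ℕ} (Q : Cube d) : Set (Fin d → ℝ) :=
  {x | ∀ i, Q.corner i ≤ x i ∧ x i < Q.corner i + Q.side}
def vol {d : ℕ} (Q : Cube d) : ℝ≥0∞ := volume Q.set
def IsDyadic {d : ℕ} (Q : Cube d) : Prop :=
  ∃ (k : ℤ) (n : Fin d → ℤ), Q.side = (2:ℝ) ^ (-k) ∧ ∀ i, Q.corner i = (2:ℝ) ^ (-k) * (n i : ℝ)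
end Cube

def IsSparse {d : ℕ} (S : Set (Cube d)) : Prop :=
  ∃ E : Cube d → Set (Fin d → ℝ),
    (∀ Q ∈ S, MeasurableSet (E Q) ∧ E Q ⊆ Q.set ∧ Q.vol ≤ 2 * volume (E Q)) ∧
    S.PairwiseDisjoint E

def eNorm {α : Type*} [MeasurableSpace α] (p : ℝ≥0∞) (μ : Measure α) (F : α → ℝ≥0∞) : ℝ≥0∞ :=
  if p = ∞ then essSup F μ else (∫⁻ x, F x ^ p.toReal ∂μ) ^ (1 / p.toReal)

def nn {α : Type*} (f : α → ℂ) : α → ℝ≥0∞ := fun x => (‖f x‖₊ : ℝ≥0∞)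

def avg {d : ℕ} (r : ℝ≥0∞) (F : (Fin d → ℝ) → ℝ≥0∞) (Q : Cube d) : ℝ≥0∞ :=
  if r = ∞ then essSup F (volume.restrict Q.set)
  else ((∫⁻ x in Q.set, F x ^ r.toReal) / Q.vol) ^ (1 / r.toReal)

def maximal {d k : ℕ} (r : Fin k → ℝ≥0∞) (F : Fin k → (Fin d → ℝ) → ℝ≥0∞)
    (x : Fin d → ℝ) : ℝ≥0∞ :=
  ⨆ (Q : Cube d) (_ : x ∈ Q.set), ∏ j, avg (r j) (F j) Q

def maximalX {d k : ℕ} (r : Fin k → ℝ≥0∞) (ρ : ℝ≥0∞) (F : Fin k → (Fin d → ℝ) → ℝ≥0∞)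
    (G : (Fin d → ℝ) → ℝ≥0∞) (x : Fin d → ℝ) : ℝ≥0∞ :=
  ⨆ (Q : Cube d) (_ : x ∈ Q.set), (∏ j, avg (r j) (F j) Q) * avg ρ G Q

def wNorm {d : ℕ} (p : ℝ≥0∞) (w : (Fin d → ℝ) → ℝ) (F : (Fin d → ℝ) → ℝ≥0∞) : ℝ≥0∞ :=
  eNorm p volume (fun x => F x * ENNReal.ofReal (w x))

def aConst {d m : ℕ} (p r : Fin m → ℝ≥0∞) (s : ℝ≥0∞)
    (w : Fin m → (Fin d → ℝ) → ℝ) : ℝ≥0∞ :=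
  ⨆ Q : Cube d,
    (∏ j, avg ((r j)⁻¹ - (p j)⁻¹)⁻¹ (fun x => ENNReal.ofReal (w j x)⁻¹) Q) *
      avg ((∑ j, (p j)⁻¹) - s⁻¹)⁻¹ (fun x => ENNReal.ofReal (∏ j, w j x)) Q

def latAvg {d : ℕ} {Ω : Type*} (r : ℝ≥0∞) (f : (Fin d → ℝ) → Ω → ℂ) (Q : Cube d) (ω : Ω) : ℝ≥0∞ :=
  ((∫⁻ y in Q.set, (‖f y ω‖₊ : ℝ≥0∞) ^ r.toReal) / Q.vol) ^ (1 / r.toReal)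

def latMax {d m : ℕ} {Ω : Type*} (r : Fin m → ℝ≥0∞) (D : Finset (Cube d))
    (f : Fin m → (Fin d → ℝ) → Ω → ℂ) (x : Fin d → ℝ) (ω : Ω) : ℝ≥0∞ :=
  ⨆ Q ∈ D, ⨆ (_ : x ∈ Cube.set Q), ∏ j, latAvg (r j) (f j) Q ω

def latMaxX {d m : ℕ} {Ω : Type*} (r : Fin m → ℝ≥0∞) (ρ : ℝ≥0∞) (D : Finset (Cube d))
    (f : Fin m → (Fin d → ℝ) → Ω → ℂ) (g : (Fin d → ℝ) → Ω → ℂ)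
    (x : Fin d → ℝ) (ω : Ω) : ℝ≥0∞ :=
  ⨆ Q ∈ D, ⨆ (_ : x ∈ Cube.set Q), (∏ j, latAvg (r j) (f j) Q ω) * latAvg ρ g Q ω

def MemLinftyC {d : ℕ} (f : (Fin d → ℝ) → ℂ) : Prop :=
  Measurable f ∧ (∃ M : ℝ, ∀ x, ‖f x‖ ≤ M) ∧ Bornology.IsBounded (Function.support f)

def SimpleLinftyC {d : ℕ} (f : (Fin d → ℝ) → ℂ) : Prop :=
  Measurable f ∧ (Set.range f).Finite ∧ Bornology.IsBounded (Function.support f)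

def PairSimple {d : ℕ} {Ω : Type*} [MeasurableSpace Ω] (f : (Fin d → ℝ) → Ω → ℂ) : Prop :=
  Measurable (Function.uncurry f) ∧ (Set.range (Function.uncurry f)).Finite ∧
    ∃ B : Set (Fin d → ℝ), Bornology.IsBounded B ∧ ∀ x ∉ B, ∀ ω, f x ω = 0

def VecSimple {d : ℕ} {Ω : Type*} [MeasurableSpace Ω] (f : (Fin d → ℝ) → Ω → ℂ) : Prop :=
  ∃ (N : ℕ) (A : Fin N → Set (Fin d → ℝ)) (ξ : Fin N → Ω → ℂ),
    (∀ i, MeasurableSet (A i)) ∧ (∀ i, Bornology.IsBounded (A i)) ∧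
    (∀ i, Measurable (ξ i)) ∧ (∃ M : ℝ, ∀ i ω, ‖ξ i ω‖ ≤ M) ∧
    ∀ x ω, f x ω = ∑ i, (A i).indicator (fun _ => ξ i ω) x

/-- A finite laminar (nested) family. -/
def Lam {ι α : Type*} (c : ι → Set α) (B : Finset ι) : Prop :=
  ∀ P ∈ B, ∀ Q ∈ B, c P ⊆ c Q ∨ c Q ⊆ c P ∨ Disjoint (c P) (c Q)

lemma Lam.mono {ι α : Type*} {c : ι → Set α} {B B' : Finset ι} (h : Lam c B) (hs : B' ⊆ B) :
    Lam c B' := fun P hP Q hQ => h P (hs hP) Q (hs hQ)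

lemma lam_union_bound {ι α : Type*} [MeasurableSpace α] (c : ι → Set α)
    (hc : ∀ i, MeasurableSet (c i)) (σ ν : Measure α) (a : ℝ≥0∞) :
    ∀ (n : ℕ) (B : Finset ι), B.card ≤ n → Lam c B → (∀ Q ∈ B, a * σ (c Q) ≤ ν (c Q)) →
    a * σ (⋃ Q ∈ B, c Q) ≤ ν (⋃ Q ∈ B, c Q) := by
  classical
  intro n
  induction n with
  | zero =>
    intro B hB _ _
    have : B = ∅ := by simpa using hB
    subst this; simp
  | succ n ih =>
    intro B hB hL hQ
    rcases B.eq_empty_or_nonempty with rfl | hne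
    · simp
    obtain ⟨Q0, hQ0, hmax⟩ := Finset.exists_maximalFor c B hne
    set B' := B.filter (fun Q => ¬ c Q ⊆ c Q0) with hB'
    have hsub : B' ⊆ B := Finset.filter_subset _ _
    have hcard : B'.card ≤ n := by
      have : B'.card < B.card := by
        apply Finset.card_lt_card
        refine ⟨hsub, fun h => ?_⟩
        have := h hQ0
        simp [hB'] at this
      omega
    have hU : (⋃ Q ∈ B, c Q) = c Q0 ∪ ⋃ Q ∈ B', c Q := by
      ext x
      simp only [Set.mem_iUnion, Set.mem_union, exists_prop, hB', Finset.mem_filter]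
      constructor
      · rintro ⟨Q, hQ, hx⟩
        by_cases h : c Q ⊆ c Q0
        · exact Or.inl (h hx)
        · exact Or.inr ⟨Q, ⟨hQ, h⟩, hx⟩
      · rintro (hx | ⟨Q, hQ, hx⟩)
        · exact ⟨Q0, hQ0, hx⟩
        · exact ⟨Q, hQ.1, hx⟩
    have hdis : Disjoint (c Q0) (⋃ Q ∈ B', c Q) := by
      simp only [Set.disjoint_iUnion_right]
      intro Q hQ'
      simp only [hB', Finset.mem_filter] at hQ'
      rcases hL Q0 hQ0 Q hQ'.1 with h | h | h
      · exact absurd (hmax hQ'.1 h) hQ'.2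
      · exact absurd h hQ'.2
      · exact h
    have hm : MeasurableSet (⋃ Q ∈ B', c Q) := Finset.measurableSet_biUnion _ (fun i _ => hc i)
    rw [hU, measure_union hdis hm, measure_union hdis hm, mul_add]
    exact add_le_add (hQ _ hQ0) (ih B' hcard (hL.mono hsub) (fun Q h => hQ Q (hsub h)))

/-- layer cake for `ℝ≥0∞`-valued, a.e. finite functions -/
lemma layercake_ennreal {α : Type*} [MeasurableSpace α] (μ : Measure α) (f : α → ℝ≥0∞)
    (hf : Measurable f) (hfin : ∀ᵐ x ∂μ, f x ≠ ∞) (p : ℝ) (hp : 0 < p) :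
    ∫⁻ x, f x ^ p ∂μ = ENNReal.ofReal p *
      ∫⁻ l in Set.Ioi (0:ℝ), μ {x | ENNReal.ofReal l < f x} * ENNReal.ofReal (l ^ (p - 1)) := by
  have h := lintegral_rpow_eq_lintegral_meas_lt_mul (μ := μ) (f := fun x => (f x).toReal)
    (Filter.Eventually.of_forall fun x => ENNReal.toReal_nonneg) hf.ennreal_toReal.aemeasurable hp
  have h1 : ∫⁻ x, f x ^ p ∂μ = ∫⁻ x, ENNReal.ofReal ((f x).toReal ^ p) ∂μ := by
    apply lintegral_congr_ae
    filter_upwards [hfin] with x hx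
    rw [← ENNReal.ofReal_rpow_of_nonneg ENNReal.toReal_nonneg hp.le, ENNReal.ofReal_toReal hx]
  rw [h1, h]
  congr 1
  apply setLIntegral_congr_fun measurableSet_Ioi
  intro l hl
  simp only
  congr 1
  apply measure_congr
  filter_upwards [hfin] with x hx
  apply propext
  change l < (f x).toReal ↔ ENNReal.ofReal l < f x
  exact (ENNReal.ofReal_lt_iff_lt_toReal (le_of_lt hl) hx).symm

/-- The maximal function of a finite family. -/
def mx {ι α : Type*} (c : ι → Set α) (D : Finset ι) (a : ι → ℝ≥0∞) (x : α) : ℝ≥0∞ :=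
  ⨆ Q ∈ D, ⨆ (_ : x ∈ c Q), a Q

lemma mx_eq {ι α : Type*} (c : ι → Set α) (D : Finset ι) (a : ι → ℝ≥0∞) (x : α) :
    mx c D a x = ⨆ Q ∈ D, (c Q).indicator (fun _ => a Q) x := by
  unfold mx
  refine iSup_congr fun Q => iSup_congr fun hQ => ?_
  by_cases h : x ∈ c Q <;> simp [h]

lemma le_mx {ι α : Type*} (c : ι → Set α) (D : Finset ι) (a : ι → ℝ≥0∞) {x : α} {Q : ι}
    (hQ : Q ∈ D) (hx : x ∈ c Q) : a Q ≤ mx c D a x :=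
  le_iSup₂_of_le Q hQ (le_iSup_of_le hx le_rfl)

lemma mx_le {ι α : Type*} (c : ι → Set α) (D : Finset ι) (a : ι → ℝ≥0∞) {x : α} {b : ℝ≥0∞}
    (h : ∀ Q ∈ D, x ∈ c Q → a Q ≤ b) : mx c D a x ≤ b :=
  iSup₂_le fun Q hQ => iSup_le fun hx => h Q hQ hx

lemma lt_mx {ι α : Type*} (c : ι → Set α) (D : Finset ι) (a : ι → ℝ≥0∞) {x : α} {b : ℝ≥0∞} :
    b < mx c D a x ↔ ∃ Q ∈ D, x ∈ c Q ∧ b < a Q := by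
  simp only [mx, lt_iSup_iff, exists_prop]

lemma measurable_mx {ι α : Type*} [MeasurableSpace α] (c : ι → Set α)
    (hc : ∀ i, MeasurableSet (c i)) (D : Finset ι) (a : ι → ℝ≥0∞) : Measurable (mx c D a) := by
  have : mx c D a = fun x => ⨆ Q ∈ D, (c Q).indicator (fun _ => a Q) x :=
    funext fun x => mx_eq c D a x
  rw [this]
  exact Measurable.biSup _ D.countable_toSet (fun i _ => measurable_const.indicator (hc i))

/-- Doob maximal inequality for a finite laminar family and an arbitrary measure. -/
lemma doob {ι α : Type*} [MeasurableSpace α] (c : ι → Set α)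
    (hc : ∀ i, MeasurableSet (c i)) (D : Finset ι) (hL : Lam c D) (σ : Measure α)
    (hσ : ∀ Q ∈ D, σ (c Q) ≠ ∞) (h : α → ℝ≥0∞) (hh : Measurable h) (p : ℝ) (hp : 1 < p) :
    ∫⁻ x, mx c D (fun Q => (∫⁻ y in c Q, h y ∂σ) / σ (c Q)) x ^ p ∂σ ≤
      ENNReal.ofReal (2 ^ p * p / (p - 1)) * ∫⁻ x, h x ^ p ∂σ := by
  classical
  by_cases hfin : ∫⁻ x, h x ^ p ∂σ = ∞
  · rw [hfin, ENNReal.mul_top]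
    · exact le_top
    · have : 0 < 2 ^ p * p / (p - 1) := by
        apply div_pos <;> [positivity; linarith]
      simpa using this
  set a : ι → ℝ≥0∞ := fun Q => (∫⁻ y in c Q, h y ∂σ) / σ (c Q) with ha
  have hhint : ∀ Q ∈ D, ∫⁻ y in c Q, h y ∂σ ≠ ∞ := by
    intro Q hQ
    have h1 : ∫⁻ y in c Q, h y ∂σ ≤ ∫⁻ y in c Q, (1 + h y ^ p) ∂σ := by
      apply lintegral_mono
      intro y
      by_cases hy : h y ≤ 1
      · exact hy.trans le_self_add
      · push Not at hy
        calc h y = h y ^ (1:ℝ) := by simp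
          _ ≤ h y ^ p := ENNReal.rpow_le_rpow_of_exponent_le hy.le hp.le
          _ ≤ _ := le_add_self
    rw [lintegral_add_left measurable_const] at h1
    refine ne_top_of_le_ne_top ?_ h1
    refine ENNReal.add_ne_top.2 ⟨by simpa using hσ Q hQ, ?_⟩
    exact ne_top_of_le_ne_top hfin (setLIntegral_le_lintegral _ _)
  have hafin : ∀ Q ∈ D, a Q ≠ ∞ := by
    intro Q hQ
    by_cases h0 : σ (c Q) = 0
    · have : ∫⁻ y in c Q, h y ∂σ = 0 := setLIntegral_measure_zero _ _ h0
      simp [ha, this]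
    · exact ENNReal.div_ne_top (hhint Q hQ) h0
  have hmfin : ∀ x, mx c D a x ≠ ∞ := by
    intro x
    have : mx c D a x ≤ ∑ Q ∈ D, a Q :=
      mx_le c D a fun Q hQ _ => Finset.single_le_sum (fun _ _ => zero_le) hQ
    exact ne_top_of_le_ne_top (ENNReal.sum_ne_top.2 hafin) this
  set ν : Measure α := σ.withDensity h with hν
  have weak : ∀ l ∈ Set.Ioi (0:ℝ), σ {x | ENNReal.ofReal l < mx c D a x} ≤
      ENNReal.ofReal (2 / l) * ν {x | ENNReal.ofReal l < 2 * h x} := by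
    intro l hl
    have hl : 0 < l := hl
    set B := D.filter (fun Q => ENNReal.ofReal l < a Q) with hB
    have hset : {x | ENNReal.ofReal l < mx c D a x} = ⋃ Q ∈ B, c Q := by
      ext x
      simp only [Set.mem_ofPred_eq, lt_mx, hB, Finset.mem_filter, Set.mem_iUnion, exists_prop]
      constructor
      · rintro ⟨Q, h1, h2, h3⟩; exact ⟨Q, ⟨h1, h3⟩, h2⟩
      · rintro ⟨Q, ⟨h1, h3⟩, h2⟩; exact ⟨Q, h1, h2, h3⟩
    set A := {x | ENNReal.ofReal l < 2 * h x} with hA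
    have hAm : MeasurableSet A := measurableSet_lt measurable_const (hh.const_mul 2)
    have key := lam_union_bound c hc σ (ν.restrict A) (ENNReal.ofReal (l / 2)) B.card B le_rfl
      (hL.mono (Finset.filter_subset _ _)) (by
        intro Q hQ
        simp only [hB, Finset.mem_filter] at hQ
        obtain ⟨hQD, hlt⟩ := hQ
        have h0 : σ (c Q) ≠ 0 := by
          intro h0
          have : ∫⁻ y in c Q, h y ∂σ = 0 := setLIntegral_measure_zero _ _ h0
          simp [ha, this] at hlt
        have h1 : ENNReal.ofReal l * σ (c Q) ≤ ∫⁻ y in c Q, h y ∂σ := by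
          have := ENNReal.mul_le_of_le_div hlt.le
          exact this
        have h2 : ∫⁻ y in c Q, h y ∂σ ≤ ν.restrict A (c Q) + ENNReal.ofReal (l/2) * σ (c Q) := by
          rw [Measure.restrict_apply (hc Q), hν, withDensity_apply _ ((hc Q).inter hAm)]
          rw [← lintegral_inter_add_sdiff h (c Q) hAm]
          refine add_le_add le_rfl ?_
          calc ∫⁻ x in c Q \ A, h x ∂σ ≤ ∫⁻ x in c Q \ A, ENNReal.ofReal (l/2) ∂σ := by
                apply setLIntegral_mono' ((hc Q).diff hAm)
                intro x hx
                have hx2 : ¬ (ENNReal.ofReal l < 2 * h x) := hx.2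
                push Not at hx2
                have e : ENNReal.ofReal (l/2) = ENNReal.ofReal l / 2 := by
                  rw [ENNReal.ofReal_div_of_pos (by norm_num)]; simp
                rw [e, ENNReal.le_div_iff_mul_le (by simp) (by simp), mul_comm]
                exact hx2
            _ ≤ _ := by
                rw [setLIntegral_const]
                gcongr
                exact Set.sdiff_subset
        have h3 : ENNReal.ofReal l * σ (c Q) = ENNReal.ofReal (l/2) * σ (c Q) +
            ENNReal.ofReal (l/2) * σ (c Q) := by
          rw [← add_mul, ← ENNReal.ofReal_add (by positivity) (by positivity)]
          ring_nf
        have h4 := (h3 ▸ h1).trans h2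
        exact (ENNReal.add_le_add_iff_right
          (ENNReal.mul_ne_top ENNReal.ofReal_ne_top (hσ Q hQD))).1 h4)
    rw [← hset] at key
    have k2 : ENNReal.ofReal (l / 2) * σ {x | ENNReal.ofReal l < mx c D a x} ≤ ν A := by
      refine key.trans ?_
      exact (measure_mono (Set.subset_univ _)).trans (by simp)
    calc σ {x | ENNReal.ofReal l < mx c D a x}
        = ENNReal.ofReal (2/l) * (ENNReal.ofReal (l / 2) *
            σ {x | ENNReal.ofReal l < mx c D a x}) := by
          rw [← mul_assoc, ← ENNReal.ofReal_mul (by positivity)]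
          have : 2 / l * (l / 2) = 1 := by field_simp
          simp [this]
      _ ≤ _ := by gcongr
  have hhfin : ∀ᵐ x ∂σ, h x ≠ ∞ := by
    have := ae_lt_top (hh.pow_const p) hfin
    filter_upwards [this] with x hx hx'
    simp [hx', show 0 < p by linarith] at hx
  have hhfinν : ∀ᵐ x ∂ν, 2 * h x ≠ ∞ := by
    have : ν ≪ σ := withDensity_absolutelyContinuous _ _
    filter_upwards [this.ae_le hhfin] with x hx
    exact ENNReal.mul_ne_top (by simp) hx
  have hp0 : 0 < p := by linarith
  have hp1 : 0 < p - 1 := by linarith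
  rw [layercake_ennreal σ (mx c D a) (measurable_mx c hc D a)
    (Filter.Eventually.of_forall hmfin) p hp0]
  have step : ∫⁻ l in Set.Ioi (0:ℝ), σ {x | ENNReal.ofReal l < mx c D a x} *
        ENNReal.ofReal (l ^ (p - 1)) ≤
      2 * ∫⁻ l in Set.Ioi (0:ℝ), ν {x | ENNReal.ofReal l < 2 * h x} *
        ENNReal.ofReal (l ^ (p - 1 - 1)) := by
    rw [← lintegral_const_mul' _ _ (by simp)]
    apply setLIntegral_mono' measurableSet_Ioi
    intro l hl
    have hl' : 0 < l := hl
    calc _ ≤ ENNReal.ofReal (2 / l) * ν {x | ENNReal.ofReal l < 2 * h x} *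
              ENNReal.ofReal (l ^ (p - 1)) := by gcongr; exact weak l hl
      _ = 2 * (ν {x | ENNReal.ofReal l < 2 * h x} * ENNReal.ofReal (l ^ (p - 1 - 1))) := by
          have : ENNReal.ofReal (2 / l) * ENNReal.ofReal (l ^ (p - 1)) =
              2 * ENNReal.ofReal (l ^ (p - 1 - 1)) := by
            rw [← ENNReal.ofReal_mul (by positivity), Real.rpow_sub hl' (p-1) 1, Real.rpow_one]
            rw [show (2:ℝ≥0∞) = ENNReal.ofReal 2 by simp, ← ENNReal.ofReal_mul (by positivity)]
            congr 1
            field_simp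
          rw [mul_right_comm, this]; ring
  have lc := layercake_ennreal ν (fun x => 2 * h x) (hh.const_mul 2) hhfinν (p - 1) hp1
  have e1 : ∫⁻ x, (2 * h x) ^ (p - 1) ∂ν = 2 ^ (p-1) * ∫⁻ x, h x ^ p ∂σ := by
    rw [hν, lintegral_withDensity_eq_lintegral_mul _ hh ((hh.const_mul 2).pow_const _)]
    rw [← lintegral_const_mul' _ _ (by simp)]
    apply lintegral_congr
    intro x
    simp only [Pi.mul_apply]
    rw [ENNReal.mul_rpow_of_nonneg _ _ hp1.le]
    have : h x ^ p = h x * h x ^ (p - 1) := by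
      conv_lhs => rw [show p = 1 + (p - 1) by ring]
      rw [ENNReal.rpow_add_of_nonneg _ _ zero_le_one hp1.le, ENNReal.rpow_one]
    rw [this]; ring
  have e2 : ∫⁻ l in Set.Ioi (0:ℝ), ν {x | ENNReal.ofReal l < 2 * h x} *
        ENNReal.ofReal (l ^ (p - 1 - 1)) =
      ENNReal.ofReal (1/(p-1)) * (2 ^ (p-1) * ∫⁻ x, h x ^ p ∂σ) := by
    rw [← e1, lc, ← mul_assoc, ← ENNReal.ofReal_mul (by positivity)]
    have : 1 / (p - 1) * (p - 1) = 1 := by field_simp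
    rw [this, ENNReal.ofReal_one, one_mul]
  refine (mul_le_mul_right step _).trans ?_
  rw [e2]
  apply le_of_eq
  rw [show (2:ℝ≥0∞) ^ (p-1) = ENNReal.ofReal (2 ^ (p-1)) by
    rw [← ENNReal.ofReal_rpow_of_pos (by norm_num)]; simp]
  rw [show (2:ℝ≥0∞) = ENNReal.ofReal 2 by simp]
  rw [← mul_assoc, ← mul_assoc, ← mul_assoc, ← ENNReal.ofReal_mul (by positivity),
    ← ENNReal.ofReal_mul (by positivity), ← ENNReal.ofReal_mul (by positivity)]
  congr 2
  rw [Real.rpow_sub (by norm_num)]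
  simp
  field_simp


lemma eNorm_top {α : Type*} [MeasurableSpace α] (μ : Measure α) (F : α → ℝ≥0∞) :
    eNorm ∞ μ F = essSup F μ := by simp [eNorm]

lemma eNorm_of_ne_top {α : Type*} [MeasurableSpace α] {p : ℝ≥0∞} (hp : p ≠ ∞) (μ : Measure α)
    (F : α → ℝ≥0∞) : eNorm p μ F = (∫⁻ x, F x ^ p.toReal ∂μ) ^ (1 / p.toReal) := by
  simp [eNorm, hp]

lemma eNorm_mono_ae {α : Type*} [MeasurableSpace α] (p : ℝ≥0∞) (μ : Measure α)
    {F G : α → ℝ≥0∞} (h : ∀ᵐ x ∂μ, F x ≤ G x) : eNorm p μ F ≤ eNorm p μ G := by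
  unfold eNorm
  split_ifs
  · exact essSup_mono_ae h
  · apply ENNReal.rpow_le_rpow _ (by positivity)
    apply lintegral_mono_ae
    filter_upwards [h] with x hx
    exact ENNReal.rpow_le_rpow hx ENNReal.toReal_nonneg

lemma eNorm_mono {α : Type*} [MeasurableSpace α] (p : ℝ≥0∞) (μ : Measure α)
    {F G : α → ℝ≥0∞} (h : ∀ x, F x ≤ G x) : eNorm p μ F ≤ eNorm p μ G :=
  eNorm_mono_ae p μ (Filter.Eventually.of_forall h)

lemma essSup_rpow {α : Type*} [MeasurableSpace α] (μ : Measure α)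
    (G : α → ℝ≥0∞) {a : ℝ} (ha : 0 < a) :
    essSup (fun x => G x ^ a) μ = (essSup G μ) ^ a := by
  have := OrderIso.essSup_apply (μ := μ) G (ENNReal.orderIsoRpow a ha)
  simpa using this.symm

lemma eNorm_rpow {α : Type*} [MeasurableSpace α] {t : ℝ≥0∞} (ht : t ≠ 0) (μ : Measure α)
    (G : α → ℝ≥0∞) {a : ℝ} (ha : 0 < a) :
    eNorm t μ (fun x => G x ^ a) = (eNorm (t * ENNReal.ofReal a) μ G) ^ a := by
  by_cases h : t = ∞
  · subst h
    rw [ENNReal.top_mul (by simpa using ha), eNorm_top, eNorm_top, essSup_rpow μ G ha]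
  · have h2 : t * ENNReal.ofReal a ≠ ∞ := ENNReal.mul_ne_top h ENNReal.ofReal_ne_top
    rw [eNorm_of_ne_top h, eNorm_of_ne_top h2, ENNReal.toReal_mul, ENNReal.toReal_ofReal ha.le,
      ← ENNReal.rpow_mul]
    have ht' : 0 < t.toReal := ENNReal.toReal_pos ht h
    congr 1
    · apply lintegral_congr
      intro x
      rw [← ENNReal.rpow_mul, mul_comm]
    · field_simp

lemma eNorm_const_mul {α : Type*} [MeasurableSpace α] {t : ℝ≥0∞} (ht : t ≠ 0) (μ : Measure α)
    (G : α → ℝ≥0∞) {c : ℝ≥0∞} (hc : c ≠ ∞) :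
    eNorm t μ (fun x => c * G x) = c * eNorm t μ G := by
  by_cases h : t = ∞
  · subst h
    rw [eNorm_top, eNorm_top, ENNReal.essSup_const_mul]
  · have ht' : 0 < t.toReal := ENNReal.toReal_pos ht h
    rw [eNorm_of_ne_top h, eNorm_of_ne_top h]
    simp_rw [ENNReal.mul_rpow_of_nonneg _ _ ht'.le]
    rw [lintegral_const_mul' _ _ (by simp [hc, ht'.le]), ENNReal.mul_rpow_of_nonneg _ _ (by positivity),
      ← ENNReal.rpow_mul]
    congr 1
    rw [mul_one_div_cancel ht'.ne', ENNReal.rpow_one]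

lemma eNorm_pow_eq {α : Type*} [MeasurableSpace α] {t : ℝ≥0∞} (ht : t ≠ 0) (ht' : t ≠ ∞)
    (μ : Measure α) (G : α → ℝ≥0∞) :
    (eNorm t μ G) ^ t.toReal = ∫⁻ x, G x ^ t.toReal ∂μ := by
  have h : 0 < t.toReal := ENNReal.toReal_pos ht ht'
  rw [eNorm_of_ne_top ht', ← ENNReal.rpow_mul, one_div_mul_cancel h.ne', ENNReal.rpow_one]

lemma measurable_eNorm {α Ω : Type*} [MeasurableSpace α] [MeasurableSpace Ω] (t : ℝ≥0∞)
    (μ : Measure Ω) [SFinite μ] (h : α → Ω → ℝ≥0∞) (hh : Measurable (Function.uncurry h)) :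
    Measurable (fun x => eNorm t μ (h x)) := by
  unfold eNorm
  split_ifs
  · apply measurable_of_Ioi
    intro a
    have : (fun x => essSup (h x) μ) ⁻¹' Set.Ioi a =
        (fun x => ∫⁻ ω, (Set.ofPred fun z : α × Ω => a < h z.1 z.2).indicator 1 (x, ω) ∂μ) ⁻¹' {0}ᶜ := by
      ext x
      have hm : MeasurableSet (Set.ofPred fun z : α × Ω => a < h z.1 z.2) :=
        measurableSet_lt measurable_const hh
      have hm2 : Measurable (fun ω => (Set.ofPred fun z : α × Ω => a < h z.1 z.2).indicator
          (1 : α × Ω → ℝ≥0∞) (x, ω)) :=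
        (measurable_one.indicator hm).comp measurable_prodMk_left
      simp only [Set.mem_preimage, Set.mem_Ioi, Set.mem_compl_iff, Set.mem_singleton_iff]
      rw [lintegral_eq_zero_iff hm2, ← not_le, not_iff_not]
      constructor
      · intro hle
        filter_upwards [ENNReal.ae_le_essSup (μ := μ) (h x)] with ω hω
        simp [Set.indicator, hω.trans hle]
      · intro h0
        refine essSup_le_of_ae_le _ ?_
        filter_upwards [h0] with ω hω
        by_contra hcon
        push Not at hcon
        simp [Set.indicator, hcon] at hω
    rw [this]
    apply Measurable.lintegral_prod_right'
      (f := (Set.ofPred fun z : α × Ω => a < h z.1 z.2).indicator 1)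
    · exact measurable_one.indicator (measurableSet_lt measurable_const hh)
    · exact (measurableSet_singleton 0).compl
  · apply Measurable.pow_const
    exact Measurable.lintegral_prod_right' (f := fun z : α × Ω => h z.1 z.2 ^ t.toReal)
      (hh.pow_const _)

lemma eNorm_prod_le {Ω : Type*} [MeasurableSpace Ω] (μ : Measure Ω) {m : ℕ} (t : Fin m → ℝ≥0∞)
    (ht0 : ∀ j, t j ≠ 0) (htfin : (∑ j, (t j)⁻¹)⁻¹ ≠ ∞)
    (G : Fin m → Ω → ℝ≥0∞) (hG : ∀ j, Measurable (G j)) :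
    eNorm (∑ j, (t j)⁻¹)⁻¹ μ (fun ω => ∏ j, G j ω) ≤ ∏ j, eNorm (t j) μ (G j) := by
  set T := (∑ j, (t j)⁻¹)⁻¹ with hT
  have hinv : ∀ j, (t j)⁻¹ ≠ ∞ := fun j => by simp [ht0 j]
  have hsum : ∑ j, (t j)⁻¹ ≠ ∞ := ENNReal.sum_ne_top.2 fun j _ => hinv j
  have hT0 : T ≠ 0 := by simp [hT, hsum]
  have hTr : 0 < T.toReal := ENNReal.toReal_pos hT0 htfin
  set b : Fin m → ℝ := fun j => (t j)⁻¹.toReal with hb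
  have hbs : ∑ j, b j = 1 / T.toReal := by
    rw [hb, ← ENNReal.toReal_sum (fun j _ => hinv j), hT, ENNReal.toReal_inv]
    simp
  set K : Fin m → ℝ≥0∞ := fun j => if t j = ∞ then (eNorm (t j) μ (G j)) ^ T.toReal else 1 with hK
  have hpt : ∀ᵐ ω ∂μ, (∏ j, G j ω) ^ T.toReal ≤
      (∏ j, K j) * ∏ j, (G j ω ^ (t j).toReal) ^ (T.toReal * b j) := by
    have hae : ∀ᵐ ω ∂μ, ∀ j, t j = ∞ → G j ω ≤ eNorm (t j) μ (G j) := by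
      rw [ae_all_iff]
      intro j
      by_cases h : t j = ∞
      · filter_upwards [ENNReal.ae_le_essSup (μ := μ) (G j)] with ω hω _
        rw [h, eNorm_top]; exact hω
      · exact Filter.Eventually.of_forall fun ω h' => absurd h' h
    filter_upwards [hae] with ω hω
    rw [← ENNReal.prod_rpow_of_nonneg hTr.le, ← Finset.prod_mul_distrib]
    apply Finset.prod_le_prod' 
    intro j _
    by_cases h : t j = ∞
    · simp only [hK, h, if_true, hb]
      simp only [ENNReal.inv_top, ENNReal.toReal_zero, mul_zero, ENNReal.rpow_zero, mul_one]
      have := hω j h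
      rw [h] at this
      exact ENNReal.rpow_le_rpow this hTr.le
    · have hj : 0 < (t j).toReal := ENNReal.toReal_pos (ht0 j) h
      simp only [hK, h, if_false, one_mul, hb]
      rw [← ENNReal.rpow_mul, ENNReal.toReal_inv (t j)]
      apply le_of_eq
      congr 1
      field_simp
  rw [eNorm_of_ne_top htfin]
  have h1 : ∫⁻ ω, (∏ j, G j ω) ^ T.toReal ∂μ ≤
      (∏ j, K j) * ∏ j, (∫⁻ ω, G j ω ^ (t j).toReal ∂μ) ^ (T.toReal * b j) := by
    refine (lintegral_mono_ae hpt).trans ?_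
    rw [lintegral_const_mul _ (Finset.measurable_fun_prod _ fun j _ =>
      ((hG j).pow_const _).pow_const _)]
    gcongr
    apply ENNReal.lintegral_prod_norm_pow_le
    · intro j _; exact ((hG j).pow_const _).aemeasurable
    · rw [← Finset.mul_sum, hbs]; field_simp
    · intro j _; simp only [hb]; positivity
  have h2 : (∏ j, K j) * ∏ j, (∫⁻ ω, G j ω ^ (t j).toReal ∂μ) ^ (T.toReal * b j)
      = (∏ j, eNorm (t j) μ (G j)) ^ T.toReal := by
    rw [← Finset.prod_mul_distrib, ← ENNReal.prod_rpow_of_nonneg hTr.le]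
    apply Finset.prod_congr rfl
    intro j _
    by_cases h : t j = ∞
    · simp [hK, h, hb]
    · simp only [hK, h, if_false, one_mul, hb]
      rw [eNorm_of_ne_top h, ← ENNReal.rpow_mul, ENNReal.toReal_inv (t j)]
      congr 1
      ring
  rw [h2] at h1
  calc _ ≤ ((∏ j, eNorm (t j) μ (G j)) ^ T.toReal) ^ (1 / T.toReal) :=
        ENNReal.rpow_le_rpow h1 (by positivity)
    _ = _ := by
        rw [← ENNReal.rpow_mul, mul_one_div_cancel hTr.ne', ENNReal.rpow_one]

lemma minkowski {α Ω : Type*} [MeasurableSpace α] [MeasurableSpace Ω] (ν : Measure α)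
    [IsFiniteMeasure ν] (μ : Measure Ω) [SFinite μ] {s : ℝ≥0∞} (hs : 1 < s)
    (h : α → Ω → ℝ≥0∞) (hh : Measurable (Function.uncurry h)) :
    eNorm s μ (fun ω => ∫⁻ y, h y ω ∂ν) ≤ ∫⁻ y, eNorm s μ (h y) ∂ν := by
  have hHm := measurable_eNorm s μ h hh
  by_cases hst : s = ∞
  · subst hst
    simp only [eNorm_top] at hHm ⊢
    refine essSup_le_of_ae_le _ ?_
    have h1 : ∀ᵐ y ∂ν, ∀ᵐ ω ∂μ, h y ω ≤ essSup (h y) μ :=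
      Filter.Eventually.of_forall fun y => ENNReal.ae_le_essSup (h y)
    have h2 : ∀ᵐ ω ∂μ, ∀ᵐ y ∂ν, h y ω ≤ essSup (h y) μ := by
      rw [Measure.ae_ae_comm] at h1
      · exact h1
      · exact measurableSet_le hh (hHm.comp measurable_fst)
    filter_upwards [h2] with ω hω
    exact lintegral_mono_ae hω
  · have hs1 : 1 < s.toReal := by
      rw [← ENNReal.toReal_one]; exact (ENNReal.toReal_lt_toReal (by simp) hst).2 hs
    have hs0 : 0 < s.toReal := by linarith
    set H : α → ℝ≥0∞ := fun y => eNorm s μ (h y) with hH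
    set S := s.toReal with hS
    by_cases hfin : ∫⁻ y, H y ∂ν = ∞
    · rw [hfin]; exact le_top
    apply ENNReal.le_of_forall_pos_le_add
    intro e he _
    obtain ⟨ε, hε0, hεt, hεe⟩ : ∃ ε : ℝ≥0∞, ε ≠ 0 ∧ ε ≠ ∞ ∧ ε * ν Set.univ ≤ e := by
      refine ⟨e / (ν Set.univ + 1), ?_, ?_, ?_⟩
      · simp [he.ne']
      · exact ENNReal.div_ne_top (by simp) (by simp)
      · rw [mul_comm, ← mul_div_assoc, mul_comm]
        apply ENNReal.div_le_of_le_mul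
        gcongr; exact le_self_add
    set W : α → ℝ≥0∞ := fun y => H y + ε with hW
    have hWm : Measurable W := hHm.add_const ε
    have hWint : ∫⁻ y, W y ∂ν ≤ ∫⁻ y, H y ∂ν + e := by
      rw [hW, lintegral_add_right _ measurable_const, lintegral_const]
      gcongr
    have hW0 : ∀ y, W y ≠ 0 := fun y => by simp [hW, hε0]
    have hWt : ∀ᵐ y ∂ν, W y ≠ ∞ := by
      filter_upwards [ae_lt_top hHm hfin] with y hy
      simp [hW, hy.ne, hεt]
    refine le_trans ?_ hWint
    rw [eNorm_of_ne_top hst]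
    have hconj : S.HolderConjugate (S.conjExponent) := Real.HolderConjugate.conjExponent hs1
    set S' := S.conjExponent with hS'
    have hsec : ∀ ω, Measurable fun y => h y ω := fun ω => hh.comp measurable_prodMk_right
    have hpt : ∀ ω, (∫⁻ y, h y ω ∂ν) ^ S ≤
        (∫⁻ y, h y ω ^ S * W y ^ (1 - S) ∂ν) * (∫⁻ y, W y ∂ν) ^ (S - 1) := by
      intro ω
      have e1 : ∫⁻ y, h y ω ∂ν = ∫⁻ y, ((fun y => h y ω * W y ^ (-(1/S'))) *
          (fun y => W y ^ (1/S'))) y ∂ν := by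
        apply lintegral_congr_ae
        filter_upwards [hWt] with y hy
        simp only [Pi.mul_apply]
        rw [mul_assoc, ← ENNReal.rpow_add _ _ (hW0 y) hy]
        simp
      have h3 := ENNReal.lintegral_mul_le_Lp_mul_Lq ν hconj
        (f := fun y => h y ω * W y ^ (-(1/S'))) (g := fun y => W y ^ (1/S'))
        ((hsec ω).mul (hWm.pow_const _)).aemeasurable (hWm.pow_const _).aemeasurable
      rw [← e1] at h3
      have hS'0 : 0 < S' := hconj.symm.pos
      have rel : S / S' = S - 1 := by
        have := hconj.div_conj_eq_sub_one
        exact this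
      calc (∫⁻ y, h y ω ∂ν) ^ S ≤ _ := ENNReal.rpow_le_rpow h3 hs0.le
        _ = _ := by
          rw [ENNReal.mul_rpow_of_nonneg _ _ hs0.le, ← ENNReal.rpow_mul, ← ENNReal.rpow_mul]
          congr 1
          · rw [one_div_mul_cancel hs0.ne', ENNReal.rpow_one]
            apply lintegral_congr
            intro y
            rw [ENNReal.mul_rpow_of_nonneg _ _ hs0.le, ← ENNReal.rpow_mul]
            congr 2
            rw [show -(1/S') * S = -(S / S') by ring, rel]; ring
          · congr 1
            · apply lintegral_congr
              intro y
              rw [← ENNReal.rpow_mul, one_div_mul_cancel hS'0.ne', ENNReal.rpow_one]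
            · rw [← rel]; ring
    have hWint' : ∫⁻ y, W y ∂ν ≠ ∞ := ne_top_of_le_ne_top (by simp [hfin]) hWint
    have h4 : ∫⁻ ω, (∫⁻ y, h y ω ∂ν) ^ S ∂μ ≤ (∫⁻ y, W y ∂ν) ^ S := by
      have hjoint : Measurable (Function.uncurry fun (ω : Ω) (y : α) => h y ω ^ S * W y ^ (1 - S)) := by
        apply Measurable.mul
        · exact (hh.comp measurable_swap).pow_const _
        · exact (hWm.comp measurable_snd).pow_const _
      calc ∫⁻ ω, (∫⁻ y, h y ω ∂ν) ^ S ∂μ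
          ≤ ∫⁻ ω, (∫⁻ y, h y ω ^ S * W y ^ (1 - S) ∂ν) * (∫⁻ y, W y ∂ν) ^ (S - 1) ∂μ :=
            lintegral_mono hpt
        _ = (∫⁻ ω, ∫⁻ y, h y ω ^ S * W y ^ (1 - S) ∂ν ∂μ) * (∫⁻ y, W y ∂ν) ^ (S - 1) := by
            rw [lintegral_mul_const' _ _ (ENNReal.rpow_ne_top_of_nonneg (by linarith) hWint')]
        _ = (∫⁻ y, ∫⁻ ω, h y ω ^ S * W y ^ (1 - S) ∂μ ∂ν) * (∫⁻ y, W y ∂ν) ^ (S - 1) := by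
            rw [lintegral_lintegral_swap hjoint.aemeasurable]
        _ ≤ (∫⁻ y, W y ∂ν) * (∫⁻ y, W y ∂ν) ^ (S - 1) := by
            gcongr ?_ * _
            apply lintegral_mono_ae
            filter_upwards [hWt] with y hy
            have hyM : Measurable fun ω => h y ω ^ S :=
              (hh.comp (measurable_prodMk_left (x := y))).pow_const S
            rw [lintegral_mul_const _ hyM]
            have : ∫⁻ ω, h y ω ^ S ∂μ = H y ^ S := by
              rw [hH, hS, eNorm_pow_eq (by intro h; simp [h] at hs) hst]
            have this' : ∫⁻ ω, h y ω ^ S ∂μ ≤ W y ^ S := by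
              rw [this]; exact ENNReal.rpow_le_rpow le_self_add hs0.le
            calc _ ≤ W y ^ S * W y ^ (1 - S) := by gcongr
              _ = W y := by
                rw [← ENNReal.rpow_add _ _ (hW0 y) hy]; simp
        _ = _ := by
            conv_rhs => rw [show S = 1 + (S - 1) by ring]
            rw [ENNReal.rpow_add_of_nonneg _ _ zero_le_one (by linarith), ENNReal.rpow_one]
    calc _ ≤ ((∫⁻ y, W y ∂ν) ^ S) ^ (1 / S) := ENNReal.rpow_le_rpow h4 (by positivity)
      _ = _ := by rw [← ENNReal.rpow_mul, mul_one_div_cancel hs0.ne', ENNReal.rpow_one]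


lemma Cube.set_eq_pi {d : ℕ} (Q : Cube d) :
    Q.set = Set.pi Set.univ (fun i => Set.Ico (Q.corner i) (Q.corner i + Q.side)) := by
  ext x
  simp only [Cube.set, Set.mem_ofPred_eq, Set.mem_pi, Set.mem_univ, true_imp_iff, Set.mem_Ico]

lemma Cube.measurableSet {d : ℕ} (Q : Cube d) : MeasurableSet Q.set := by
  rw [Q.set_eq_pi]
  exact MeasurableSet.univ_pi fun i => measurableSet_Ico

lemma Cube.vol_eq {d : ℕ} (Q : Cube d) : Q.vol = ENNReal.ofReal Q.side ^ d := by
  unfold Cube.vol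
  rw [Q.set_eq_pi, Real.volume_pi_Ico]
  simp

lemma Cube.vol_ne_zero {d : ℕ} (Q : Cube d) : Q.vol ≠ 0 := by
  rw [Q.vol_eq]
  have := Q.side_pos
  apply pow_ne_zero
  simpa using this

lemma Cube.vol_ne_top {d : ℕ} (Q : Cube d) : Q.vol ≠ ∞ := by
  rw [Q.vol_eq]
  exact ENNReal.pow_ne_top ENNReal.ofReal_ne_top

/-- Cubes of the translated and dilated dyadic grid. -/
def gcube {d : ℕ} (s : Fin d → ℝ) (δ : ℝ) (hδ : 0 < δ) (n : ℕ) (a : Fin d → ℤ) : Cube d :=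
  ⟨fun i => s i + δ * 2 ^ n * a i, δ * 2 ^ n, by positivity⟩

/-- The label of the level `n` grid cube containing `x`. -/
def lab {d : ℕ} (s : Fin d → ℝ) (δ : ℝ) (n : ℕ) (x : Fin d → ℝ) : Fin d → ℤ :=
  fun i => ⌊(x i - s i) / (δ * 2 ^ n)⌋

section grid
variable {d : ℕ} (s : Fin d → ℝ) (δ : ℝ) (hδ : 0 < δ)

lemma mem_gcube (n : ℕ) (a : Fin d → ℤ) (x : Fin d → ℝ) :
    x ∈ (gcube s δ hδ n a).set ↔ lab s δ n x = a := by
  have hp : 0 < δ * 2 ^ n := by positivity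
  simp only [Cube.set, gcube, Set.mem_ofPred_eq, funext_iff, lab]
  apply forall_congr'
  intro i
  rw [Int.floor_eq_iff, le_div_iff₀ hp, div_lt_iff₀ hp]
  constructor
  · rintro ⟨h1, h2⟩; constructor <;> nlinarith
  · rintro ⟨h1, h2⟩; constructor <;> nlinarith

lemma lab_succ (n : ℕ) (x : Fin d → ℝ) (i : Fin d) :
    lab s δ (n+1) x i = ⌊((lab s δ n x i : ℤ) : ℝ) / 2⌋ := by
  simp only [lab]
  rw [show (x i - s i) / (δ * 2 ^ (n+1)) = (x i - s i) / (δ * 2 ^ n) / (2:ℕ) by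
    rw [pow_succ, div_div]; push_cast; ring_nf]
  rw [Int.floor_div_natCast]
  have := Int.floor_div_natCast ((⌊(x i - s i) / (δ * 2 ^ n)⌋ : ℤ) : ℝ) 2
  simp only [Int.floor_intCast] at this
  rw [← this]; norm_cast

lemma lab_mono {n n' : ℕ} (h : n ≤ n') {x y : Fin d → ℝ} (hxy : lab s δ n x = lab s δ n y) :
    lab s δ n' x = lab s δ n' y := by
  induction n', h using Nat.le_induction with
  | base => exact hxy
  | succ k _ ih =>
    funext i
    rw [lab_succ, lab_succ, ih]

lemma measurable_lab (n : ℕ) : Measurable (lab s δ n) := by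
  apply measurable_pi_lambda
  intro i
  apply Int.measurable_floor.comp
  exact ((measurable_pi_apply i).sub_const _).div_const _

/-- The grid cube of level `n` containing `x`. -/
def cel (n : ℕ) (x : Fin d → ℝ) : Cube d := gcube s δ hδ n (lab s δ n x)

lemma mem_cel (n : ℕ) (x y : Fin d → ℝ) :
    y ∈ (cel s δ hδ n x).set ↔ lab s δ n y = lab s δ n x := mem_gcube s δ hδ n _ y

lemma self_mem_cel (n : ℕ) (x : Fin d → ℝ) : x ∈ (cel s δ hδ n x).set :=
  (mem_cel s δ hδ n x x).2 rfl

lemma cel_eq_of_mem {n : ℕ} {x y : Fin d → ℝ} (h : y ∈ (cel s δ hδ n x).set) :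
    cel s δ hδ n y = cel s δ hδ n x := by
  unfold cel; rw [(mem_cel s δ hδ n x y).1 h]

lemma cel_eq_of_mem_gcube {n : ℕ} {a : Fin d → ℤ} {y : Fin d → ℝ}
    (h : y ∈ (gcube s δ hδ n a).set) : cel s δ hδ n y = gcube s δ hδ n a := by
  unfold cel; rw [(mem_gcube s δ hδ n a y).1 h]

lemma gcube_nonempty (n : ℕ) (a : Fin d → ℤ) : (gcube s δ hδ n a).set.Nonempty := by
  refine ⟨(gcube s δ hδ n a).corner, fun i => ⟨le_rfl, ?_⟩⟩
  have := (gcube s δ hδ n a).side_pos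
  linarith

lemma cel_subset {n n' : ℕ} (h : n ≤ n') (x : Fin d → ℝ) :
    (cel s δ hδ n x).set ⊆ (cel s δ hδ n' x).set := by
  intro y hy
  rw [mem_cel] at hy ⊢
  exact lab_mono s δ h hy

lemma gcube_nested {n n' : ℕ} (h : n ≤ n') (a a' : Fin d → ℤ) :
    (gcube s δ hδ n a).set ⊆ (gcube s δ hδ n' a').set ∨
      Disjoint (gcube s δ hδ n a).set (gcube s δ hδ n' a').set := by
  by_cases hd : Disjoint (gcube s δ hδ n a).set (gcube s δ hδ n' a').set
  · exact Or.inr hd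
  · left
    obtain ⟨x, hx, hx'⟩ := Set.not_disjoint_iff.1 hd
    rw [← cel_eq_of_mem_gcube s δ hδ hx, ← cel_eq_of_mem_gcube s δ hδ hx']
    exact cel_subset s δ hδ h x

/-- The grid. -/
def InGrid (Q : Cube d) : Prop := ∃ n a, Q = gcube s δ hδ n a

lemma grid_lam (D : Finset (Cube d)) (hD : ∀ Q ∈ D, InGrid s δ hδ Q) : Lam Cube.set D := by
  intro P hP Q hQ
  obtain ⟨n, a, rfl⟩ := hD P hP
  obtain ⟨n', a', rfl⟩ := hD Q hQ
  rcases le_total n n' with h | h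
  · rcases gcube_nested s δ hδ h a a' with h | h
    · exact Or.inl h
    · exact Or.inr (Or.inr h)
  · rcases gcube_nested s δ hδ h a' a with h | h
    · exact Or.inr (Or.inl h)
    · exact Or.inr (Or.inr h.symm)

lemma vol_cel_succ (n : ℕ) (x : Fin d → ℝ) :
    (cel s δ hδ (n+1) x).vol = 2 ^ d * (cel s δ hδ n x).vol := by
  rw [Cube.vol_eq, Cube.vol_eq, ← mul_pow]
  congr 1
  simp only [cel, gcube]
  rw [show (2:ℝ≥0∞) = ENNReal.ofReal 2 by simp, ← ENNReal.ofReal_mul (by norm_num)]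
  congr 1; ring

lemma lintegral_children_le (n : ℕ) (a : Fin d → ℤ) (g h : (Fin d → ℝ) → ℝ≥0∞)
    (hgh : ∀ b, (gcube s δ hδ n b).set ⊆ (gcube s δ hδ (n+1) a).set →
      ∫⁻ y in (gcube s δ hδ n b).set, g y ≤ ∫⁻ y in (gcube s δ hδ n b).set, h y) :
    ∫⁻ y in (gcube s δ hδ (n+1) a).set, g y ≤ ∫⁻ y in (gcube s δ hδ (n+1) a).set, h y := by
  have hU : (gcube s δ hδ (n+1) a).set =
      ⋃ b : {b // (gcube s δ hδ n b).set ⊆ (gcube s δ hδ (n+1) a).set},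
        (gcube s δ hδ n b.1).set := by
    apply Set.Subset.antisymm
    · intro x hx
      rw [Set.mem_iUnion]
      refine ⟨⟨lab s δ n x, ?_⟩, self_mem_cel s δ hδ n x⟩
      rw [← cel_eq_of_mem_gcube s δ hδ hx]
      exact cel_subset s δ hδ (Nat.le_succ n) x
    · exact Set.iUnion_subset fun b => b.2
  have hdis : Pairwise (Function.onFun Disjoint
      (fun b : {b // (gcube s δ hδ n b).set ⊆ (gcube s δ hδ (n+1) a).set} =>
        (gcube s δ hδ n b.1).set)) := by
    intro b b' hb
    rw [Function.onFun, Set.disjoint_left]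
    intro x hx hx'
    rw [mem_gcube] at hx hx'
    exact hb (Subtype.ext (hx.symm.trans hx'))
  conv_lhs => rw [hU]
  conv_rhs => rw [hU]
  rw [lintegral_iUnion (fun b => Cube.measurableSet _) hdis,
    lintegral_iUnion (fun b => Cube.measurableSet _) hdis]
  exact ENNReal.tsum_le_tsum fun b => hgh b.1 b.2

lemma lintegral_children (n : ℕ) (a : Fin d → ℤ) (g h : (Fin d → ℝ) → ℝ≥0∞)
    (hgh : ∀ b, (gcube s δ hδ n b).set ⊆ (gcube s δ hδ (n+1) a).set →
      ∫⁻ y in (gcube s δ hδ n b).set, g y = ∫⁻ y in (gcube s δ hδ n b).set, h y) :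
    ∫⁻ y in (gcube s δ hδ (n+1) a).set, g y = ∫⁻ y in (gcube s δ hδ (n+1) a).set, h y := by
  apply le_antisymm
  · exact lintegral_children_le s δ hδ n a g h fun b hb => (hgh b hb).le
  · exact lintegral_children_le s δ hδ n a h g fun b hb => (hgh b hb).ge

end grid


/-- Average of a nonnegative function over a cube. -/
def av {d : ℕ} (h : (Fin d → ℝ) → ℝ≥0∞) (Q : Cube d) : ℝ≥0∞ := (∫⁻ y in Q.set, h y) / Q.vol

lemma av_mul_vol {d : ℕ} (h : (Fin d → ℝ) → ℝ≥0∞) (Q : Cube d) :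
    av h Q * Q.vol = ∫⁻ y in Q.set, h y :=
  ENNReal.div_mul_cancel Q.vol_ne_zero Q.vol_ne_top

lemma av_congr_set {d : ℕ} (h : (Fin d → ℝ) → ℝ≥0∞) {Q R : Cube d} (hs : Q.set = R.set) :
    av h Q = av h R := by
  unfold av Cube.vol; rw [hs]

lemma av_norm {d : ℕ} {Ω : Type*} [MeasurableSpace Ω] (μ : Measure Ω) [SFinite μ] {s : ℝ≥0∞}
    (hs : 1 < s) (h : (Fin d → ℝ) → Ω → ℝ≥0∞) (hh : Measurable (Function.uncurry h)) (Q : Cube d) :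
    eNorm s μ (fun ω => av (fun y => h y ω) Q) ≤ av (fun y => eNorm s μ (h y)) Q := by
  unfold av
  simp only [ENNReal.div_eq_inv_mul]
  rw [eNorm_const_mul (zero_lt_one.trans hs).ne' μ _ (ENNReal.inv_ne_top.2 Q.vol_ne_zero)]
  have : IsFiniteMeasure (volume.restrict Q.set) := ⟨by
    rw [Measure.restrict_apply_univ]; exact Q.vol_ne_top.lt_top⟩
  gcongr
  exact minkowski (volume.restrict Q.set) μ hs h hh

lemma measurable_av {d : ℕ} {Ω : Type*} [MeasurableSpace Ω]
    (h : (Fin d → ℝ) → Ω → ℝ≥0∞) (hh : Measurable (Function.uncurry h)) (Q : Cube d) :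
    Measurable (fun ω => av (fun y => h y ω) Q) := by
  unfold av
  apply Measurable.div_const
  exact Measurable.lintegral_prod_left' (μ := volume.restrict Q.set) hh

section cz
variable {d : ℕ} (e : Fin d → ℝ) (δ : ℝ) (hδ : 0 < δ) {Ω : Type*}

open Classical in
/-- Calderon-Zygmund type truncation. -/
def cz (H : (Fin d → ℝ) → ℝ≥0∞) (lam : ℝ≥0∞) (h : (Fin d → ℝ) → Ω → ℝ≥0∞) :
    ℕ → (Fin d → ℝ) → Ω → ℝ≥0∞
  | 0, y, ω => av (fun y => h y ω) (cel e δ hδ 0 y)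
  | i+1, y, ω => if lam < av H (cel e δ hδ (i+1) y) then av (fun y => h y ω) (cel e δ hδ (i+1) y)
      else cz H lam h i y ω

lemma measurable_av_cel [MeasurableSpace Ω] (h : (Fin d → ℝ) → Ω → ℝ≥0∞)
    (hh : Measurable (Function.uncurry h)) (n : ℕ) :
    Measurable (fun z : (Fin d → ℝ) × Ω => av (fun y => h y z.2) (cel e δ hδ n z.1)) := by
  have h1 : Measurable (fun z : (Fin d → ℤ) × Ω => av (fun y => h y z.2) (gcube e δ hδ n z.1)) := by
    apply measurable_from_prod_countable_right
    intro a
    exact measurable_av h hh (gcube e δ hδ n a)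
  have h2 : Measurable (fun z : (Fin d → ℝ) × Ω => ((lab e δ n z.1, z.2) : (Fin d → ℤ) × Ω)) :=
    ((measurable_lab e δ n).comp measurable_fst).prodMk measurable_snd
  have h3 := h1.comp h2
  unfold cel
  exact h3

lemma measurable_av_cel' (H : (Fin d → ℝ) → ℝ≥0∞) (n : ℕ) :
    Measurable (fun y => av H (cel e δ hδ n y)) := by
  have h1 : Measurable (fun z : (Fin d → ℤ) => av H (gcube e δ hδ n z)) :=
    measurable_from_top.mono (by rw [show (MeasurableSpace.pi : MeasurableSpace (Fin d → ℤ)) = ⊤ from ?_]; apply le_top.antisymm; intro s _; exact s.to_countable.measurableSet) le_rfl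
  exact h1.comp (measurable_lab e δ n)

lemma measurable_cz [MeasurableSpace Ω] (H : (Fin d → ℝ) → ℝ≥0∞) (lam : ℝ≥0∞)
    (h : (Fin d → ℝ) → Ω → ℝ≥0∞)
    (hh : Measurable (Function.uncurry h)) (n : ℕ) :
    Measurable (Function.uncurry (cz e δ hδ H lam h n)) := by
  induction n with
  | zero => exact measurable_av_cel e δ hδ h hh 0
  | succ n ih =>
    classical
    have : Function.uncurry (cz e δ hδ H lam h (n+1)) = fun z =>
        if lam < av H (cel e δ hδ (n+1) z.1) then av (fun y => h y z.2) (cel e δ hδ (n+1) z.1)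
        else Function.uncurry (cz e δ hδ H lam h n) z := by
      funext z
      simp only [Function.uncurry, cz]
    rw [this]
    refine Measurable.ite ?_ (measurable_av_cel e δ hδ h hh _) ih
    exact measurableSet_lt measurable_const ((measurable_av_cel' e δ hδ H (n+1)).comp measurable_fst)

lemma lintegral_const_on_cube (Q : Cube d) (g h : (Fin d → ℝ) → ℝ≥0∞)
    (hg : ∀ y ∈ Q.set, g y = av h Q) : ∫⁻ y in Q.set, g y = ∫⁻ y in Q.set, h y := by
  rw [setLIntegral_congr_fun Q.measurableSet hg, setLIntegral_const]
  exact av_mul_vol h Q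

lemma cz_int (H : (Fin d → ℝ) → ℝ≥0∞) (lam : ℝ≥0∞) (h : (Fin d → ℝ) → Ω → ℝ≥0∞) (ω : Ω)
    (n : ℕ) : ∀ a, ∫⁻ y in (gcube e δ hδ n a).set, cz e δ hδ H lam h n y ω =
      ∫⁻ y in (gcube e δ hδ n a).set, h y ω := by
  induction n with
  | zero =>
    intro a
    apply lintegral_const_on_cube
    intro y hy
    simp only [cz]
    rw [cel_eq_of_mem_gcube e δ hδ hy]
  | succ n ih =>
    intro a
    by_cases hb : lam < av H (gcube e δ hδ (n+1) a)
    · apply lintegral_const_on_cube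
      intro y hy
      simp only [cz]
      rw [cel_eq_of_mem_gcube e δ hδ hy, if_pos hb]
    · rw [← lintegral_children e δ hδ n a (fun y => cz e δ hδ H lam h n y ω) (fun y => h y ω)
        (fun b _ => ih b)]
      apply setLIntegral_congr_fun (Cube.measurableSet _)
      intro y hy
      simp only [cz]
      rw [cel_eq_of_mem_gcube e δ hδ hy, if_neg hb]

lemma av_cel_le (H : (Fin d → ℝ) → ℝ≥0∞) (n : ℕ) (y : Fin d → ℝ) :
    av H (cel e δ hδ n y) ≤ 2 ^ d * av H (cel e δ hδ (n+1) y) := by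
  unfold av
  rw [vol_cel_succ]
  have h1 : ∫⁻ z in (cel e δ hδ n y).set, H z ≤ ∫⁻ z in (cel e δ hδ (n+1) y).set, H z :=
    lintegral_mono_set (cel_subset e δ hδ (Nat.le_succ n) y)
  have h2 : (2:ℝ≥0∞)^d ≠ 0 := by positivity
  have h3 : (2:ℝ≥0∞)^d ≠ ∞ := by finiteness
  rw [ENNReal.div_eq_inv_mul, ENNReal.div_eq_inv_mul, ENNReal.mul_inv (Or.inl h2) (Or.inl h3),
    ← mul_assoc, ← mul_assoc, ENNReal.mul_inv_cancel h2 h3, one_mul]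
  gcongr

lemma cz_norm [MeasurableSpace Ω] (μ : Measure Ω) [SFinite μ] {s : ℝ≥0∞} (hs : 1 < s)
    (lam : ℝ≥0∞) (h : (Fin d → ℝ) → Ω → ℝ≥0∞) (hh : Measurable (Function.uncurry h))
    (y : Fin d → ℝ) (n : ℕ)
    (hn : av (fun y => eNorm s μ (h y)) (cel e δ hδ n y) ≤ 2 ^ d * lam) :
    eNorm s μ (cz e δ hδ (fun y => eNorm s μ (h y)) lam h n y) ≤ 2 ^ d * lam := by
  induction n with
  | zero => exact (av_norm μ hs h hh _).trans hn
  | succ n ih =>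
    by_cases hb : lam < av (fun y => eNorm s μ (h y)) (cel e δ hδ (n+1) y)
    · have : cz e δ hδ (fun y => eNorm s μ (h y)) lam h (n+1) y =
          fun ω => av (fun y => h y ω) (cel e δ hδ (n+1) y) := by
        funext ω; simp only [cz]; rw [if_pos hb]
      rw [this]
      exact (av_norm μ hs h hh _).trans hn
    · have : cz e δ hδ (fun y => eNorm s μ (h y)) lam h (n+1) y =
          cz e δ hδ (fun y => eNorm s μ (h y)) lam h n y := by
        funext ω; simp only [cz]; rw [if_neg hb]
      rw [this]
      apply ih
      refine (av_cel_le e δ hδ _ n y).trans ?_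
      gcongr
      exact not_lt.1 hb

lemma cz_eq (H : (Fin d → ℝ) → ℝ≥0∞) (lam : ℝ≥0∞) (h : (Fin d → ℝ) → Ω → ℝ≥0∞)
    (x : Fin d → ℝ) (l n : ℕ) (hl : l ≤ n) (hx : ∀ k ≤ n, av H (cel e δ hδ k x) ≤ lam)
    (y : Fin d → ℝ) (hy : y ∈ (cel e δ hδ l x).set) (ω : Ω) :
    cz e δ hδ H lam h n y ω = cz e δ hδ H lam h l y ω := by
  induction n, hl using Nat.le_induction with
  | base => rfl
  | succ n hln ih =>
    rw [← ih fun k hk => hx k (hk.trans (Nat.le_succ n))]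
    have : cel e δ hδ (n+1) y = cel e δ hδ (n+1) x :=
      cel_eq_of_mem e δ hδ (cel_subset e δ hδ (hln.trans (Nat.le_succ n)) x hy)
    simp only [cz]
    rw [this, if_neg (not_lt.2 (hx _ le_rfl))]

lemma bad_bound (H : (Fin d → ℝ) → ℝ≥0∞) (lam : ℝ≥0∞) (n : ℕ) : ∀ a,
    lam * volume ({x | ∃ k ≤ n, lam < av H (cel e δ hδ k x)} ∩ (gcube e δ hδ n a).set) ≤
      ∫⁻ y in (gcube e δ hδ n a).set, H y := by
  have hmeas : ∀ n, MeasurableSet {x | ∃ k ≤ n, lam < av H (cel e δ hδ k x)} := by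
    intro n
    have : {x | ∃ k ≤ n, lam < av H (cel e δ hδ k x)} =
        ⋃ k : ℕ, ⋃ (_ : k ≤ n), {x | lam < av H (cel e δ hδ k x)} := by
      ext x; simp
    rw [this]
    exact MeasurableSet.iUnion fun k => MeasurableSet.iUnion fun _ =>
      measurableSet_lt measurable_const (measurable_av_cel' e δ hδ H k)
  have top : ∀ n a, lam < av H (gcube e δ hδ n a) →
      lam * volume ({x | ∃ k ≤ n, lam < av H (cel e δ hδ k x)} ∩ (gcube e δ hδ n a).set) ≤
      ∫⁻ y in (gcube e δ hδ n a).set, H y := by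
    intro n a hb
    rw [← av_mul_vol]
    gcongr
    exact measure_mono Set.inter_subset_right
  induction n with
  | zero =>
    intro a
    by_cases hb : lam < av H (gcube e δ hδ 0 a)
    · exact top 0 a hb
    · have : {x | ∃ k ≤ 0, lam < av H (cel e δ hδ k x)} ∩ (gcube e δ hδ 0 a).set = ∅ := by
        ext x
        simp only [Set.mem_inter_iff, Set.mem_ofPred_eq, Set.mem_empty_iff_false, iff_false]
        rintro ⟨⟨k, hk, h1⟩, hx⟩
        obtain rfl : k = 0 := by omega
        rw [cel_eq_of_mem_gcube e δ hδ hx] at h1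
        exact hb h1
      rw [this]; simp
  | succ n ih =>
    intro a
    by_cases hb : lam < av H (gcube e δ hδ (n+1) a)
    · exact top _ a hb
    · have h1 : {x | ∃ k ≤ n+1, lam < av H (cel e δ hδ k x)} ∩ (gcube e δ hδ (n+1) a).set =
        {x | ∃ k ≤ n, lam < av H (cel e δ hδ k x)} ∩ (gcube e δ hδ (n+1) a).set := by
        ext x
        simp only [Set.mem_inter_iff, Set.mem_ofPred_eq]
        constructor
        · rintro ⟨⟨k, hk, h1⟩, hx⟩
          refine ⟨⟨k, ?_, h1⟩, hx⟩
          by_contra hkn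
          obtain rfl : k = n+1 := by omega
          rw [cel_eq_of_mem_gcube e δ hδ hx] at h1
          exact hb h1
        · rintro ⟨⟨k, hk, h1⟩, hx⟩
          exact ⟨⟨k, by omega, h1⟩, hx⟩
      have h2 : ∀ b, lam * volume ({x | ∃ k ≤ n, lam < av H (cel e δ hδ k x)} ∩ (b : Cube d).set)
          = ∫⁻ y in b.set, {x | ∃ k ≤ n, lam < av H (cel e δ hδ k x)}.indicator (fun _ => lam) y := by
        intro b
        rw [lintegral_indicator (hmeas n), setLIntegral_const, Measure.restrict_apply (hmeas n)]
      rw [h1, h2]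
      apply lintegral_children_le e δ hδ n a
      intro b _
      rw [← h2]
      exact ih b

end cz


lemma half_mul_inv {ε : ℝ≥0∞} (hε : ε ≠ 0) (hε' : ε ≠ ∞) : ε / 2 * (2 / ε) = 1 := by
  rw [ENNReal.div_eq_inv_mul, ENNReal.div_eq_inv_mul]
  calc 2⁻¹ * ε * (ε⁻¹ * 2) = (2⁻¹ * 2) * (ε * ε⁻¹) := by ring
    _ = 1 := by rw [ENNReal.mul_inv_cancel hε hε', ENNReal.inv_mul_cancel (by simp) (by simp), one_mul]

lemma grid_sub_level {d : ℕ} (e : Fin d → ℝ) (δ : ℝ) (hδ : 0 < δ) {Q : Cube d}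
    (hQ : InGrid e δ hδ Q) {n : ℕ} {a : Fin d → ℤ} (hs : Q.set ⊆ (gcube e δ hδ n a).set)
    {x : Fin d → ℝ} (hx : x ∈ Q.set) : ∃ l ≤ n, Q.set = (cel e δ hδ l x).set := by
  obtain ⟨k, b, rfl⟩ := hQ
  rcases le_total k n with h | h
  · exact ⟨k, h, by rw [cel_eq_of_mem_gcube e δ hδ hx]⟩
  · refine ⟨n, le_rfl, ?_⟩
    rw [cel_eq_of_mem_gcube e δ hδ (hs hx)]
    apply Set.Subset.antisymm hs
    rw [← cel_eq_of_mem_gcube e δ hδ hx, ← cel_eq_of_mem_gcube e δ hδ (hs hx)]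
    exact cel_subset e δ hδ h x

lemma measurable_mx2 {d : ℕ} {Ω : Type*} [MeasurableSpace Ω] (D : Finset (Cube d))
    (A : Cube d → Ω → ℝ≥0∞) (hA : ∀ Q, Measurable (A Q)) :
    Measurable (Function.uncurry (fun (x : Fin d → ℝ) ω => mx Cube.set D (fun Q => A Q ω) x)) := by
  have : Function.uncurry (fun (x : Fin d → ℝ) ω => mx Cube.set D (fun Q => A Q ω) x) =
      fun z => ⨆ Q ∈ D, (Q.set ×ˢ Set.univ).indicator (fun z : (Fin d → ℝ) × Ω => A Q z.2) z := by
    funext z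
    simp only [Function.uncurry]
    rw [mx_eq]
    refine iSup_congr fun Q => iSup_congr fun hQ => ?_
    by_cases h : z.1 ∈ Q.set <;> simp [Set.indicator, h]
  rw [this]
  exact Measurable.biSup _ D.countable_toSet (fun Q _ =>
    ((hA Q).comp measurable_snd).indicator (Q.measurableSet.prod MeasurableSet.univ))

lemma eNorm_eq_zero {Ω : Type*} [MeasurableSpace Ω] (μ : Measure Ω) {s : ℝ≥0∞} (hs : s ≠ 0)
    (G : Ω → ℝ≥0∞) (hG : Measurable G) (h0 : eNorm s μ G = 0) : ∀ᵐ ω ∂μ, G ω = 0 := by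
  by_cases hst : s = ∞
  · subst hst
    rw [eNorm_top] at h0
    filter_upwards [ENNReal.ae_le_essSup (μ := μ) G] with ω hω
    rw [h0] at hω
    exact le_antisymm hω bot_le
  · have hpos : 0 < s.toReal := ENNReal.toReal_pos hs hst
    have h1 := eNorm_pow_eq hs hst μ G
    rw [h0, ENNReal.zero_rpow_of_pos hpos] at h1
    have h2 := (lintegral_eq_zero_iff (hG.pow_const _)).1 h1.symm
    filter_upwards [h2] with ω hω
    simpa [ENNReal.rpow_eq_zero_iff, hpos, not_lt.2 hpos.le] using hω

lemma eNorm_zero_of_ae {Ω : Type*} [MeasurableSpace Ω] (μ : Measure Ω) {s : ℝ≥0∞} (hs : s ≠ 0)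
    (G : Ω → ℝ≥0∞) (h0 : ∀ᵐ ω ∂μ, G ω = 0) : eNorm s μ G = 0 := by
  apply le_antisymm _ bot_le
  calc eNorm s μ G ≤ eNorm s μ (fun ω => 0 * (0:ℝ≥0∞)) :=
        eNorm_mono_ae s μ (by filter_upwards [h0] with ω h; simp [h])
    _ = 0 := by rw [eNorm_const_mul hs μ _ (by simp), zero_mul]

/-- Weak type estimate, infinite exponent and bad set. -/
lemma weak_strong {d : ℕ} {Ω : Type*} [MeasurableSpace Ω] (μ : Measure Ω) [SFinite μ] {s : ℝ≥0∞}
    (hs : 1 < s) (hst : s ≠ ∞) (h : (Fin d → ℝ) → Ω → ℝ≥0∞) (hh : Measurable (Function.uncurry h))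
    (e : Fin d → ℝ) (δ : ℝ) (hδ : 0 < δ) (D : Finset (Cube d)) (Q0 : Cube d)
    (hD : ∀ Q ∈ D, InGrid e δ hδ Q ∧ Q.set ⊆ Q0.set) (M : ℝ≥0∞)
    (hM : ∀ y ∈ Q0.set, eNorm s μ (h y) ≤ M) :
    ∫⁻ x in Q0.set, (eNorm s μ (fun ω => mx Cube.set D (fun Q => av (fun y => h y ω) Q) x)) ^ s.toReal
      ≤ ENNReal.ofReal (2 ^ s.toReal * s.toReal / (s.toReal - 1)) * (M ^ s.toReal * Q0.vol) := by
  have hs0 : s ≠ 0 := (zero_lt_one.trans hs).ne'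
  have hs1 : 1 < s.toReal := by
    rw [← ENNReal.toReal_one]; exact (ENNReal.toReal_lt_toReal (by simp) hst).2 hs
  have hLam := grid_lam e δ hδ D fun Q hQ => (hD Q hQ).1
  have hmm := measurable_mx2 D (fun Q ω => av (fun y => h y ω) Q) (fun Q => measurable_av h hh Q)
  simp_rw [eNorm_pow_eq hs0 hst]
  rw [lintegral_lintegral_swap (hmm.pow_const _).aemeasurable]
  have hdoob : ∀ ω, ∫⁻ x in Q0.set, mx Cube.set D (fun Q => av (fun y => h y ω) Q) x ^ s.toReal ≤
      ENNReal.ofReal (2 ^ s.toReal * s.toReal / (s.toReal - 1)) *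
        ∫⁻ x in Q0.set, h x ω ^ s.toReal := by
    intro ω
    have hω : Measurable (fun y => h y ω) := hh.comp (measurable_id.prodMk measurable_const)
    have := doob Cube.set Cube.measurableSet D hLam (volume.restrict Q0.set) (by
      intro Q hQ
      apply ne_top_of_le_ne_top Q.vol_ne_top
      exact Measure.restrict_apply_le _ _) (fun y => h y ω) hω s.toReal hs1
    refine le_trans (le_of_eq ?_) this
    congr 1
    funext x
    congr 1
    unfold mx
    refine iSup_congr fun Q => iSup_congr fun hQ => iSup_congr fun hx => ?_
    beta_reduce
    rw [Measure.restrict_restrict_of_subset (hD Q hQ).2, Measure.restrict_apply Q.measurableSet,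
      Set.inter_eq_left.2 (hD Q hQ).2]
    rfl
  refine (lintegral_mono hdoob).trans ?_
  rw [lintegral_const_mul _ (Measurable.lintegral_prod_left' (μ := volume.restrict Q0.set)
    (f := fun z : (Fin d → ℝ) × Ω => h z.1 z.2 ^ s.toReal) (hh.pow_const s.toReal))]
  gcongr
  rw [lintegral_lintegral_swap (by
    exact ((hh.comp measurable_swap).pow_const s.toReal).aemeasurable)]
  calc ∫⁻ y in Q0.set, ∫⁻ x, h y x ^ s.toReal ∂μ ≤ ∫⁻ y in Q0.set, M ^ s.toReal := by
        apply setLIntegral_mono measurable_const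
        intro y hy
        rw [← eNorm_pow_eq hs0 hst]
        gcongr
        exact hM y hy
    _ = M ^ s.toReal * Q0.vol := by rw [setLIntegral_const]; rfl

lemma weak1 (d : ℕ) (s : ℝ≥0∞) (hs : 1 < s) (ε : ℝ≥0∞) (hε : ε ≠ 0) (hε' : ε ≠ ∞) :
    ∃ K : ℝ≥0∞, K ≠ ∞ ∧ K ≠ 0 ∧ ∀ (Ω : Type) [MeasurableSpace Ω] (μ : Measure Ω) [SFinite μ]
      (e : Fin d → ℝ) (δ : ℝ) (hδ : 0 < δ) (h : (Fin d → ℝ) → Ω → ℝ≥0∞)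
      (_ : Measurable (Function.uncurry h)) (D : Finset (Cube d)) (Q0 : Cube d)
      (_ : InGrid e δ hδ Q0) (_ : ∀ Q ∈ D, InGrid e δ hδ Q ∧ Q.set ⊆ Q0.set),
      volume {x | x ∈ Q0.set ∧ K * av (fun y => eNorm s μ (h y)) Q0 <
        eNorm s μ (fun ω => mx Cube.set D (fun Q => av (fun y => h y ω) Q) x)} ≤ ε * Q0.vol := by
  have hs0 : s ≠ 0 := (zero_lt_one.trans hs).ne'
  set K1 : ℝ≥0∞ := max 1 (2 / ε) with hK1
  have hK1t : K1 ≠ ∞ := by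
    rw [hK1]; exact max_ne_top (by simp) (ENNReal.div_ne_top (by simp) hε)
  have hK10 : K1 ≠ 0 := (zero_lt_one.trans_le (le_max_left _ _)).ne'
  have hK1e : 1 ≤ ε / 2 * K1 := by
    calc (1:ℝ≥0∞) = ε / 2 * (2 / ε) := by
          exact (half_mul_inv hε hε').symm
      _ ≤ _ := by gcongr; exact le_max_right _ _
  set K2 : ℝ≥0∞ := max 1 ((ENNReal.ofReal (2 ^ s.toReal * s.toReal / (s.toReal - 1)) *
    (2 ^ d) ^ s.toReal * (2 / ε)) ^ (1 / s.toReal)) with hK2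
  have hK2t : K2 ≠ ∞ := by
    rw [hK2]
    refine max_ne_top (by simp) ?_
    apply ENNReal.rpow_ne_top_of_nonneg (by positivity)
    refine ENNReal.mul_ne_top (ENNReal.mul_ne_top (by simp) ?_) (ENNReal.div_ne_top (by simp) hε)
    exact ENNReal.rpow_ne_top_of_nonneg (by positivity) (by finiteness)
  have hK20 : K2 ≠ 0 := (zero_lt_one.trans_le (le_max_left _ _)).ne'
  refine ⟨K2 * K1, ENNReal.mul_ne_top hK2t hK1t, mul_ne_zero hK20 hK10, ?_⟩
  intro Ω _ μ _ e δ hδ h hh D Q0 hQ0 hD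
  obtain ⟨n, a0, rfl⟩ := hQ0
  set Q0 := gcube e δ hδ n a0 with hQ0
  set H : (Fin d → ℝ) → ℝ≥0∞ := fun y => eNorm s μ (h y) with hH
  set a := av H Q0 with ha
  by_cases hat : a = ∞
  · have : {x | x ∈ Q0.set ∧ K2 * K1 * a <
        eNorm s μ (fun ω => mx Cube.set D (fun Q => av (fun y => h y ω) Q) x)} = ∅ := by
      ext x
      rw [hat, ENNReal.mul_top (mul_ne_zero hK20 hK10)]
      simp
    rw [this]; simp
  by_cases ha0 : a = 0
  · have : {x | x ∈ Q0.set ∧ K2 * K1 * a <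
        eNorm s μ (fun ω => mx Cube.set D (fun Q => av (fun y => h y ω) Q) x)} = ∅ := by
      ext x
      rw [ha0, mul_zero]
      simp only [Set.mem_ofPred_eq, Set.mem_empty_iff_false, iff_false, not_and, not_lt]
      intro _
      apply le_of_eq
      apply eNorm_zero_of_ae μ hs0
      have hall : ∀ Q ∈ D, ∀ᵐ ω ∂μ, av (fun y => h y ω) Q = 0 := by
        intro Q hQ
        apply eNorm_eq_zero μ hs0 _ (measurable_av h hh Q)
        apply le_antisymm _ bot_le
        refine (av_norm μ hs h hh Q).trans ?_
        have h1 : ∫⁻ y in Q.set, H y ≤ ∫⁻ y in Q0.set, H y := lintegral_mono_set (hD Q hQ).2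
        rw [← av_mul_vol, ← av_mul_vol, ← ha, ha0, zero_mul, nonpos_iff_eq_zero, mul_eq_zero] at h1
        exact (h1.resolve_right Q.vol_ne_zero).le
      have := (ae_ball_iff D.countable_toSet).2 hall
      filter_upwards [this] with ω hω
      apply le_antisymm _ bot_le
      apply mx_le
      intro Q hQ _
      exact (hω Q hQ).le
    rw [this]; simp
  set lam := K1 * a with hlam
  have hlam0 : lam ≠ 0 := mul_ne_zero hK10 ha0
  have hlamt : lam ≠ ∞ := ENNReal.mul_ne_top hK1t hat
  have halam : a ≤ lam := by
    calc a = 1 * a := (one_mul a).symm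
      _ ≤ lam := by rw [hlam]; gcongr; exact le_max_left _ _
  set B := {x | ∃ k ≤ n, lam < av H (cel e δ hδ k x)} with hB
  have hBb : volume (B ∩ Q0.set) ≤ ε / 2 * Q0.vol := by
    have h1 := bad_bound e δ hδ H lam n a0
    rw [← av_mul_vol, ← ha] at h1
    have h2 : a * (K1 * volume (B ∩ Q0.set)) ≤ a * Q0.vol := by
      rw [← mul_assoc, mul_comm a K1]; exact h1
    have h3 : K1 * volume (B ∩ Q0.set) ≤ Q0.vol := (ENNReal.mul_le_mul_iff_right ha0 hat).1 h2
    calc volume (B ∩ Q0.set) ≤ (ε / 2 * K1) * volume (B ∩ Q0.set) := le_mul_of_one_le_left' hK1e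
      _ = ε / 2 * (K1 * volume (B ∩ Q0.set)) := by rw [mul_assoc]
      _ ≤ _ := by gcongr
  have hgood : ∀ x ∉ B, ∀ k ≤ n, av H (cel e δ hδ k x) ≤ lam := by
    intro x hx k hk
    by_contra hc
    exact hx ⟨k, hk, not_le.1 hc⟩
  by_cases hst : s = ∞
  · have hsub : {x | x ∈ Q0.set ∧ K2 * K1 * a <
        eNorm s μ (fun ω => mx Cube.set D (fun Q => av (fun y => h y ω) Q) x)} ⊆ B ∩ Q0.set := by
      rintro x ⟨hx, hlt⟩
      refine ⟨?_, hx⟩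
      by_contra hxB
      apply not_le.2 hlt
      have hle : eNorm s μ (fun ω => mx Cube.set D (fun Q => av (fun y => h y ω) Q) x) ≤ lam := by
        have hall : ∀ Q ∈ D, ∀ᵐ ω ∂μ, av (fun y => h y ω) Q ≤ av H Q := by
          intro Q hQ
          have h1 := av_norm μ hs h hh Q
          nth_rewrite 1 [hst] at h1
          rw [eNorm_top] at h1
          filter_upwards [ENNReal.ae_le_essSup (μ := μ) (fun ω => av (fun y => h y ω) Q)] with ω hω
          exact hω.trans h1
        have hb := (ae_ball_iff D.countable_toSet).2 hall
        rw [hst, eNorm_top]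
        refine essSup_le_of_ae_le _ ?_
        filter_upwards [hb] with ω hω
        apply mx_le
        intro Q hQ hxQ
        refine (hω Q hQ).trans ?_
        obtain ⟨l, hl, hset⟩ := grid_sub_level e δ hδ (hD Q hQ).1 (hD Q hQ).2 hxQ
        rw [av_congr_set H hset]
        exact hgood x hxB l hl
      refine hle.trans ?_
      rw [mul_assoc]
      exact le_mul_of_one_le_left' (le_max_left _ _)
    refine (measure_mono hsub).trans (hBb.trans ?_)
    gcongr
    exact ENNReal.half_le_self
  · have hs1 : 1 < s.toReal := by
      rw [← ENNReal.toReal_one]; exact (ENNReal.toReal_lt_toReal (by simp) hst).2 hs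
    have hspos : 0 < s.toReal := by linarith
    set g := cz e δ hδ H lam h n with hg
    have hgm : Measurable (Function.uncurry g) := measurable_cz e δ hδ H lam h hh n
    set Φ : (Fin d → ℝ) → ℝ≥0∞ :=
      fun x => eNorm s μ (fun ω => mx Cube.set D (fun Q => av (fun y => g y ω) Q) x) with hΦ
    have hΦm : Measurable Φ := measurable_eNorm s μ _
      (measurable_mx2 D (fun Q ω => av (fun y => g y ω) Q) (fun Q => measurable_av g hgm Q))
    have hgM : ∀ y ∈ Q0.set, eNorm s μ (g y) ≤ 2 ^ d * lam := by
      intro y hy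
      apply cz_norm e δ hδ μ hs lam h hh y n
      rw [cel_eq_of_mem_gcube e δ hδ hy]
      refine halam.trans (le_mul_of_one_le_left' ?_)
      exact one_le_pow₀ (by norm_num)
    have hst2 := weak_strong μ hs hst g hgm e δ hδ D Q0 hD _ hgM
    have hcheb : volume ({x | K2 * lam < Φ x} ∩ Q0.set) ≤ ε / 2 * Q0.vol := by
      have h1 := mul_meas_ge_le_lintegral₀ (μ := volume.restrict Q0.set)
        (f := fun x => Φ x ^ s.toReal) (hΦm.pow_const _).aemeasurable ((K2 * lam) ^ s.toReal)
      have h2 : volume ({x | K2 * lam < Φ x} ∩ Q0.set) ≤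
          (volume.restrict Q0.set) {x | (K2 * lam) ^ s.toReal ≤ Φ x ^ s.toReal} := by
        rw [Measure.restrict_apply' Q0.measurableSet]
        apply measure_mono
        rintro x ⟨hx, hx'⟩
        refine ⟨?_, hx'⟩
        have : K2 * lam < Φ x := hx
        exact ENNReal.rpow_le_rpow this.le hspos.le
      set Cs := ENNReal.ofReal (2 ^ s.toReal * s.toReal / (s.toReal - 1)) with hCs
      set V := volume ({x | K2 * lam < Φ x} ∩ Q0.set) with hV
      have h3 : (K2 * lam) ^ s.toReal * V ≤ Cs * ((2 ^ d * lam) ^ s.toReal * Q0.vol) :=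
        (mul_le_mul_right h2 _).trans (h1.trans hst2)
      rw [ENNReal.mul_rpow_of_nonneg K2 lam hspos.le, ENNReal.mul_rpow_of_nonneg _ lam hspos.le] at h3
      have hl0 : lam ^ s.toReal ≠ 0 := by
        rw [ne_eq, ENNReal.rpow_eq_zero_iff]; push Not; exact ⟨fun h => absurd h hlam0, fun h => absurd h hlamt⟩
      have hlt : lam ^ s.toReal ≠ ∞ := ENNReal.rpow_ne_top_of_nonneg hspos.le hlamt
      have h4 : K2 ^ s.toReal * V ≤ Cs * (2 ^ d) ^ s.toReal * Q0.vol := by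
        apply (ENNReal.mul_le_mul_iff_right hl0 hlt).1
        calc lam ^ s.toReal * (K2 ^ s.toReal * V) = K2 ^ s.toReal * lam ^ s.toReal * V := by ring
          _ ≤ _ := h3
          _ = _ := by ring
      have h5 : Cs * (2 ^ d) ^ s.toReal * (2 / ε) ≤ K2 ^ s.toReal := by
        calc Cs * (2 ^ d) ^ s.toReal * (2 / ε) =
            ((Cs * (2 ^ d) ^ s.toReal * (2 / ε)) ^ (1 / s.toReal)) ^ s.toReal := by
              rw [← ENNReal.rpow_mul, one_div_mul_cancel hspos.ne', ENNReal.rpow_one]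
          _ ≤ _ := by
            apply ENNReal.rpow_le_rpow _ hspos.le
            rw [hK2]; exact le_max_right _ _
      have hCs0 : Cs * (2 ^ d) ^ s.toReal ≠ 0 := by
        apply mul_ne_zero
        · rw [hCs, ne_eq, ENNReal.ofReal_eq_zero, not_le]
          have : 0 < s.toReal - 1 := by linarith
          positivity
        · rw [ne_eq, ENNReal.rpow_eq_zero_iff]; push Not
          exact ⟨fun h => absurd h (by positivity), fun h => absurd h (by finiteness)⟩
      have hCst : Cs * (2 ^ d) ^ s.toReal ≠ ∞ := by
        apply ENNReal.mul_ne_top (by simp [hCs])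
        exact ENNReal.rpow_ne_top_of_nonneg (by positivity) (by finiteness)
      have h6 : 2 / ε * V ≤ Q0.vol := by
        apply (ENNReal.mul_le_mul_iff_right hCs0 hCst).1
        rw [← mul_assoc]
        exact (mul_le_mul_left h5 _).trans h4
      calc V = ε / 2 * (2 / ε) * V := by
            rw [half_mul_inv hε hε', one_mul]
        _ = ε / 2 * (2 / ε * V) := by rw [mul_assoc]
        _ ≤ _ := by gcongr
    have hsub : {x | x ∈ Q0.set ∧ K2 * K1 * a <
        eNorm s μ (fun ω => mx Cube.set D (fun Q => av (fun y => h y ω) Q) x)} ⊆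
        B ∩ Q0.set ∪ {x | K2 * lam < Φ x} ∩ Q0.set := by
      rintro x ⟨hx, hlt⟩
      by_cases hxB : x ∈ B
      · exact Or.inl ⟨hxB, hx⟩
      right
      refine ⟨?_, hx⟩
      rw [mul_assoc, ← hlam] at hlt
      have : (fun ω => mx Cube.set D (fun Q => av (fun y => h y ω) Q) x) =
          fun ω => mx Cube.set D (fun Q => av (fun y => g y ω) Q) x := by
        funext ω
        unfold mx
        refine iSup_congr fun Q => iSup_congr fun hQ => iSup_congr fun hxQ => ?_
        obtain ⟨l, hl, hset⟩ := grid_sub_level e δ hδ (hD Q hQ).1 (hD Q hQ).2 hxQ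
        beta_reduce
        rw [av_congr_set _ hset, av_congr_set _ hset]
        unfold av
        congr 1
        have h1 := cz_int e δ hδ H lam h ω l (lab e δ l x)
        change _ = ∫⁻ y in (gcube e δ hδ l (lab e δ l x)).set, g y ω
        refine h1.symm.trans ?_
        apply setLIntegral_congr_fun (Cube.measurableSet _)
        intro y hy
        exact (cz_eq e δ hδ H lam h x l n hl (hgood x hxB) y hy ω).symm
      rw [this] at hlt
      exact hlt
    refine (measure_mono hsub).trans ((measure_union_le _ _).trans ?_)
    calc _ ≤ ε / 2 * Q0.vol + ε / 2 * Q0.vol := add_le_add hBb hcheb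
      _ = ε * Q0.vol := by rw [← add_mul, ENNReal.add_halves]


lemma measurable_mx3 {d : ℕ} {Ω : Type*} [MeasurableSpace Ω] (D : Finset (Cube d))
    (A : Cube d → Ω → ℝ≥0∞) (hA : ∀ Q, Measurable (A Q)) (x : Fin d → ℝ) :
    Measurable (fun ω => mx Cube.set D (fun Q => A Q ω) x) := by
  unfold mx
  exact Measurable.biSup _ D.countable_toSet (fun Q _ => Measurable.iSup_Prop _ (hA Q))

lemma avg_eq_av {d : ℕ} {r : ℝ≥0∞} (hr : r ≠ ∞) (F : (Fin d → ℝ) → ℝ≥0∞) (Q : Cube d) :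
    avg r F Q = (av (fun y => F y ^ r.toReal) Q) ^ (1 / r.toReal) := by
  simp [avg, hr, av]

lemma measurable_nn {d : ℕ} {Ω : Type*} [MeasurableSpace Ω] (f : (Fin d → ℝ) → Ω → ℂ)
    (hf : Measurable (Function.uncurry f)) : Measurable (Function.uncurry fun y => nn (f y)) := by
  have : (Function.uncurry fun y => nn (f y)) = fun z => ((‖Function.uncurry f z‖₊ : NNReal) : ℝ≥0∞) := rfl
  rw [this]
  exact hf.nnnorm.coe_nnreal_ennreal

lemma weakm (d m : ℕ) (r : Fin m → ℝ≥0∞) (hr : ∀ j, 0 < r j ∧ r j ≠ ∞)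
    (t : Fin m → ℝ≥0∞) (hrt : ∀ j, r j < t j) (htfin : (∑ j, (t j)⁻¹)⁻¹ ≠ ∞) :
    ∃ K : ℝ≥0∞, K ≠ ∞ ∧ K ≠ 0 ∧ ∀ (Ω : Type) [MeasurableSpace Ω] (μ : Measure Ω) [SFinite μ]
      (e : Fin d → ℝ) (δ : ℝ) (hδ : 0 < δ) (f : Fin m → (Fin d → ℝ) → Ω → ℂ)
      (_ : ∀ j, Measurable (Function.uncurry (f j))) (D : Finset (Cube d)) (Q0 : Cube d)
      (_ : InGrid e δ hδ Q0) (_ : ∀ Q ∈ D, InGrid e δ hδ Q ∧ Q.set ⊆ Q0.set),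
      volume {x | x ∈ Q0.set ∧ K * ∏ j, avg (r j) (fun y => eNorm (t j) μ (nn (f j y))) Q0 <
        eNorm (∑ j, (t j)⁻¹)⁻¹ μ (latMax r D f x)} ≤ 2⁻¹ * Q0.vol := by
  have hrpos : ∀ j, 0 < (r j).toReal := fun j => ENNReal.toReal_pos (hr j).1.ne' (hr j).2
  have hm1 : ((2:ℝ≥0∞) * (m + 1))⁻¹ ≠ 0 := by
    rw [ne_eq, ENNReal.inv_eq_zero]; finiteness
  have hm2 : ((2:ℝ≥0∞) * (m + 1))⁻¹ ≠ ∞ := by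
    rw [ne_eq, ENNReal.inv_eq_top]; simp
  have hs1 : ∀ j, 1 < t j / r j := by
    intro j
    rw [ENNReal.lt_div_iff_mul_lt (Or.inl (hr j).1.ne') (Or.inl (hr j).2), one_mul]
    exact hrt j
  have ht0 : ∀ j, t j ≠ 0 := fun j => ((hr j).1.trans (hrt j)).ne'
  have hs0 : ∀ j, t j / r j ≠ 0 := fun j => (zero_lt_one.trans (hs1 j)).ne'
  have hsr : ∀ j, t j / r j * ENNReal.ofReal (r j).toReal = t j := by
    intro j
    rw [ENNReal.ofReal_toReal (hr j).2, ENNReal.div_mul_cancel (hr j).1.ne' (hr j).2]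
  have hsr' : ∀ j, t j * ENNReal.ofReal (1 / (r j).toReal) = t j / r j := by
    intro j
    rw [one_div, ENNReal.ofReal_inv_of_pos (hrpos j), ENNReal.ofReal_toReal (hr j).2]
    rfl
  choose K hKt hK0 hK using fun j => weak1 d (t j / r j) (hs1 j) _ hm1 hm2
  refine ⟨∏ j, K j ^ (1 / (r j).toReal), ?_, ?_, ?_⟩
  · apply ENNReal.prod_ne_top
    intro j _
    exact ENNReal.rpow_ne_top_of_nonneg (by have := hrpos j; positivity) (hKt j)
  · rw [Finset.prod_ne_zero_iff]
    intro j _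
    rw [ne_eq, ENNReal.rpow_eq_zero_iff]; push Not
    exact ⟨fun h => absurd h (hK0 j), fun h => absurd h (hKt j)⟩
  intro Ω _ μ _ e δ hδ f hf D Q0 hQ0 hD
  set h : Fin m → (Fin d → ℝ) → Ω → ℝ≥0∞ := fun j y ω => nn (f j y) ω ^ (r j).toReal with hh
  have hhm : ∀ j, Measurable (Function.uncurry (h j)) := fun j =>
    (measurable_nn (f j) (hf j)).pow_const _
  have hH : ∀ j y, eNorm (t j / r j) μ (h j y) = eNorm (t j) μ (nn (f j y)) ^ (r j).toReal := by
    intro j y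
    have := eNorm_rpow (hs0 j) μ (nn (f j y)) (hrpos j)
    rw [hsr] at this
    exact this
  set A : Fin m → Set (Fin d → ℝ) := fun j => {x | x ∈ Q0.set ∧
    K j * av (fun y => eNorm (t j / r j) μ (h j y)) Q0 <
        eNorm (t j / r j) μ (fun ω => mx Cube.set D (fun Q => av (fun y => h j y ω) Q) x)} with hA
  have hAb : ∀ j, volume (A j) ≤ ((2:ℝ≥0∞) * (m + 1))⁻¹ * Q0.vol := fun j =>
    hK j Ω μ e δ hδ (h j) (hhm j) D Q0 hQ0 hD
  have hsub : {x | x ∈ Q0.set ∧ (∏ j, K j ^ (1 / (r j).toReal)) *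
      ∏ j, avg (r j) (fun y => eNorm (t j) μ (nn (f j y))) Q0 <
        eNorm (∑ j, (t j)⁻¹)⁻¹ μ (latMax r D f x)} ⊆ ⋃ j, A j := by
    rintro x ⟨hx, hlt⟩
    by_contra hc
    rw [Set.mem_iUnion] at hc
    push Not at hc
    apply not_le.2 hlt
    calc eNorm (∑ j, (t j)⁻¹)⁻¹ μ (latMax r D f x)
        ≤ eNorm (∑ j, (t j)⁻¹)⁻¹ μ (fun ω => ∏ j,
          (mx Cube.set D (fun Q => av (fun y => h j y ω) Q) x) ^ (1 / (r j).toReal)) := by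
          apply eNorm_mono
          intro ω
          refine iSup₂_le fun Q hQ => iSup_le fun hxQ => ?_
          apply Finset.prod_le_prod' 
          intro j _
          change (av (fun y => h j y ω) Q) ^ (1 / (r j).toReal) ≤ _
          apply ENNReal.rpow_le_rpow _ (by have := hrpos j; positivity)
          exact le_mx Cube.set D (fun Q => av (fun y => h j y ω) Q) hQ hxQ
      _ ≤ ∏ j, eNorm (t j) μ (fun ω =>
          (mx Cube.set D (fun Q => av (fun y => h j y ω) Q) x) ^ (1 / (r j).toReal)) := by
          apply eNorm_prod_le μ t ht0 htfin
          intro j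
          apply Measurable.pow_const
          exact measurable_mx3 D (fun Q ω => av (fun y => h j y ω) Q)
            (fun Q => measurable_av (h j) (hhm j) Q) x
      _ ≤ ∏ j, (K j ^ (1 / (r j).toReal) * avg (r j) (fun y => eNorm (t j) μ (nn (f j y))) Q0) := by
          apply Finset.prod_le_prod'
          intro j _
          have hp : 0 < 1 / (r j).toReal := by have := hrpos j; positivity
          rw [eNorm_rpow (ht0 j) μ _ hp, hsr', avg_eq_av (hr j).2,
            ← ENNReal.mul_rpow_of_nonneg _ _ hp.le]
          apply ENNReal.rpow_le_rpow _ hp.le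
          have h1 : ¬ (K j * av (fun y => eNorm (t j / r j) μ (h j y)) Q0 <
            eNorm (t j / r j) μ (fun ω => mx Cube.set D (fun Q => av (fun y => h j y ω) Q) x)) :=
            fun hcc => hc j ⟨hx, hcc⟩
          simp_rw [hH] at h1
          exact not_lt.1 h1
      _ = _ := Finset.prod_mul_distrib
  refine (measure_mono hsub).trans ((measure_iUnion_fintype_le _ _).trans ?_)
  refine (Finset.sum_le_sum fun j _ => hAb j).trans ?_
  rw [Finset.sum_const, Finset.card_univ, Fintype.card_fin, nsmul_eq_mul, ← mul_assoc]
  gcongr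
  rw [ENNReal.mul_inv (by simp) (by simp), mul_left_comm]
  calc (2:ℝ≥0∞)⁻¹ * (m * (m + 1 : ℝ≥0∞)⁻¹) ≤ 2⁻¹ * ((m + 1) * (m + 1 : ℝ≥0∞)⁻¹) := by
        gcongr; exact le_self_add
    _ = 2⁻¹ := by rw [ENNReal.mul_inv_cancel (by simp) (by finiteness), mul_one]


lemma sparse_dom {d : ℕ} {Ω : Type*} [MeasurableSpace Ω] (μ : Measure Ω)
    (e : Fin d → ℝ) (δ : ℝ) (hδ : 0 < δ) (T : ℝ≥0∞) (hT0 : T ≠ 0) (hT : T ≠ ∞)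
    (A : Cube d → Ω → ℝ≥0∞) (hA : ∀ Q, Measurable (A Q)) (c : Cube d → ℝ≥0∞)
    (hw : ∀ (D : Finset (Cube d)) (Q0 : Cube d) (_ : InGrid e δ hδ Q0)
      (_ : ∀ Q ∈ D, InGrid e δ hδ Q ∧ Q.set ⊆ Q0.set),
      volume {x | x ∈ Q0.set ∧ c Q0 < eNorm T μ (fun ω => mx Cube.set D (fun Q => A Q ω) x)}
        ≤ 2⁻¹ * Q0.vol) (n : ℕ) :
    ∀ D : Finset (Cube d), D.card ≤ n → (∀ Q ∈ D, InGrid e δ hδ Q) →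
    ∃ S ⊆ D, ∃ E : Cube d → Set (Fin d → ℝ),
      (∀ Q ∈ S, MeasurableSet (E Q) ∧ E Q ⊆ Q.set ∧ Q.vol ≤ 2 * volume (E Q)) ∧
      (S : Set (Cube d)).PairwiseDisjoint E ∧
      ∀ x, (eNorm T μ (fun ω => mx Cube.set D (fun Q => A Q ω) x)) ^ T.toReal ≤
        ∑ Q ∈ S, Q.set.indicator (fun _ => c Q ^ T.toReal) x := by
  classical
  have hTp : 0 < T.toReal := ENNReal.toReal_pos hT0 hT
  induction n with
  | zero =>
    intro D hD _
    obtain rfl : D = ∅ := Finset.card_eq_zero.1 (by omega)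
    refine ⟨∅, by simp, fun _ => ∅, by simp, by simp, ?_⟩
    intro x
    have : (fun ω => mx Cube.set (∅ : Finset (Cube d)) (fun Q => A Q ω) x) = fun _ => 0 := by
      funext ω; simp [mx]
    rw [this, eNorm_zero_of_ae μ hT0 _ (by simp)]
    simp [hTp]
  | succ n ih =>
    intro D hDn hD
    by_cases hne : D.Nonempty
    swap
    · rw [Finset.not_nonempty_iff_eq_empty] at hne
      exact ih D (by simp [hne]) hD
    obtain ⟨Q0, hQ0, hmax⟩ := Finset.exists_maximalFor Cube.set D hne
    have hLam := grid_lam e δ hδ D hD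
    set DR : Cube d → Finset (Cube d) :=
      fun R => D.filter (fun Q => R.set ⊆ Q.set ∧ Q.set ⊆ Q0.set) with hDR
    set bad : Finset (Cube d) := D.filter (fun R => R.set ⊆ Q0.set ∧
      c Q0 < eNorm T μ (fun ω => ⨆ Q ∈ DR R, A Q ω)) with hbad
    set U : Set (Fin d → ℝ) := ⋃ R ∈ bad, R.set with hU
    have hUm : MeasurableSet U := Finset.measurableSet_biUnion _ fun R _ => R.measurableSet
    have hUQ : U ⊆ Q0.set := by
      refine Set.iUnion₂_subset fun R hR => ?_
      exact (Finset.mem_filter.1 hR).2.1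
    have hUv : volume U ≤ 2⁻¹ * Q0.vol := by
      refine le_trans (measure_mono ?_) (hw (D.filter (fun Q => Q.set ⊆ Q0.set)) Q0 (hD Q0 hQ0) ?_)
      · intro x hx
        refine ⟨hUQ hx, ?_⟩
        rw [hU, Set.mem_iUnion₂] at hx
        obtain ⟨R, hR, hxR⟩ := hx
        refine (Finset.mem_filter.1 hR).2.2.trans_le ?_
        apply eNorm_mono
        intro ω
        refine iSup₂_le fun Q hQ => ?_
        have hQ' := Finset.mem_filter.1 hQ
        exact le_mx Cube.set _ (fun Q => A Q ω) (Finset.mem_filter.2 ⟨hQ'.1, hQ'.2.2⟩)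
          (hQ'.2.1 hxR)
      · intro Q hQ
        have hQ' := Finset.mem_filter.1 hQ
        exact ⟨hD Q hQ'.1, hQ'.2⟩
    set D' : Finset (Cube d) := D.filter (fun Q => Disjoint Q.set Q0.set ∨ Q.set ⊆ U) with hD'
    have hQ0U : ¬ Q0.set ⊆ U := by
      intro hs
      have h1 : Q0.vol ≤ 2⁻¹ * Q0.vol := (measure_mono hs).trans hUv
      have h2 : 2⁻¹ * Q0.vol < Q0.vol := by
        rw [mul_comm]; exact ENNReal.half_lt_self Q0.vol_ne_zero Q0.vol_ne_top
      exact absurd h1 (not_le.2 h2)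
    have hQ0ne : Q0.set.Nonempty := by
      by_contra hc
      rw [Set.not_nonempty_iff_eq_empty] at hc
      exact hQ0U (by rw [hc]; exact Set.empty_subset _)
    have hQ0D' : Q0 ∉ D' := by
      intro hc
      rcases (Finset.mem_filter.1 hc).2 with h | h
      · rw [disjoint_self] at h
        exact hQ0ne.ne_empty h
      · exact hQ0U h
    have hsub : D' ⊆ D := Finset.filter_subset _ _
    have hcard : D'.card ≤ n := by
      have : D'.card < D.card := Finset.card_lt_card
        ⟨hsub, fun h => hQ0D' (h hQ0)⟩
      omega
    obtain ⟨S, hSD, E, hE, hdisj, hdom⟩ := ih D' hcard fun Q hQ => hD Q (hsub hQ)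
    have hQ0S : Q0 ∉ S := fun h => hQ0D' (hSD h)
    have hEQ : ∀ Q ∈ S, Disjoint (E Q) (Q0.set \ U) := by
      intro Q hQ
      rcases (Finset.mem_filter.1 (hSD hQ)).2 with h | h
      · exact (h.mono_left (hE Q hQ).2.1).mono_right Set.sdiff_subset
      · exact (Set.disjoint_sdiff_right).mono_left ((hE Q hQ).2.1.trans h)
    refine ⟨insert Q0 S, ?_, Function.update E Q0 (Q0.set \ U), ?_, ?_, ?_⟩
    · intro Q hQ
      rcases Finset.mem_insert.1 hQ with rfl | hQ
      · exact hQ0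
      · exact hsub (hSD hQ)
    · intro Q hQ
      rcases Finset.mem_insert.1 hQ with rfl | hQ
      · rw [Function.update_self]
        refine ⟨Q.measurableSet.diff hUm, Set.sdiff_subset, ?_⟩
        have h1 : volume Q.set ≤ volume U + volume (Q.set \ U) := by
          refine (measure_mono ?_).trans (measure_union_le _ _)
          intro x hx
          by_cases hxU : x ∈ U
          · exact Or.inl hxU
          · exact Or.inr ⟨hx, hxU⟩
        have h2 : Q.vol ≤ 2⁻¹ * Q.vol + volume (Q.set \ U) := h1.trans (add_le_add_left hUv _)
        have h3 : 2⁻¹ * Q.vol + 2⁻¹ * Q.vol = Q.vol := by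
          rw [← add_mul, ENNReal.inv_two_add_inv_two, one_mul]
        have h4 : 2⁻¹ * Q.vol ≤ volume (Q.set \ U) := by
          have h5 : 2⁻¹ * Q.vol ≠ ∞ := ENNReal.mul_ne_top (by simp) Q.vol_ne_top
          nth_rewrite 1 [← h3] at h2
          exact (ENNReal.add_le_add_iff_left h5).1 h2
        calc Q.vol = 2 * (2⁻¹ * Q.vol) := by
              rw [← mul_assoc, ENNReal.mul_inv_cancel (by simp) (by simp), one_mul]
          _ ≤ _ := by gcongr
      · have hq : Q ≠ Q0 := fun h => hQ0S (h ▸ hQ)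
        rw [Function.update_of_ne hq]
        exact hE Q hQ
    · intro P hP Q hQ hPQ
      simp only [Finset.coe_insert, Set.mem_insert_iff, Finset.mem_coe] at hP hQ
      simp only [Function.onFun]
      rcases hP with rfl | hP
      · rcases hQ with rfl | hQ
        · exact absurd rfl hPQ
        · rw [Function.update_self, Function.update_of_ne hPQ.symm]
          exact (hEQ Q hQ).symm
      · rcases hQ with rfl | hQ
        · rw [Function.update_self, Function.update_of_ne hPQ]
          exact hEQ P hP
        · have hq : Q ≠ Q0 := fun h => hQ0S (h ▸ hQ)
          have hp : P ≠ Q0 := fun h => hQ0S (h ▸ hP)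
          rw [Function.update_of_ne hq, Function.update_of_ne hp]
          exact hdisj hP hQ hPQ
    · intro x
      rw [Finset.sum_insert hQ0S]
      refine le_trans ?_ (add_le_add_right (hdom x) _)
      by_cases hx : x ∈ Q0.set
      · rw [Set.indicator_of_mem hx]
        set Ax := D.filter (fun Q => x ∈ Q.set ∧ ¬ Q.set ⊆ U) with hAx
        have hAQ : ∀ Q ∈ D, x ∈ Q.set → Q.set ⊆ Q0.set := by
          intro Q hQ hxQ
          rcases hLam Q hQ Q0 hQ0 with h | h | h
          · exact h
          · exact hmax hQ h
          · exact absurd hx (Set.disjoint_left.1 h hxQ)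
        by_cases hAne : Ax.Nonempty
        · obtain ⟨R, hR, hmin⟩ := Finset.exists_minimalFor Cube.set Ax hAne
          have hR' := Finset.mem_filter.1 hR
          have hRQ : ∀ Q ∈ Ax, R.set ⊆ Q.set := by
            intro Q hQ
            have hQ' := Finset.mem_filter.1 hQ
            rcases hLam R hR'.1 Q hQ'.1 with h | h | h
            · exact h
            · exact hmin hQ h
            · exact absurd hQ'.2.1 (Set.disjoint_left.1 h hR'.2.1)
          have hRb : R ∉ bad := fun h => hR'.2.2 (Set.subset_iUnion₂_of_subset R h subset_rfl)
          have hRc : eNorm T μ (fun ω => ⨆ Q ∈ DR R, A Q ω) ≤ c Q0 := by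
            by_contra hc
            exact hRb (Finset.mem_filter.2 ⟨hR'.1, hAQ R hR'.1 hR'.2.1, not_le.1 hc⟩)
          have hmeas : Measurable (fun ω => ⨆ Q ∈ DR R, A Q ω) :=
            Measurable.biSup _ (DR R).countable_toSet (fun Q _ => hA Q)
          calc (eNorm T μ (fun ω => mx Cube.set D (fun Q => A Q ω) x)) ^ T.toReal
              = ∫⁻ ω, (mx Cube.set D (fun Q => A Q ω) x) ^ T.toReal ∂μ := eNorm_pow_eq hT0 hT μ _
            _ ≤ ∫⁻ ω, ((⨆ Q ∈ DR R, A Q ω) ^ T.toReal +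
                (mx Cube.set D' (fun Q => A Q ω) x) ^ T.toReal) ∂μ := by
                apply lintegral_mono
                intro ω
                have : mx Cube.set D (fun Q => A Q ω) x ≤
                    max (⨆ Q ∈ DR R, A Q ω) (mx Cube.set D' (fun Q => A Q ω) x) := by
                  apply mx_le
                  intro Q hQ hxQ
                  by_cases hQU : Q.set ⊆ U
                  · exact le_max_of_le_right (le_mx Cube.set D' (fun Q => A Q ω)
                      (Finset.mem_filter.2 ⟨hQ, Or.inr hQU⟩) hxQ)
                  · apply le_max_of_le_left
                    refine le_iSup₂_of_le Q (Finset.mem_filter.2 ⟨hQ, ?_, hAQ Q hQ hxQ⟩) le_rfl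
                    exact hRQ Q (Finset.mem_filter.2 ⟨hQ, hxQ, hQU⟩)
                refine (ENNReal.rpow_le_rpow this hTp.le).trans ?_
                rcases le_total (⨆ Q ∈ DR R, A Q ω) (mx Cube.set D' (fun Q => A Q ω) x) with h | h
                · rw [max_eq_right h]; exact le_add_self
                · rw [max_eq_left h]; exact le_self_add
            _ = (eNorm T μ (fun ω => ⨆ Q ∈ DR R, A Q ω)) ^ T.toReal +
                (eNorm T μ (fun ω => mx Cube.set D' (fun Q => A Q ω) x)) ^ T.toReal := by
                rw [lintegral_add_left (hmeas.pow_const _), eNorm_pow_eq hT0 hT, eNorm_pow_eq hT0 hT]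
            _ ≤ _ := by gcongr
        · refine le_trans ?_ le_add_self
          apply ENNReal.rpow_le_rpow _ hTp.le
          apply eNorm_mono
          intro ω
          apply mx_le
          intro Q hQ hxQ
          have hQU : Q.set ⊆ U := by
            by_contra hc
            exact hAne ⟨Q, Finset.mem_filter.2 ⟨hQ, hxQ, hc⟩⟩
          exact le_mx Cube.set D' (fun Q => A Q ω)
                      (Finset.mem_filter.2 ⟨hQ, Or.inr hQU⟩) hxQ
      · refine le_trans ?_ le_add_self
        apply ENNReal.rpow_le_rpow _ hTp.le
        apply eNorm_mono
        intro ω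
        apply mx_le
        intro Q hQ hxQ
        have hQd : Disjoint Q.set Q0.set := by
          rcases hLam Q hQ Q0 hQ0 with h | h | h
          · exact absurd (h hxQ) hx
          · exact absurd (hmax hQ h hxQ) hx
          · exact h
        exact le_mx Cube.set D' (fun Q => A Q ω)
                      (Finset.mem_filter.2 ⟨hQ, Or.inl hQd⟩) hxQ


lemma exists_ex {X : ℝ≥0∞} (h0 : X ≠ 0) (ht : X ≠ ∞) : ∃ x : ℝ, X = ENNReal.ofReal (Real.exp x) := by
  refine ⟨Real.log X.toReal, ?_⟩
  rw [Real.exp_log (ENNReal.toReal_pos h0 ht), ENNReal.ofReal_toReal ht]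

lemma ex_rpow (x y : ℝ) : ENNReal.ofReal (Real.exp x) ^ y = ENNReal.ofReal (Real.exp (x * y)) := by
  rw [ENNReal.ofReal_rpow_of_pos (Real.exp_pos x), Real.exp_mul]

lemma ex_mul (x y : ℝ) : ENNReal.ofReal (Real.exp x) * ENNReal.ofReal (Real.exp y) =
    ENNReal.ofReal (Real.exp (x + y)) := by
  rw [← ENNReal.ofReal_mul (Real.exp_pos x).le, Real.exp_add]

lemma ex_div (x y : ℝ) : ENNReal.ofReal (Real.exp x) / ENNReal.ofReal (Real.exp y) =
    ENNReal.ofReal (Real.exp (x - y)) := by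
  rw [← ENNReal.ofReal_div_of_pos (Real.exp_pos y), Real.exp_sub]

lemma ex_prod {m : ℕ} (x : Fin m → ℝ) : ∏ j, ENNReal.ofReal (Real.exp (x j)) =
    ENNReal.ofReal (Real.exp (∑ j, x j)) := by
  rw [← ENNReal.ofReal_prod_of_nonneg (fun j _ => (Real.exp_pos _).le), Real.exp_sum]

lemma ex_le {x y : ℝ} : ENNReal.ofReal (Real.exp x) ≤ ENNReal.ofReal (Real.exp y) ↔ x ≤ y := by
  rw [ENNReal.ofReal_le_ofReal_iff (Real.exp_pos y).le, Real.exp_le_exp]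

lemma key_ineq {m : ℕ} (a b : Fin m → ℝ) (β u γ : ℝ) (hβ : β = ∑ j, b j) (hA : 0 ≤ ∑ j, a j)
    (hu : 0 < u) (hγ1 : 1 ≤ γ) (hγa : ∀ j, a j ≤ γ * (a j - b j)) (hγu : 1 ≤ u * γ * β)
    (V ee : Fin m → ℝ≥0∞) (S η L l W : ℝ≥0∞)
    (he0 : ∀ j, ee j ≠ 0) (hη0 : η ≠ 0) (hl0 : l ≠ 0)
    (hVt : ∀ j, V j ≠ ∞) (hSt : S ≠ ∞) (hLt : L ≠ ∞) (hWt : W ≠ ∞)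
    (heV : ∀ j, ee j ≤ V j) (hηS : η ≤ S) (hlL : l ≤ L) (hL2 : L ≤ 2 * l)
    (h1 : (∏ j, (V j / L) ^ (a j - b j)) * (S / L) ^ β ≤ W)
    (h2 : l ^ (∑ j, a j) ≤ (∏ j, ee j ^ (a j - b j)) * η ^ β) :
    (∏ j, (V j / L) ^ (u * a j)) * S ≤
      ENNReal.ofReal (2 ^ (u * (∑ j, a j) * (γ - 1))) * W ^ (u * γ) *
        ((∏ j, ee j ^ (u * b j)) * η ^ (1 - u * β)) := by
  have hV0 : ∀ j, V j ≠ 0 := fun j h => he0 j (le_antisymm (h ▸ heV j) bot_le)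
  have het : ∀ j, ee j ≠ ∞ := fun j => ne_top_of_le_ne_top (hVt j) (heV j)
  have hS0 : S ≠ 0 := fun h => hη0 (le_antisymm (h ▸ hηS) bot_le)
  have hηt : η ≠ ∞ := ne_top_of_le_ne_top hSt hηS
  have hL0 : L ≠ 0 := fun h => hl0 (le_antisymm (h ▸ hlL) bot_le)
  have hlt : l ≠ ∞ := ne_top_of_le_ne_top hLt hlL
  choose V' hV' using fun j => exists_ex (hV0 j) (hVt j)
  choose e' he' using fun j => exists_ex (he0 j) (het j)
  obtain ⟨S', hS'⟩ := exists_ex hS0 hSt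
  obtain ⟨η', hη'⟩ := exists_ex hη0 hηt
  obtain ⟨L', hL'⟩ := exists_ex hL0 hLt
  obtain ⟨l', hl'⟩ := exists_ex hl0 hlt
  have h22 : (2:ℝ≥0∞) = ENNReal.ofReal (Real.exp (Real.log 2)) := by
    rw [Real.exp_log (by norm_num)]; simp
  have h23 : ENNReal.ofReal (2 ^ (u * (∑ j, a j) * (γ - 1))) =
      ENNReal.ofReal (Real.exp (Real.log 2 * (u * (∑ j, a j) * (γ - 1)))) := by
    rw [Real.exp_mul, Real.exp_log (by norm_num)]
  rw [h23]
  simp only [hV', he', hS', hη', hL', hl', h22, ex_div, ex_rpow, ex_prod, ex_mul, ex_le]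
    at heV hηS hlL hL2 h1 h2 ⊢
  have hW0 : W ≠ 0 := by
    intro h
    rw [h, nonpos_iff_eq_zero, ENNReal.ofReal_eq_zero] at h1
    exact absurd h1 (not_le.2 (Real.exp_pos _))
  obtain ⟨W', hW'⟩ := exists_ex hW0 hWt
  simp only [hW', ex_rpow, ex_mul, ex_le] at h1 ⊢
  have hab : ∑ j, (a j - b j) = ∑ j, a j - β := by rw [hβ, Finset.sum_sub_distrib]
  have hs1 : 0 ≤ ∑ j, u * (γ * (a j - b j) - a j) * (V' j - e' j) := by
    apply Finset.sum_nonneg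
    intro j _
    have := hγa j
    have := heV j
    apply mul_nonneg (mul_nonneg hu.le _) <;> linarith
  have hs2 : ∑ j, u * (γ * (a j - b j) - a j) * (V' j - e' j) =
      u * γ * (∑ j, V' j * (a j - b j)) - u * (∑ j, V' j * a j)
       - u * γ * (∑ j, e' j * (a j - b j)) + u * (∑ j, e' j * a j) := by
    simp only [Finset.mul_sum, ← Finset.sum_sub_distrib, ← Finset.sum_add_distrib]
    apply Finset.sum_congr rfl
    intro j _; ring
  have hs3 : ∑ j, (V' j - L') * (a j - b j) = ∑ j, V' j * (a j - b j) - L' * (∑ j, a j - β) := by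
    rw [← hab, Finset.mul_sum, ← Finset.sum_sub_distrib]
    apply Finset.sum_congr rfl
    intro j _; ring
  have hs4 : ∑ j, (V' j - L') * (u * a j) = u * ∑ j, V' j * a j - u * L' * ∑ j, a j := by
    rw [Finset.mul_sum, Finset.mul_sum, ← Finset.sum_sub_distrib]
    apply Finset.sum_congr rfl
    intro j _; ring
  have hs5 : ∑ j, e' j * (u * b j) = u * ∑ j, e' j * a j - u * ∑ j, e' j * (a j - b j) := by
    rw [Finset.mul_sum, Finset.mul_sum, ← Finset.sum_sub_distrib]
    apply Finset.sum_congr rfl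
    intro j _; ring
  rw [hs2] at hs1
  rw [hs3] at h1
  rw [hs4, hs5]
  set A := ∑ j, a j
  set x1 := ∑ j, V' j * (a j - b j)
  set x2 := ∑ j, V' j * a j
  set x3 := ∑ j, e' j * (a j - b j)
  set x4 := ∑ j, e' j * a j
  have k1 := mul_le_mul_of_nonneg_left h1 (by positivity : 0 ≤ u * γ)
  have hg : 0 ≤ u * (γ - 1) := mul_nonneg hu.le (by linarith)
  have k2 := mul_le_mul_of_nonneg_left h2 hg
  have k3 := mul_le_mul_of_nonneg_left hL2 (mul_nonneg hg hA)
  have k4 := mul_le_mul_of_nonneg_left hηS (by linarith : 0 ≤ u * γ * β - 1)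
  nlinarith [k1, k2, k3, k4, hs1]

lemma holder_sum {ι : Type*} {m : ℕ} (S : Finset ι) (g : ι → ℝ≥0∞) (f : Fin m → ι → ℝ≥0∞)
    (q : ℝ) (θ : Fin m → ℝ) (h1 : q + ∑ j, θ j = 1) (hq : 0 ≤ q) (hθ : ∀ j, 0 ≤ θ j) :
    ∑ Q ∈ S, g Q ^ q * ∏ j, f j Q ^ θ j ≤
      (∑ Q ∈ S, g Q) ^ q * ∏ j, (∑ Q ∈ S, f j Q) ^ θ j := by
  classical
  let _ : MeasurableSpace {Q // Q ∈ S} := ⊤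
  have h := ENNReal.lintegral_mul_prod_norm_pow_le (μ := (Measure.count : Measure {Q // Q ∈ S}))
    Finset.univ (g := fun Q => g Q.1) (f := fun j Q => f j Q.1) (measurable_from_top).aemeasurable
    (fun j _ => (measurable_from_top).aemeasurable) q h1 hq (fun j _ => hθ j)
  simp only [lintegral_count, tsum_fintype] at h
  rw [Finset.sum_coe_sort S (fun Q => g Q ^ q * ∏ j, f j Q ^ θ j), Finset.sum_coe_sort S g] at h
  have h3 : ∀ j, ∑ Q : {Q // Q ∈ S}, f j Q.1 = ∑ Q ∈ S, f j Q := fun j => Finset.sum_coe_sort S (f j)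
  simp only [h3] at h
  exact h

lemma carleson {d : ℕ} (S : Finset (Cube d)) (hL : Lam Cube.set S) (E : Cube d → Set (Fin d → ℝ))
    (hEm : ∀ Q ∈ S, MeasurableSet (E Q)) (hE : ∀ Q ∈ S, E Q ⊆ Q.set)
    (hdisj : (S : Set (Cube d)).PairwiseDisjoint E) (ν : Measure (Fin d → ℝ))
    (hν : ∀ Q ∈ S, ν Q.set ≠ ∞) (h : (Fin d → ℝ) → ℝ≥0∞) (hh : Measurable h) (p : ℝ) (hp : 1 < p) :
    ∑ Q ∈ S, ν (E Q) * ((∫⁻ y in Q.set, h y ∂ν) / ν Q.set) ^ p ≤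
      ENNReal.ofReal (2 ^ p * p / (p - 1)) * ∫⁻ x, h x ^ p ∂ν := by
  refine le_trans ?_ (doob Cube.set Cube.measurableSet S hL ν hν h hh p hp)
  set M := mx Cube.set S (fun Q => (∫⁻ y in Q.set, h y ∂ν) / ν Q.set) with hM
  calc _ ≤ ∑ Q ∈ S, ∫⁻ x in E Q, M x ^ p ∂ν := by
        apply Finset.sum_le_sum
        intro Q hQ
        rw [mul_comm, ← setLIntegral_const]
        apply setLIntegral_mono' (hEm Q hQ)
        intro x hx
        apply ENNReal.rpow_le_rpow _ (by linarith)
        exact le_mx Cube.set S (fun Q => (∫⁻ y in Q.set, h y ∂ν) / ν Q.set) hQ (hE Q hQ hx)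
    _ = ∫⁻ x in ⋃ Q ∈ S, E Q, M x ^ p ∂ν := (lintegral_biUnion_finset hdisj hEm _).symm
    _ ≤ _ := setLIntegral_le_lintegral _ _


def cst (a b u : ℝ) : ℝ≥0∞ := ENNReal.ofReal (2 ^ (a / b) * (a / b) / (a / b - 1)) ^ (u * b)

lemma cst_ne_top (a b u : ℝ) (h : 0 ≤ u * b) : cst a b u ≠ ∞ :=
  ENNReal.rpow_ne_top_of_nonneg h ENNReal.ofReal_ne_top

lemma embed {d : ℕ} (S : Finset (Cube d)) (hL : Lam Cube.set S) (E : Cube d → Set (Fin d → ℝ))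
    (hEm : ∀ Q ∈ S, MeasurableSet (E Q)) (hE : ∀ Q ∈ S, E Q ⊆ Q.set)
    (hdisj : (S : Set (Cube d)).PairwiseDisjoint E) (ν : Measure (Fin d → ℝ))
    (hν : ∀ Q ∈ S, ν Q.set ≠ ∞) (h : (Fin d → ℝ) → ℝ≥0∞) (hh : Measurable h)
    (a b u : ℝ) (ha : 0 < a) (hb : 0 ≤ b) (hab : b < a) (hu : 0 < u) (N : ℝ≥0∞)
    (hN1 : 0 < b → ∫⁻ x, h x ^ (a / b) ∂ν ≤ N ^ (1 / b))
    (hN2 : b = 0 → ∀ᵐ x ∂ν, h x ≤ N ^ (1 / a)) :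
    ∃ (M : ℝ≥0∞) (y : Cube d → ℝ≥0∞),
      (∀ Q ∈ S, ν (E Q) ^ (u * b) * ((∫⁻ x in Q.set, h x ∂ν) / ν Q.set) ^ (u * a) ≤
        M * y Q ^ (u * b)) ∧
      M * (∑ Q ∈ S, y Q) ^ (u * b) ≤ cst a b u * N ^ u := by
  rcases hb.eq_or_lt with hb0 | hb0
  · subst hb0
    refine ⟨N ^ u, fun _ => 1, ?_, ?_⟩
    · intro Q hQ
      simp only [mul_zero, ENNReal.rpow_zero, one_mul, mul_one]
      have h1 : (∫⁻ x in Q.set, h x ∂ν) / ν Q.set ≤ N ^ (1 / a) := by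
        apply ENNReal.div_le_of_le_mul
        rw [← setLIntegral_const]
        exact lintegral_mono_ae (ae_restrict_of_ae (hN2 rfl))
      calc _ ≤ (N ^ (1 / a)) ^ (u * a) := ENNReal.rpow_le_rpow h1 (by positivity)
        _ = N ^ u := by
          rw [← ENNReal.rpow_mul]; congr 1; field_simp
    · simp [cst]
  · refine ⟨1, fun Q => ν (E Q) * ((∫⁻ x in Q.set, h x ∂ν) / ν Q.set) ^ (a / b), ?_, ?_⟩
    · intro Q hQ
      rw [one_mul, ENNReal.mul_rpow_of_nonneg _ _ (by positivity), ← ENNReal.rpow_mul]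
      apply le_of_eq
      congr 2
      field_simp
    · rw [one_mul]
      have h1 := carleson S hL E hEm hE hdisj ν hν h hh (a / b) (by rw [lt_div_iff₀ hb0]; linarith)
      have h2 := h1.trans (mul_le_mul_right (hN1 hb0) _)
      refine (ENNReal.rpow_le_rpow h2 (by positivity)).trans ?_
      rw [ENNReal.mul_rpow_of_nonneg _ _ (by positivity), ← ENNReal.rpow_mul, cst]
      apply le_of_eq
      congr 2
      field_simp

def Kd {m : ℕ} (a b : Fin m → ℝ) (β u γ : ℝ) : ℝ≥0∞ :=
  ENNReal.ofReal (2 ^ (u * (∑ j, a j) * (γ - 1))) * ((∏ j, cst (a j) (b j) u) * cst 1 (1 - u * β) 1)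

lemma dual {d m : ℕ} (a b : Fin m → ℝ) (β u γ : ℝ) (hβ : β = ∑ j, b j)
    (ha : ∀ j, 0 < a j) (hb : ∀ j, 0 ≤ b j) (hab : ∀ j, b j < a j)
    (hβ0 : 0 < β) (hu : 0 < u) (huβ : u * β ≤ 1) (hγ1 : 1 ≤ γ)
    (hγa : ∀ j, a j ≤ γ * (a j - b j)) (hγu : 1 ≤ u * γ * β)
    (S : Finset (Cube d)) (hL : Lam Cube.set S) (E : Cube d → Set (Fin d → ℝ))
    (hEm : ∀ Q ∈ S, MeasurableSet (E Q)) (hE : ∀ Q ∈ S, E Q ⊆ Q.set)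
    (hE2 : ∀ Q ∈ S, Q.vol ≤ 2 * volume (E Q))
    (hdisj : (S : Set (Cube d)).PairwiseDisjoint E)
    (ν : Fin m → Measure (Fin d → ℝ)) (σ : Measure (Fin d → ℝ))
    (hν : ∀ j, ∀ Q ∈ S, ν j Q.set ≠ ∞) (hσ : ∀ Q ∈ S, σ Q.set ≠ ∞)
    (hν0 : ∀ j, ∀ Q ∈ S, ν j (E Q) ≠ 0) (hσ0 : ∀ Q ∈ S, σ (E Q) ≠ 0)
    (W : ℝ≥0∞) (hW : W ≠ ∞)
    (h1 : ∀ Q ∈ S, (∏ j, (ν j Q.set / Q.vol) ^ (a j - b j)) * (σ Q.set / Q.vol) ^ β ≤ W)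
    (h2 : ∀ Q ∈ S, volume (E Q) ^ (∑ j, a j) ≤ (∏ j, ν j (E Q) ^ (a j - b j)) * σ (E Q) ^ β)
    (h : Fin m → (Fin d → ℝ) → ℝ≥0∞) (hh : ∀ j, Measurable (h j)) (N : Fin m → ℝ≥0∞)
    (hN1 : ∀ j, 0 < b j → ∫⁻ x, h j x ^ (a j / b j) ∂(ν j) ≤ N j ^ (1 / b j))
    (hN2 : ∀ j, b j = 0 → ∀ᵐ x ∂(ν j), h j x ≤ N j ^ (1 / a j))
    (g : (Fin d → ℝ) → ℝ≥0∞) (hg : Measurable g) (G : ℝ≥0∞)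
    (hG1 : 0 < 1 - u * β → ∫⁻ x, g x ^ (1 / (1 - u * β)) ∂σ ≤ G ^ (1 / (1 - u * β)))
    (hG2 : 1 - u * β = 0 → ∀ᵐ x ∂σ, g x ≤ G) :
    ∑ Q ∈ S, (∏ j, (ν j Q.set / Q.vol) ^ (u * a j) *
        ((∫⁻ x in Q.set, h j x ∂(ν j)) / ν j Q.set) ^ (u * a j)) * ∫⁻ x in Q.set, g x ∂σ ≤
      Kd a b β u γ * W ^ (u * γ) * ((∏ j, N j ^ u) * G) := by
  choose M y hy hM using fun j => embed S hL E hEm hE hdisj (ν j) (hν j) (h j) (hh j) (a j) (b j) u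
    (ha j) (hb j) (hab j) hu (N j) (hN1 j) (hN2 j)
  have h0 : 0 < u * β := by positivity
  obtain ⟨M', y', hy', hM'⟩ := embed S hL E hEm hE hdisj σ hσ g hg 1 (1 - u * β) 1 one_pos
    (by linarith) (by linarith) one_pos G hG1 (fun h => by simpa using hG2 h)
  simp only [one_mul, ENNReal.rpow_one] at hy' hM'
  set c0 := ENNReal.ofReal (2 ^ (u * (∑ j, a j) * (γ - 1))) with hc0
  have step : ∀ Q ∈ S, (∏ j, (ν j Q.set / Q.vol) ^ (u * a j) *
        ((∫⁻ x in Q.set, h j x ∂(ν j)) / ν j Q.set) ^ (u * a j)) * ∫⁻ x in Q.set, g x ∂σ ≤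
      c0 * W ^ (u * γ) * (((∏ j, M j) * M') * (y' Q ^ (1 - u * β) * ∏ j, y j Q ^ (u * b j))) := by
    intro Q hQ
    have hσQ : σ Q.set ≠ 0 := fun h => hσ0 Q hQ (measure_mono_null (hE Q hQ) h)
    have hl : volume (E Q) ≠ 0 := by
      intro h
      have := hE2 Q hQ
      rw [h, mul_zero, nonpos_iff_eq_zero] at this
      exact Q.vol_ne_zero this
    have key := key_ineq a b β u γ hβ (Finset.sum_nonneg fun j _ => (ha j).le) hu hγ1 hγa hγu
      (fun j => ν j Q.set) (fun j => ν j (E Q)) (σ Q.set) (σ (E Q)) Q.vol (volume (E Q)) W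
      (fun j => hν0 j Q hQ) (hσ0 Q hQ) hl (fun j => hν j Q hQ) (hσ Q hQ) Q.vol_ne_top hW
      (fun j => measure_mono (hE Q hQ)) (measure_mono (hE Q hQ)) (measure_mono (hE Q hQ)) (hE2 Q hQ)
      (h1 Q hQ) (h2 Q hQ)
    have e1 : ∫⁻ x in Q.set, g x ∂σ = σ Q.set * ((∫⁻ x in Q.set, g x ∂σ) / σ Q.set) := by
      rw [ENNReal.mul_div_cancel hσQ (hσ Q hQ)]
    rw [e1, Finset.prod_mul_distrib]
    calc _ = ((∏ j, (ν j Q.set / Q.vol) ^ (u * a j)) * σ Q.set) *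
          ((∏ j, ((∫⁻ x in Q.set, h j x ∂(ν j)) / ν j Q.set) ^ (u * a j)) *
            ((∫⁻ x in Q.set, g x ∂σ) / σ Q.set)) := by ring
      _ ≤ (c0 * W ^ (u * γ) *
        ((∏ j, ν j (E Q) ^ (u * b j)) * σ (E Q) ^ (1 - u * β))) *
          ((∏ j, ((∫⁻ x in Q.set, h j x ∂(ν j)) / ν j Q.set) ^ (u * a j)) *
            ((∫⁻ x in Q.set, g x ∂σ) / σ Q.set)) := mul_le_mul_left key _
      _ = c0 * W ^ (u * γ) * ((∏ j, ν j (E Q) ^ (u * b j) *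
          ((∫⁻ x in Q.set, h j x ∂(ν j)) / ν j Q.set) ^ (u * a j)) *
            (σ (E Q) ^ (1 - u * β) * ((∫⁻ x in Q.set, g x ∂σ) / σ Q.set))) := by
          rw [Finset.prod_mul_distrib]; ring
      _ ≤ c0 * W ^ (u * γ) * ((∏ j, M j * y j Q ^ (u * b j)) * (M' * y' Q ^ (1 - u * β))) := by
          refine mul_le_mul_right (mul_le_mul' (Finset.prod_le_prod' fun j _ => hy j Q hQ) (hy' Q hQ)) _
      _ = _ := by rw [Finset.prod_mul_distrib]; ring
  refine (Finset.sum_le_sum step).trans ?_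
  rw [← Finset.mul_sum, ← Finset.mul_sum]
  have hs := holder_sum S y' y (1 - u * β) (fun j => u * b j)
    (by rw [← Finset.mul_sum, ← hβ]; ring) (by linarith) (fun j => mul_nonneg hu.le (hb j))
  calc _ ≤ c0 * W ^ (u * γ) * (((∏ j, M j) * M') * ((∑ Q ∈ S, y' Q) ^ (1 - u * β) *
          ∏ j, (∑ Q ∈ S, y j Q) ^ (u * b j))) := mul_le_mul_right (mul_le_mul_right hs _) _
    _ = c0 * W ^ (u * γ) * ((∏ j, M j * (∑ Q ∈ S, y j Q) ^ (u * b j)) *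
          (M' * (∑ Q ∈ S, y' Q) ^ (1 - u * β))) := by rw [Finset.prod_mul_distrib]; ring
    _ ≤ c0 * W ^ (u * γ) * ((∏ j, cst (a j) (b j) u * N j ^ u) * (cst 1 (1 - u * β) 1 * G)) :=
        mul_le_mul_right (mul_le_mul' (Finset.prod_le_prod' fun j _ => hM j) hM') _
    _ = _ := by rw [Finset.prod_mul_distrib, Kd]; ring

lemma Kd_ne_top {m : ℕ} (a b : Fin m → ℝ) (β u γ : ℝ) (hb : ∀ j, 0 ≤ b j) (hu : 0 < u)
    (huβ : u * β ≤ 1) : Kd a b β u γ ≠ ∞ := by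
  refine ENNReal.mul_ne_top ENNReal.ofReal_ne_top (ENNReal.mul_ne_top ?_ ?_)
  · exact ENNReal.prod_ne_top fun j _ => cst_ne_top _ _ _ (mul_nonneg hu.le (hb j))
  · exact cst_ne_top _ _ _ (by linarith)

lemma main_abs {d m : ℕ} (a b : Fin m → ℝ) (β u γ : ℝ) (hβ : β = ∑ j, b j)
    (ha : ∀ j, 0 < a j) (hb : ∀ j, 0 ≤ b j) (hab : ∀ j, b j < a j)
    (hβ0 : 0 < β) (hu : 0 < u) (huβ : u * β ≤ 1) (hγ1 : 1 ≤ γ)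
    (hγa : ∀ j, a j ≤ γ * (a j - b j)) (hγu : 1 ≤ u * γ * β)
    (S : Finset (Cube d)) (hL : Lam Cube.set S) (E : Cube d → Set (Fin d → ℝ))
    (hEm : ∀ Q ∈ S, MeasurableSet (E Q)) (hE : ∀ Q ∈ S, E Q ⊆ Q.set)
    (hE2 : ∀ Q ∈ S, Q.vol ≤ 2 * volume (E Q))
    (hdisj : (S : Set (Cube d)).PairwiseDisjoint E)
    (ν : Fin m → Measure (Fin d → ℝ)) (σ : Measure (Fin d → ℝ))
    (hν : ∀ j, ∀ Q ∈ S, ν j Q.set ≠ ∞) (hσ : ∀ Q ∈ S, σ Q.set ≠ ∞)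
    (hν0 : ∀ j, ∀ Q ∈ S, ν j (E Q) ≠ 0) (hσ0 : ∀ Q ∈ S, σ (E Q) ≠ 0)
    (W : ℝ≥0∞) (hW : W ≠ ∞)
    (h1 : ∀ Q ∈ S, (∏ j, (ν j Q.set / Q.vol) ^ (a j - b j)) * (σ Q.set / Q.vol) ^ β ≤ W)
    (h2 : ∀ Q ∈ S, volume (E Q) ^ (∑ j, a j) ≤ (∏ j, ν j (E Q) ^ (a j - b j)) * σ (E Q) ^ β)
    (h : Fin m → (Fin d → ℝ) → ℝ≥0∞) (hh : ∀ j, Measurable (h j)) (N : Fin m → ℝ≥0∞)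
    (hNt : ∀ j, N j ≠ ∞)
    (hN1 : ∀ j, 0 < b j → ∫⁻ x, h j x ^ (a j / b j) ∂(ν j) ≤ N j ^ (1 / b j))
    (hN2 : ∀ j, b j = 0 → ∀ᵐ x ∂(ν j), h j x ≤ N j ^ (1 / a j)) :
    ∫⁻ x, (∑ Q ∈ S, Q.set.indicator (fun _ => (∏ j, (ν j Q.set / Q.vol) ^ (u * a j) *
        ((∫⁻ x in Q.set, h j x ∂(ν j)) / ν j Q.set) ^ (u * a j))) x) ^ (1 / (u * β)) ∂σ ≤
      (Kd a b β u γ) ^ (1 / (u * β)) * W ^ (γ / β) * (∏ j, N j) ^ (1 / β) := by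
  have h0 : 0 < u * β := by positivity
  set al : Cube d → ℝ≥0∞ := fun Q => ∏ j, (ν j Q.set / Q.vol) ^ (u * a j) *
        ((∫⁻ x in Q.set, h j x ∂(ν j)) / ν j Q.set) ^ (u * a j) with hal
  set T := Kd a b β u γ * W ^ (u * γ) * (∏ j, N j ^ u) with hT
  have hTt : T ≠ ∞ := by
    refine ENNReal.mul_ne_top (ENNReal.mul_ne_top (Kd_ne_top a b β u γ hb hu huβ) ?_) ?_
    · exact ENNReal.rpow_ne_top_of_nonneg (by positivity) hW
    · exact ENNReal.prod_ne_top fun j _ => ENNReal.rpow_ne_top_of_nonneg hu.le (hNt j)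
  have D1 : ∀ (g : (Fin d → ℝ) → ℝ≥0∞) (hg : Measurable g) (G : ℝ≥0∞)
    (hG1 : 0 < 1 - u * β → ∫⁻ x, g x ^ (1 / (1 - u * β)) ∂σ ≤ G ^ (1 / (1 - u * β)))
    (hG2 : 1 - u * β = 0 → ∀ᵐ x ∂σ, g x ≤ G),
      ∑ Q ∈ S, al Q * ∫⁻ x in Q.set, g x ∂σ ≤ T * G := by
    intro g hg G hG1 hG2
    refine (dual a b β u γ hβ ha hb hab hβ0 hu huβ hγ1 hγa hγu S hL E hEm hE hE2 hdisj ν σ hν hσ hν0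
      hσ0 W hW h1 h2 h hh N hN1 hN2 g hg G hG1 hG2).trans ?_
    rw [hT]; apply le_of_eq; ring
  have halt : ∀ Q ∈ S, al Q ≠ ∞ := by
    intro Q hQ htop
    have hσQ : σ Q.set ≠ 0 := fun h => hσ0 Q hQ (measure_mono_null (hE Q hQ) h)
    have := D1 (Q.set.indicator 1) (measurable_one.indicator Q.measurableSet)
      (σ Q.set ^ (1 - u * β)) (fun hp => by
        rw [← ENNReal.rpow_mul, mul_one_div_cancel hp.ne', ENNReal.rpow_one]
        rw [← lintegral_indicator_one Q.measurableSet]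
        apply lintegral_mono
        intro x
        by_cases hx : x ∈ Q.set
        · simp [hx]
        · simp [hx, ENNReal.zero_rpow_of_pos (inv_pos.2 hp)]) (fun hp => by
        filter_upwards with x
        rw [hp, ENNReal.rpow_zero]
        by_cases hx : x ∈ Q.set <;> simp [hx])
    have h3 := (Finset.single_le_sum (f := fun Q' => al Q' * ∫⁻ x in Q'.set, Q.set.indicator 1 x ∂σ)
      (fun _ _ => bot_le) hQ).trans this
    have h4 : ∫⁻ x in Q.set, Q.set.indicator (1 : (Fin d → ℝ) → ℝ≥0∞) x ∂σ = σ Q.set := by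
      rw [lintegral_indicator_one Q.measurableSet, Measure.restrict_apply Q.measurableSet, Set.inter_self]
    simp only [h4, htop, ENNReal.top_mul hσQ, top_le_iff] at h3
    exact ENNReal.mul_ne_top hTt (ENNReal.rpow_ne_top_of_nonneg (by linarith) (hσ Q hQ)) h3
  set F : (Fin d → ℝ) → ℝ≥0∞ := fun x => ∑ Q ∈ S, Q.set.indicator (fun _ => al Q) x with hF
  have hFm : Measurable F := Finset.measurable_sum _ fun Q _ => measurable_const.indicator Q.measurableSet
  set κ := 1 / (u * β) with hκ
  have hκ1 : 1 ≤ κ := by rw [hκ, le_div_iff₀ h0]; linarith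
  set I := ∫⁻ x, F x ^ κ ∂σ with hI
  have hsum : (∑ Q ∈ S, al Q) ≠ ∞ := (ENNReal.sum_lt_top.2 fun Q hQ => (halt Q hQ).lt_top).ne
  have hIt : I ≠ ∞ := by
    have : I ≤ ∫⁻ x in ⋃ Q ∈ S, Q.set, (∑ Q ∈ S, al Q) ^ κ ∂σ := by
      rw [← lintegral_indicator (Finset.measurableSet_biUnion S fun Q _ => Q.measurableSet)]
      apply lintegral_mono
      intro x
      by_cases hx : x ∈ ⋃ Q ∈ S, Q.set
      · rw [Set.indicator_of_mem hx]
        apply ENNReal.rpow_le_rpow _ (by linarith)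
        apply Finset.sum_le_sum
        intro Q hQ
        exact Set.indicator_le_self' (fun _ _ => bot_le) x
      · rw [Set.indicator_of_notMem hx]
        have : F x = 0 := by
          apply Finset.sum_eq_zero
          intro Q hQ
          apply Set.indicator_of_notMem
          intro hx'
          exact hx (Set.mem_biUnion hQ hx')
        beta_reduce
        rw [this, ENNReal.zero_rpow_of_pos (by linarith)]
    refine ne_top_of_le_ne_top ?_ this
    rw [setLIntegral_const]
    refine ENNReal.mul_ne_top (ENNReal.rpow_ne_top_of_nonneg (by linarith) hsum) ?_
    refine ne_top_of_le_ne_top ?_ (measure_biUnion_finset_le S _)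
    exact (ENNReal.sum_lt_top.2 fun Q hQ => (hσ Q hQ).lt_top).ne
  have hmain : I ≤ T * I ^ (1 - u * β) := by
    have e1 : I = ∑ Q ∈ S, al Q * ∫⁻ x in Q.set, F x ^ (κ - 1) ∂σ := by
      have : ∀ Q ∈ S, al Q * ∫⁻ x in Q.set, F x ^ (κ - 1) ∂σ =
          ∫⁻ x, Q.set.indicator (fun _ => al Q) x * F x ^ (κ - 1) ∂σ := by
        intro Q hQ
        rw [← lintegral_const_mul _ (hFm.pow_const _), ← lintegral_indicator Q.measurableSet]
        congr 1
        ext x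
        by_cases hx : x ∈ Q.set <;> simp [hx]
      rw [Finset.sum_congr rfl this, ← lintegral_finsetSum S (f := fun Q x =>
        Q.set.indicator (fun _ => al Q) x * F x ^ (κ - 1)) (fun Q _ =>
        (measurable_const.indicator (Cube.measurableSet Q)).mul (hFm.pow_const _))]
      apply lintegral_congr
      intro x
      rw [← Finset.sum_mul]
      have hx : F x = F x ^ (1:ℝ) := by simp
      change F x ^ κ = F x * F x ^ (κ - 1)
      nth_rw 2 [hx]
      rw [← ENNReal.rpow_add_of_nonneg _ _ (by linarith) (by linarith)]
      congr 1; ring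
    nth_rw 1 [e1]
    apply D1 _ (hFm.pow_const _)
    · intro hp
      rw [← ENNReal.rpow_mul, mul_one_div_cancel hp.ne', ENNReal.rpow_one, hI]
      apply le_of_eq
      congr 1; ext x
      rw [← ENNReal.rpow_mul]
      congr 1
      rw [hκ]; field_simp
    · intro hp
      filter_upwards with x
      have : κ - 1 = 0 := by
        rw [hκ, show u * β = 1 by linarith]; norm_num
      rw [hp, this, ENNReal.rpow_zero, ENNReal.rpow_zero]
  have hfin : I ≤ T ^ κ := by
    by_cases hI0 : I = 0
    · rw [hI0]; exact bot_le
    have hIs : I = I ^ (u * β) * I ^ (1 - u * β) := by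
      rw [← ENNReal.rpow_add _ _ hI0 hIt]; simp
    have h5 : I ^ (u * β) ≤ T := by
      have hm2 := hmain
      nth_rw 1 [hIs] at hm2
      rwa [ENNReal.mul_le_mul_iff_left] at hm2
      · rw [ne_eq, ENNReal.rpow_eq_zero_iff]; push Not
        exact ⟨fun h => absurd h hI0, fun h => absurd h hIt⟩
      · exact ENNReal.rpow_ne_top_of_nonneg (by linarith) hIt
    calc I = (I ^ (u * β)) ^ κ := by
          rw [← ENNReal.rpow_mul, hκ, mul_one_div_cancel h0.ne', ENNReal.rpow_one]
      _ ≤ _ := ENNReal.rpow_le_rpow h5 (by linarith)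
  refine hfin.trans (le_of_eq ?_)
  have hk0 : 0 ≤ κ := by linarith
  rw [hT, ENNReal.mul_rpow_of_nonneg _ _ hk0, ENNReal.mul_rpow_of_nonneg _ _ hk0, ← ENNReal.rpow_mul,
    ENNReal.prod_rpow_of_nonneg hu.le, ← ENNReal.rpow_mul]
  congr 2
  · congr 1; rw [hκ]; field_simp
  · rw [hκ]; field_simp


def vw (c : ℝ) (w : ℝ) : ℝ≥0∞ := ENNReal.ofReal w⁻¹ ^ (1 / c)

lemma vw_ex {w : ℝ} (hw : 0 < w) (c : ℝ) :
    vw c w = ENNReal.ofReal (Real.exp (-Real.log w * (1 / c))) := by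
  unfold vw
  rw [← ex_rpow, Real.exp_neg, Real.exp_log hw]

lemma of_ex {w : ℝ} (hw : 0 < w) : ENNReal.ofReal w = ENNReal.ofReal (Real.exp (Real.log w)) := by
  rw [Real.exp_log hw]

lemma ex_ne_zero (x : ℝ) : ENNReal.ofReal (Real.exp x) ≠ 0 := by
  rw [ne_eq, ENNReal.ofReal_eq_zero]; exact not_le.2 (Real.exp_pos x)

lemma wd_ne_zero {X : Type*} [MeasurableSpace X] (μ : Measure X) (v : X → ℝ≥0∞) (hv : Measurable v)
    (hv0 : ∀ x, v x ≠ 0) (E : Set X) (hE : μ E ≠ 0) : (μ.withDensity v) E ≠ 0 := by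
  rw [ne_eq, withDensity_apply_eq_zero' hv.aemeasurable]
  convert! hE using 3
  ext x; simp [hv0 x]

lemma w_ident {m : ℕ} (c : Fin m → ℝ) (β A : ℝ) (hc : ∀ j, c j ≠ 0) (hβ : β ≠ 0) (hA : A ≠ 0)
    (w : Fin m → ℝ) (hw : ∀ j, 0 < w j) :
    (ENNReal.ofReal (∏ j, w j) ^ (1 / β)) ^ (β / A) * ∏ j, vw (c j) (w j) ^ (c j / A) = 1 := by
  have hp : 0 < ∏ j, w j := Finset.prod_pos fun j _ => hw j
  have e1 : Real.log (∏ j, w j) = ∑ j, Real.log (w j) := Real.log_prod fun j _ => (hw j).ne'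
  simp only [vw_ex (hw _), of_ex hp, ex_rpow, ex_prod, ex_mul, e1]
  rw [show ((1:ℝ≥0∞) = ENNReal.ofReal (Real.exp 0)) by simp]
  congr 2
  have : ∀ j, -Real.log (w j) * (1 / c j) * (c j / A) = - (Real.log (w j) * (1 / A)) := by
    intro j; have := hc j; field_simp
  simp only [this, Finset.sum_neg_distrib, ← Finset.sum_mul]
  field_simp
  ring

lemma wd_holder {d m : ℕ} (a b : Fin m → ℝ) (β : ℝ) (hβ : β = ∑ j, b j)
    (hab : ∀ j, b j < a j) (hβ0 : 0 < β)
    (w : Fin m → (Fin d → ℝ) → ℝ) (hw : ∀ j, Measurable (w j)) (hw0 : ∀ j x, 0 < w j x)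
    (E : Set (Fin d → ℝ)) (hE : MeasurableSet E) :
    volume E ^ (∑ j, a j) ≤
      (∏ j, (volume.withDensity (fun x => vw (a j - b j) (w j x))) E ^ (a j - b j)) *
      (volume.withDensity (fun x => ENNReal.ofReal (∏ j, w j x) ^ (1 / β))) E ^ β := by
  have hA : ∑ j, a j = β + ∑ j, (a j - b j) := by rw [Finset.sum_sub_distrib, hβ]; ring
  have hA0 : 0 < ∑ j, a j := by
    rw [hA]
    have : 0 ≤ ∑ j, (a j - b j) := Finset.sum_nonneg fun j _ => by linarith [hab j]
    linarith
  set A := ∑ j, a j with hAd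
  have hvm : ∀ j, Measurable (fun x => vw (a j - b j) (w j x)) := fun j =>
    ((hw j).inv.ennreal_ofReal).pow_const _
  have hsm : Measurable (fun x => ENNReal.ofReal (∏ j, w j x) ^ (1 / β)) :=
    ((Finset.measurable_prod _ fun j _ => hw j).ennreal_ofReal).pow_const _
  have hH := ENNReal.lintegral_mul_prod_norm_pow_le (μ := volume.restrict E) Finset.univ
    hsm.aemeasurable (fun j _ => (hvm j).aemeasurable) (β / A) (p := fun j => (a j - b j) / A)
    (by rw [← Finset.sum_div, ← add_div, ← hA, div_self hA0.ne']) (by positivity)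
    (fun j _ => div_nonneg (by linarith [hab j]) hA0.le)
  have hid : ∀ x, (ENNReal.ofReal (∏ j, w j x) ^ (1 / β)) ^ (β / A) *
      ∏ j, vw (a j - b j) (w j x) ^ ((a j - b j) / A) = 1 := fun x =>
    w_ident (fun j => a j - b j) β A (fun j => by linarith [hab j] |> fun (h : 0 < a j - b j) => h.ne')
      hβ0.ne' hA0.ne' (fun j => w j x) (fun j => hw0 j x)
  simp only [hid, lintegral_const, Measure.restrict_apply MeasurableSet.univ, Set.univ_inter,
    one_mul] at hH
  have h3 := ENNReal.rpow_le_rpow hH hA0.le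
  refine h3.trans (le_of_eq ?_)
  rw [ENNReal.mul_rpow_of_nonneg _ _ hA0.le, ← ENNReal.prod_rpow_of_nonneg hA0.le, mul_comm]
  congr 1
  · apply Finset.prod_congr rfl
    intro j _
    rw [← ENNReal.rpow_mul, div_mul_cancel₀ _ hA0.ne', withDensity_apply _ hE]
  · rw [← ENNReal.rpow_mul, div_mul_cancel₀ _ hA0.ne', withDensity_apply _ hE]

lemma weighted {d m : ℕ} (a b : Fin m → ℝ) (β u γ : ℝ) (hβ : β = ∑ j, b j)
    (ha : ∀ j, 0 < a j) (hb : ∀ j, 0 ≤ b j) (hab : ∀ j, b j < a j)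
    (hβ0 : 0 < β) (hu : 0 < u) (huβ : u * β ≤ 1) (hγ1 : 1 ≤ γ)
    (hγa : ∀ j, a j ≤ γ * (a j - b j)) (hγu : 1 ≤ u * γ * β)
    (w : Fin m → (Fin d → ℝ) → ℝ) (hw : ∀ j, Measurable (w j)) (hw0 : ∀ j x, 0 < w j x)
    (W : ℝ≥0∞) (hW : W ≠ ∞) (hW0 : W ≠ 0)
    (h1 : ∀ Q : Cube d, (∏ j, av (fun x => vw (a j - b j) (w j x)) Q ^ (a j - b j)) *
      (av (fun x => ENNReal.ofReal (∏ j, w j x) ^ (1 / β)) Q) ^ β ≤ W)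
    (S : Finset (Cube d)) (hL : Lam Cube.set S) (E : Cube d → Set (Fin d → ℝ))
    (hEm : ∀ Q ∈ S, MeasurableSet (E Q)) (hE : ∀ Q ∈ S, E Q ⊆ Q.set)
    (hE2 : ∀ Q ∈ S, Q.vol ≤ 2 * volume (E Q))
    (hdisj : (S : Set (Cube d)).PairwiseDisjoint E)
    (F : Fin m → (Fin d → ℝ) → ℝ≥0∞) (hF : ∀ j, Measurable (F j)) (N : Fin m → ℝ≥0∞)
    (hN1 : ∀ j, 0 < b j → N j = (∫⁻ x, (F j x * ENNReal.ofReal (w j x)) ^ (1 / b j)) ^ (b j))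
    (hN2 : ∀ j, b j = 0 → N j = essSup (fun x => F j x * ENNReal.ofReal (w j x)) volume) :
    ∫⁻ x, (∑ Q ∈ S, Q.set.indicator
        (fun _ => (∏ j, av (fun y => F j y ^ (1 / a j)) Q ^ a j) ^ u) x) ^ (1 / (u * β)) *
        (ENNReal.ofReal (∏ j, w j x) ^ (1 / β)) ≤
      (Kd a b β u γ + 1) ^ (1 / (u * β)) * W ^ (γ / β) * (∏ j, N j) ^ (1 / β) := by
  have h0 : 0 < u * β := by positivity
  have hc : ∀ j, 0 < a j - b j := fun j => by linarith [hab j]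
  set v : Fin m → (Fin d → ℝ) → ℝ≥0∞ := fun j x => vw (a j - b j) (w j x) with hv
  set sg : (Fin d → ℝ) → ℝ≥0∞ := fun x => ENNReal.ofReal (∏ j, w j x) ^ (1 / β) with hsg
  have hvm : ∀ j, Measurable (v j) := fun j => ((hw j).inv.ennreal_ofReal).pow_const _
  have hsm : Measurable sg :=
    ((Finset.measurable_prod _ fun j _ => hw j).ennreal_ofReal).pow_const _
  have hv0 : ∀ j x, v j x ≠ 0 := fun j x => by rw [hv]; beta_reduce; rw [vw_ex (hw0 j x)]; exact ex_ne_zero _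
  have hvt : ∀ j x, v j x ≠ ∞ := fun j x => by
    rw [hv]; beta_reduce; rw [vw_ex (hw0 j x)]; exact ENNReal.ofReal_ne_top
  have hs0 : ∀ x, sg x ≠ 0 := fun x => by
    rw [hsg]; beta_reduce; rw [of_ex (Finset.prod_pos fun j _ => hw0 j x), ex_rpow]; exact ex_ne_zero _
  have hwne : ∀ j x, ENNReal.ofReal (w j x) ≠ 0 := fun j x => by
    rw [of_ex (hw0 j x)]; exact ex_ne_zero _
  by_cases hz : ∃ i, N i = 0
  · obtain ⟨i, hi⟩ := hz
    have hFi : ∀ᵐ x ∂volume, F i x = 0 := by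
      have hmul : ∀ᵐ x ∂volume, F i x * ENNReal.ofReal (w i x) = 0 := by
        rcases (hb i).eq_or_lt with hb0 | hb0
        · rw [hN2 i hb0.symm] at hi
          filter_upwards [ENNReal.ae_le_essSup (μ := volume) (fun x => F i x * ENNReal.ofReal (w i x))]
            with x hx
          rw [hi] at hx
          exact le_antisymm hx bot_le
        · have hmm : Measurable (fun x => (F i x * ENNReal.ofReal (w i x)) ^ (1 / b i)) :=
            ((hF i).mul (hw i).ennreal_ofReal).pow_const _
          rw [hN1 i hb0, ENNReal.rpow_eq_zero_iff_of_pos hb0, lintegral_eq_zero_iff hmm] at hi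
          filter_upwards [hi] with x hx
          simpa [ENNReal.rpow_eq_zero_iff_of_pos (one_div_pos.2 hb0), inv_pos.2 hb0, not_lt.2 (inv_pos.2 hb0).le] using hx
      filter_upwards [hmul] with x hx
      exact (mul_eq_zero.1 hx).resolve_right (hwne i x)
    have hav : ∀ Q : Cube d, (∏ j, av (fun y => F j y ^ (1 / a j)) Q ^ a j) ^ u = 0 := by
      intro Q
      rw [ENNReal.rpow_eq_zero_iff_of_pos hu]
      apply Finset.prod_eq_zero (Finset.mem_univ i)
      rw [ENNReal.rpow_eq_zero_iff_of_pos (ha i)]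
      unfold av
      rw [ENNReal.div_eq_zero_iff]
      left
      rw [← lintegral_zero]
      apply lintegral_congr_ae
      filter_upwards [ae_restrict_of_ae hFi] with x hx
      rw [hx, ENNReal.zero_rpow_of_pos (one_div_pos.2 (ha i))]
    simp only [hav, Set.indicator_zero, Finset.sum_const_zero, ENNReal.zero_rpow_of_pos (one_div_pos.2 h0),
      zero_mul, lintegral_zero]
    exact bot_le
  push Not at hz
  by_cases ht : ∃ i, N i = ∞
  · obtain ⟨i, hi⟩ := ht
    have hp : ∏ j, N j = ∞ := by
      rw [← Finset.mul_prod_erase _ _ (Finset.mem_univ i), hi, ENNReal.top_mul]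
      exact Finset.prod_ne_zero_iff.2 fun j _ => hz j
    rw [hp, ENNReal.top_rpow_of_pos (by positivity), ENNReal.mul_top]
    · exact le_top
    · refine mul_ne_zero ?_ ?_
      · rw [ne_eq, ENNReal.rpow_eq_zero_iff_of_pos (by positivity)]; simp
      · rw [ne_eq, ENNReal.rpow_eq_zero_iff_of_pos (by positivity)]; exact hW0
  push Not at ht
  set ν : Fin m → Measure (Fin d → ℝ) := fun j => volume.withDensity (v j) with hν
  set σ : Measure (Fin d → ℝ) := volume.withDensity sg with hσ
  have avν : ∀ j (Q : Cube d), av (v j) Q = ν j Q.set / Q.vol := fun j Q => by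
    rw [av, hν]; beta_reduce; rw [withDensity_apply _ Q.measurableSet]
  have avσ : ∀ (Q : Cube d), av sg Q = σ Q.set / Q.vol := fun Q => by
    rw [av, hσ, withDensity_apply _ Q.measurableSet]
  have hν0 : ∀ j (B : Set (Fin d → ℝ)), volume B ≠ 0 → ν j B ≠ 0 := fun j B hB =>
    wd_ne_zero volume (v j) (hvm j) (hv0 j) B hB
  have hσ0 : ∀ (B : Set (Fin d → ℝ)), volume B ≠ 0 → σ B ≠ 0 := fun B hB =>
    wd_ne_zero volume sg hsm hs0 B hB
  have hEv : ∀ Q ∈ S, volume (E Q) ≠ 0 := by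
    intro Q hQ h
    have := hE2 Q hQ
    rw [h, mul_zero, nonpos_iff_eq_zero] at this
    exact Q.vol_ne_zero this
  have h1' : ∀ Q : Cube d, (∏ j, (ν j Q.set / Q.vol) ^ (a j - b j)) * (σ Q.set / Q.vol) ^ β ≤ W := by
    intro Q
    have := h1 Q
    rw [avσ] at this
    refine le_trans (le_of_eq ?_) this
    congr 1
    exact Finset.prod_congr rfl fun j _ => by rw [← avν]
  have hX0 : ∀ j (Q : Cube d), (ν j Q.set / Q.vol) ^ (a j - b j) ≠ 0 := fun j Q => by
    rw [ne_eq, ENNReal.rpow_eq_zero_iff_of_pos (hc j), ENNReal.div_eq_zero_iff]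
    push Not
    exact ⟨hν0 j _ Q.vol_ne_zero, Q.vol_ne_top⟩
  have hY0 : ∀ (Q : Cube d), (σ Q.set / Q.vol) ^ β ≠ 0 := fun Q => by
    rw [ne_eq, ENNReal.rpow_eq_zero_iff_of_pos hβ0, ENNReal.div_eq_zero_iff]
    push Not
    exact ⟨hσ0 _ Q.vol_ne_zero, Q.vol_ne_top⟩
  have hνt : ∀ j (Q : Cube d), ν j Q.set ≠ ∞ := by
    intro j Q htop
    have := h1' Q
    rw [← Finset.mul_prod_erase _ _ (Finset.mem_univ j), htop, ENNReal.top_div_of_ne_top Q.vol_ne_top,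
      ENNReal.top_rpow_of_pos (hc j), ENNReal.top_mul, ENNReal.top_mul (hY0 Q), top_le_iff] at this
    · exact hW this
    · exact Finset.prod_ne_zero_iff.2 fun i _ => hX0 i Q
  have hσt : ∀ (Q : Cube d), σ Q.set ≠ ∞ := by
    intro Q htop
    have := h1' Q
    rw [htop, ENNReal.top_div_of_ne_top Q.vol_ne_top,
      ENNReal.top_rpow_of_pos hβ0, ENNReal.mul_top, top_le_iff] at this
    · exact hW this
    · exact Finset.prod_ne_zero_iff.2 fun i _ => hX0 i Q
  set h : Fin m → (Fin d → ℝ) → ℝ≥0∞ := fun j x => F j x ^ (1 / a j) / v j x with hh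
  have hhm : ∀ j, Measurable (h j) := fun j => ((hF j).pow_const _).div (hvm j)
  have hvh : ∀ j x, v j x * h j x = F j x ^ (1 / a j) := fun j x =>
    ENNReal.mul_div_cancel (hv0 j x) (hvt j x)
  have hN1' : ∀ j, 0 < b j → ∫⁻ x, h j x ^ (a j / b j) ∂(ν j) ≤ N j ^ (1 / b j) := by
    intro j hbj
    rw [hN1 j hbj, ← ENNReal.rpow_mul, mul_one_div_cancel hbj.ne', ENNReal.rpow_one,
      lintegral_withDensity_eq_lintegral_mul volume (hvm j) ((hhm j).pow_const _)]
    apply le_of_eq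
    apply lintegral_congr
    intro x
    simp only [Pi.mul_apply, hh]
    have hq : 0 ≤ a j / b j := by have := ha j; positivity
    rw [ENNReal.div_rpow_of_nonneg _ _ hq, ← ENNReal.rpow_mul, ENNReal.mul_rpow_of_nonneg _ _ (by positivity),
      div_eq_mul_inv, mul_left_comm]
    congr 1
    · congr 1
      have := ha j
      field_simp
    · rw [hv]; beta_reduce
      rw [vw_ex (hw0 j x), of_ex (hw0 j x), ex_rpow, ex_rpow, ← ENNReal.ofReal_inv_of_pos (Real.exp_pos _),
        ← Real.exp_neg, ex_mul]
      congr 2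
      have := hc j
      field_simp
      ring
  have hN2' : ∀ j, b j = 0 → ∀ᵐ x ∂(ν j), h j x ≤ N j ^ (1 / a j) := by
    intro j hbj
    apply (withDensity_absolutelyContinuous volume (v j)).ae_le
    rw [hN2 j hbj]
    filter_upwards [ENNReal.ae_le_essSup (μ := volume) (fun x => F j x * ENNReal.ofReal (w j x))] with x hx
    refine le_trans (le_of_eq ?_) (ENNReal.rpow_le_rpow hx (one_div_pos.2 (ha j)).le)
    simp only [hh]
    rw [ENNReal.mul_rpow_of_nonneg _ _ (one_div_pos.2 (ha j)).le, div_eq_mul_inv]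
    congr 1
    rw [hv]; beta_reduce
    rw [vw_ex (hw0 j x), of_ex (hw0 j x), ex_rpow, ← ENNReal.ofReal_inv_of_pos (Real.exp_pos _),
        ← Real.exp_neg, hbj]
    congr 2
    ring
  have hM := main_abs a b β u γ hβ ha hb hab hβ0 hu huβ hγ1 hγa hγu S hL E hEm hE hE2 hdisj ν σ
    (fun j Q _ => hνt j Q) (fun Q _ => hσt Q) (fun j Q hQ => hν0 j _ (hEv Q hQ))
    (fun Q hQ => hσ0 _ (hEv Q hQ)) W hW (fun Q _ => h1' Q)
    (fun Q hQ => wd_holder a b β hβ hab hβ0 w hw hw0 (E Q) (hEm Q hQ)) h hhm N ht hN1' hN2'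
  have hal : ∀ Q : Cube d, (∏ j, (ν j Q.set / Q.vol) ^ (u * a j) *
        ((∫⁻ x in Q.set, h j x ∂(ν j)) / ν j Q.set) ^ (u * a j)) =
      (∏ j, av (fun y => F j y ^ (1 / a j)) Q ^ a j) ^ u := by
    intro Q
    rw [← ENNReal.prod_rpow_of_nonneg hu.le]
    apply Finset.prod_congr rfl
    intro j _
    rw [← ENNReal.mul_rpow_of_nonneg _ _ (mul_pos hu (ha j)).le, ← ENNReal.rpow_mul, mul_comm (a j) u]
    congr 1
    rw [setLIntegral_withDensity_eq_setLIntegral_mul volume (hvm j) (hhm j) Q.measurableSet]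
    simp only [Pi.mul_apply, hvh]
    rw [av, mul_comm, div_eq_mul_inv, div_eq_mul_inv, div_eq_mul_inv, mul_assoc]
    congr 1
    rw [← mul_assoc, ENNReal.inv_mul_cancel (hν0 j _ Q.vol_ne_zero) (hνt j Q), one_mul]
  simp only [hal] at hM
  rw [lintegral_withDensity_eq_lintegral_mul volume hsm] at hM
  · simp only [Pi.mul_apply, mul_comm (sg _)] at hM
    refine hM.trans ?_
    refine mul_le_mul_left (mul_le_mul_left (ENNReal.rpow_le_rpow le_self_add (by positivity)) _) _
  · exact (Finset.measurable_sum _ fun Q _ => measurable_const.indicator (Cube.measurableSet Q)).pow_const _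


lemma rpow_sum_le_sum_rpow {ι : Type*} (S : Finset ι) (f : ι → ℝ≥0∞) {p : ℝ} (hp : 0 < p) (hp1 : p ≤ 1) :
    (∑ i ∈ S, f i) ^ p ≤ ∑ i ∈ S, f i ^ p := by
  classical
  induction S using Finset.induction_on with
  | empty => simp [ENNReal.zero_rpow_of_pos hp]
  | insert i S hi ih =>
    rw [Finset.sum_insert hi, Finset.sum_insert hi]
    exact (ENNReal.rpow_add_le_add_rpow _ _ hp.le hp1).trans (add_le_add_right ih _)

lemma avg_inv {d : ℕ} {x : ℝ≥0∞} (hx : x ≠ 0) (F : (Fin d → ℝ) → ℝ≥0∞) (Q : Cube d) :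
    avg x⁻¹ F Q = av (fun y => F y ^ (1 / x.toReal)) Q ^ x.toReal := by
  rw [avg_eq_av (ENNReal.inv_ne_top.2 hx), ENNReal.toReal_inv]
  simp only [one_div, inv_inv]

lemma gamma_facts {m : ℕ} (hm : 1 ≤ m)
    (r : Fin m → ℝ≥0∞) (hr : ∀ j, 0 < r j ∧ r j ≠ ∞) (T : ℝ≥0∞) (hT0 : T ≠ 0) (hT : T ≠ ∞)
    (q : ℝ≥0∞) (hq1 : (∑ j, (r j)⁻¹)⁻¹ ≤ q) (hq2 : q ≤ T)
    (p : Fin m → ℝ≥0∞) (hrp : ∀ j, r j < p j) (hpfin : (∑ j, (p j)⁻¹)⁻¹ ≠ ∞) (γ : ℝ)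
    (hγ : γ = (max (⨆ j, (r j)⁻¹ / ((r j)⁻¹ - (p j)⁻¹)) ((∑ j, (p j)⁻¹)⁻¹ / q)).toReal) :
    1 ≤ γ ∧ (∀ j, (r j)⁻¹.toReal ≤ γ * ((r j)⁻¹.toReal - (p j)⁻¹.toReal)) ∧
      (∑ j, (p j)⁻¹)⁻¹.toReal ≤ γ * T.toReal := by
  have hri : ∀ j, (r j)⁻¹ ≠ ∞ := fun j => ENNReal.inv_ne_top.2 (hr j).1.ne'
  have hlt : ∀ j, (p j)⁻¹ < (r j)⁻¹ := fun j => ENNReal.inv_lt_inv.2 (hrp j)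
  have hc0 : ∀ j, (r j)⁻¹ - (p j)⁻¹ ≠ 0 := fun j => (tsub_pos_of_lt (hlt j)).ne'
  have hcr : ∀ j, ((r j)⁻¹ - (p j)⁻¹).toReal = (r j)⁻¹.toReal - (p j)⁻¹.toReal := fun j =>
    ENNReal.toReal_sub_of_le (hlt j).le (hri j)
  have hq0 : q ≠ 0 := by
    intro h
    rw [h, nonpos_iff_eq_zero, ENNReal.inv_eq_zero] at hq1
    exact (ENNReal.sum_lt_top.2 fun j _ => (hri j).lt_top).ne hq1
  have hqt : q ≠ ∞ := ne_top_of_le_ne_top hT hq2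
  have hfin : max (⨆ j, (r j)⁻¹ / ((r j)⁻¹ - (p j)⁻¹)) ((∑ j, (p j)⁻¹)⁻¹ / q) ≠ ∞ := by
    refine (max_lt ?_ (ENNReal.div_lt_top hpfin hq0)).ne
    rw [← Finset.sup_univ_eq_iSup]
    rw [Finset.sup_lt_iff (by simp)]
    intro j _
    exact ENNReal.div_lt_top (hri j) (hc0 j)
  have hj : ∀ j, (r j)⁻¹.toReal ≤ γ * ((r j)⁻¹.toReal - (p j)⁻¹.toReal) := by
    intro j
    have h1 : ((r j)⁻¹ / ((r j)⁻¹ - (p j)⁻¹)).toReal ≤ γ := by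
      rw [hγ]
      exact ENNReal.toReal_mono hfin ((le_iSup (fun j => (r j)⁻¹ / ((r j)⁻¹ - (p j)⁻¹)) j).trans
        (le_max_left _ _))
    rw [ENNReal.toReal_div, hcr] at h1
    rwa [div_le_iff₀] at h1
    rw [← hcr]
    exact ENNReal.toReal_pos (hc0 j) (ne_top_of_le_ne_top (hri j) tsub_le_self)
  refine ⟨?_, hj, ?_⟩
  · have j0 : Fin m := ⟨0, hm⟩
    have h1 := hj j0
    have h2 : 0 < (r j0)⁻¹.toReal - (p j0)⁻¹.toReal := by
      rw [← hcr]
      exact ENNReal.toReal_pos (hc0 j0) (ne_top_of_le_ne_top (hri j0) tsub_le_self)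
    have h3 : 0 ≤ (p j0)⁻¹.toReal := ENNReal.toReal_nonneg
    by_contra hcon
    push Not at hcon
    nlinarith
  · have h1 : ((∑ j, (p j)⁻¹)⁻¹ / q).toReal ≤ γ := by
      rw [hγ]
      exact ENNReal.toReal_mono hfin (le_max_right _ _)
    have hqp := ENNReal.toReal_pos hq0 hqt
    rw [ENNReal.toReal_div, div_le_iff₀ hqp] at h1
    refine h1.trans ?_
    have : 0 ≤ γ := by rw [hγ]; exact ENNReal.toReal_nonneg
    exact mul_le_mul_of_nonneg_left (ENNReal.toReal_mono hT hq2) this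

lemma grid_bound (d m : ℕ) (hm : 1 ≤ m)
    (r : Fin m → ℝ≥0∞) (hr : ∀ j, 0 < r j ∧ r j ≠ ∞)
    (t : Fin m → ℝ≥0∞) (hrt : ∀ j, r j < t j) (htfin : (∑ j, (t j)⁻¹)⁻¹ ≠ ∞)
    (q : ℝ≥0∞) (hq1 : (∑ j, (r j)⁻¹)⁻¹ ≤ q) (hq2 : q ≤ (∑ j, (t j)⁻¹)⁻¹)
    (p : Fin m → ℝ≥0∞) (hrp : ∀ j, r j < p j) (hpfin : (∑ j, (p j)⁻¹)⁻¹ ≠ ∞) :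
    ∃ C : ℝ≥0∞, C ≠ 0 ∧ C ≠ ∞ ∧
      ∀ (Ω : Type) [MeasurableSpace Ω] (μ : Measure Ω) [SFinite μ],
      ∀ (w : Fin m → (Fin d → ℝ) → ℝ),
        (∀ j, Measurable (w j)) → (∀ j x, 0 < w j x) →
        aConst p r ∞ w ≠ ∞ →
        ∀ (e : Fin d → ℝ) (δ : ℝ) (hδ : 0 < δ)
          (D : Finset (Cube d)) (_ : ∀ Q ∈ D, InGrid e δ hδ Q) (f : Fin m → (Fin d → ℝ) → Ω → ℂ),
          (∀ j, Measurable (Function.uncurry (f j))) →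
          wNorm (∑ j, (p j)⁻¹)⁻¹ (fun x => ∏ j, w j x)
              (fun x => eNorm (∑ j, (t j)⁻¹)⁻¹ μ (latMax r D f x)) ≤
            C * aConst p r ∞ w ^
                ((max (⨆ j, (r j)⁻¹ / ((r j)⁻¹ - (p j)⁻¹))
                  ((∑ j, (p j)⁻¹)⁻¹ / q)).toReal) *
              ∏ j, wNorm (p j) (w j) (fun x => eNorm (t j) μ (nn (f j x))) := by
  obtain ⟨K, hKt, hK0, hK⟩ := weakm d m r hr t hrt htfin
  set T := (∑ j, (t j)⁻¹)⁻¹ with hTd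
  have hT0 : T ≠ 0 := by
    rw [hTd, ne_eq, ENNReal.inv_eq_zero]
    exact (ENNReal.sum_lt_top.2 fun j _ => (ENNReal.inv_ne_top.2 ((hr j).1.trans (hrt j)).ne').lt_top).ne
  have hpi : ∀ j, (p j)⁻¹ ≠ ∞ := fun j => ENNReal.inv_ne_top.2 ((hr j).1.trans (hrp j)).ne'
  have hri : ∀ j, (r j)⁻¹ ≠ ∞ := fun j => ENNReal.inv_ne_top.2 (hr j).1.ne'
  have hlt : ∀ j, (p j)⁻¹ < (r j)⁻¹ := fun j => ENNReal.inv_lt_inv.2 (hrp j)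
  have hc0 : ∀ j, (r j)⁻¹ - (p j)⁻¹ ≠ 0 := fun j => (tsub_pos_of_lt (hlt j)).ne'
  have hsp : (∑ j, (p j)⁻¹) ≠ ∞ := (ENNReal.sum_lt_top.2 fun j _ => (hpi j).lt_top).ne
  have hsp0 : (∑ j, (p j)⁻¹) ≠ 0 := ENNReal.inv_ne_top.1 hpfin
  set a : Fin m → ℝ := fun j => (r j)⁻¹.toReal with ha
  set b : Fin m → ℝ := fun j => (p j)⁻¹.toReal with hb
  set β : ℝ := (∑ j, (p j)⁻¹).toReal with hβd
  have hβ : β = ∑ j, b j := by rw [hβd, ENNReal.toReal_sum fun j _ => hpi j]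
  have hβ0 : 0 < β := ENNReal.toReal_pos hsp0 hsp
  have hcr : ∀ j, ((r j)⁻¹ - (p j)⁻¹).toReal = a j - b j := fun j =>
    ENNReal.toReal_sub_of_le (hlt j).le (hri j)
  set γ : ℝ := (max (⨆ j, (r j)⁻¹ / ((r j)⁻¹ - (p j)⁻¹)) ((∑ j, (p j)⁻¹)⁻¹ / q)).toReal with hγ
  obtain ⟨hγ1, hγa, hγT⟩ := gamma_facts hm r hr T hT0 htfin q hq1 hq2 p hrp hpfin γ hγ
  rw [ENNReal.toReal_inv, ← hβd] at hγT
  have hTp : 0 < T.toReal := ENNReal.toReal_pos hT0 htfin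
  set u : ℝ := min β⁻¹ T.toReal with hud
  have hu : 0 < u := lt_min (inv_pos.2 hβ0) hTp
  have huT : u ≤ T.toReal := min_le_right _ _
  have huβ : u * β ≤ 1 := by
    calc u * β ≤ β⁻¹ * β := mul_le_mul_of_nonneg_right (min_le_left _ _) hβ0.le
      _ = 1 := inv_mul_cancel₀ hβ0.ne'
  have hγu : 1 ≤ u * γ * β := by
    rcases min_choice β⁻¹ T.toReal with h | h
    · rw [hud, h]
      have : β⁻¹ * γ * β = γ := by field_simp
      rw [this]; exact hγ1
    · rw [hud, h]
      have := mul_le_mul_of_nonneg_right hγT hβ0.le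
      rw [inv_mul_cancel₀ hβ0.ne'] at this
      linarith
  have ha0 : ∀ j, 0 < a j := fun j => ENNReal.toReal_pos (ENNReal.inv_ne_zero.2 (hr j).2) (hri j)
  have hb0 : ∀ j, 0 ≤ b j := fun j => ENNReal.toReal_nonneg
  have hab : ∀ j, b j < a j := fun j => (ENNReal.toReal_lt_toReal (hpi j) (hri j)).2 (hlt j)
  have hKd : Kd a b β u γ ≠ ∞ := Kd_ne_top a b β u γ hb0 hu huβ
  refine ⟨K * (Kd a b β u γ + 1) ^ (1 / u), mul_ne_zero hK0 ?_, ENNReal.mul_ne_top hKt ?_, ?_⟩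
  · rw [ne_eq, ENNReal.rpow_eq_zero_iff_of_pos (by positivity)]; simp
  · exact ENNReal.rpow_ne_top_of_nonneg (by positivity) (by simp [hKd])
  intro Ω _ μ _ w hw hw0 hWt e δ hδ D hD f hf
  set W := aConst p r ∞ w with hWd
  have h1 : ∀ Q : Cube d, (∏ j, av (fun x => vw (a j - b j) (w j x)) Q ^ (a j - b j)) *
      (av (fun x => ENNReal.ofReal (∏ j, w j x) ^ (1 / β)) Q) ^ β ≤ W := by
    intro Q
    refine le_trans (le_of_eq ?_) (le_iSup (fun Q : Cube d =>
      (∏ j, avg ((r j)⁻¹ - (p j)⁻¹)⁻¹ (fun x => ENNReal.ofReal (w j x)⁻¹) Q) *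
      avg ((∑ j, (p j)⁻¹) - ∞⁻¹)⁻¹ (fun x => ENNReal.ofReal (∏ j, w j x)) Q) Q)
    rw [ENNReal.inv_top, tsub_zero, avg_inv hsp0, ← hβd]
    congr 1
    apply Finset.prod_congr rfl
    intro j _
    rw [avg_inv (hc0 j), hcr]
    rfl
  have hW0 : W ≠ 0 := by
    intro h
    have h2 := h1 ⟨0, 1, one_pos⟩
    rw [h, nonpos_iff_eq_zero, mul_eq_zero, Finset.prod_eq_zero_iff] at h2
    have hav : ∀ (g : (Fin d → ℝ) → ℝ≥0∞) (c : ℝ) (Q : Cube d), Measurable g → (∀ x, g x ≠ 0) → 0 < c →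
        av g Q ^ c ≠ 0 := by
      intro g c Q hg hg0 hc h3
      rw [ENNReal.rpow_eq_zero_iff_of_pos hc, av, ENNReal.div_eq_zero_iff] at h3
      have h4 := h3.resolve_right Q.vol_ne_top
      rw [← withDensity_apply _ Q.measurableSet] at h4
      exact wd_ne_zero volume g hg hg0 _ Q.vol_ne_zero h4
    rcases h2 with ⟨j, _, h2⟩ | h2
    · refine hav _ _ _ ?_ ?_ ?_ h2
      · exact ((hw j).inv.ennreal_ofReal).pow_const _
      · intro x; rw [vw_ex (hw0 j x)]; exact ex_ne_zero _
      · linarith [hab j]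
    · refine hav _ _ _ ?_ ?_ hβ0 h2
      · exact ((Finset.measurable_prod _ fun j _ => hw j).ennreal_ofReal).pow_const _
      · intro x; rw [of_ex (Finset.prod_pos fun j _ => hw0 j x), ex_rpow]; exact ex_ne_zero _
  set F : Fin m → (Fin d → ℝ) → ℝ≥0∞ := fun j y => eNorm (t j) μ (nn (f j y)) with hF
  have hFm : ∀ j, Measurable (F j) := fun j => measurable_eNorm (t j) μ _ (measurable_nn (f j) (hf j))
  set N : Fin m → ℝ≥0∞ := fun j => wNorm (p j) (w j) (F j) with hN
  have hN1 : ∀ j, 0 < b j → N j = (∫⁻ x, (F j x * ENNReal.ofReal (w j x)) ^ (1 / b j)) ^ (b j) := by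
    intro j hbj
    have hpt : p j ≠ ∞ := by
      intro h
      simp only [hb, h, ENNReal.inv_top, ENNReal.toReal_zero, lt_self_iff_false] at hbj
    have e1 : b j = 1 / (p j).toReal := by simp only [hb, ENNReal.toReal_inv, one_div]
    simp only [hN, wNorm]
    rw [eNorm_of_ne_top hpt, e1, one_div_one_div]
  have hN2 : ∀ j, b j = 0 → N j = essSup (fun x => F j x * ENNReal.ofReal (w j x)) volume := by
    intro j hbj
    have hpt : p j = ∞ := by
      by_contra h
      exact (ENNReal.toReal_pos (ENNReal.inv_ne_zero.2 h) (hpi j)).ne' hbj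
    simp only [hN, wNorm, hpt]
    rw [eNorm_top]
  have hlm : ∀ (D : Finset (Cube d)) x, latMax r D f x =
    (fun ω => mx Cube.set D (fun Q => (∏ j, latAvg (r j) (f j) Q ω)) x) := fun D x => rfl
  have hA : ∀ Q, Measurable (fun ω => ∏ j, latAvg (r j) (f j) Q ω) := by
    intro Q
    apply Finset.measurable_prod
    intro j _
    refine (measurable_av (fun y ω => (nn (f j y) ω) ^ (r j).toReal) ?_ Q).pow_const _
    exact (measurable_nn (f j) (hf j)).pow_const _
  obtain ⟨S, hSD, E, hE, hdisj, hdom⟩ := sparse_dom μ e δ hδ T hT0 htfin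
    (fun Q ω => ∏ j, latAvg (r j) (f j) Q ω) hA (fun Q => K * ∏ j, avg (r j) (F j) Q)
    (fun D Q0 h1 h2 => hK Ω μ e δ hδ f hf D Q0 h1 h2) D.card D le_rfl hD
  have hL : Lam Cube.set S := grid_lam e δ hδ S fun Q hQ => hD Q (hSD hQ)
  have key := weighted a b β u γ hβ ha0 hb0 hab hβ0 hu huβ hγ1 hγa hγu w hw hw0 W hWt hW0 h1 S hL E
    (fun Q hQ => (hE Q hQ).1) (fun Q hQ => (hE Q hQ).2.1) (fun Q hQ => (hE Q hQ).2.2) hdisj F hFm N hN1 hN2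
  set G : Cube d → ℝ≥0∞ := fun Q => ∏ j, av (fun y => F j y ^ (1 / a j)) Q ^ a j with hG
  have hGe : ∀ Q, ∏ j, avg (r j) (F j) Q = G Q := by
    intro Q
    apply Finset.prod_congr rfl
    intro j _
    rw [avg_eq_av (hr j).2]
    have : a j = 1 / (r j).toReal := by simp only [ha, ENNReal.toReal_inv, one_div]
    rw [this, one_div_one_div]
  set Φ : (Fin d → ℝ) → ℝ≥0∞ := fun x => eNorm T μ (latMax r D f x) with hΦ
  have hpt : ∀ x, Φ x ^ u ≤ K ^ u * ∑ Q ∈ S, Q.set.indicator (fun _ => G Q ^ u) x := by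
    intro x
    have h2 := hdom x
    have e1 : Φ x ^ u = (Φ x ^ T.toReal) ^ (u / T.toReal) := by
      rw [← ENNReal.rpow_mul]; congr 1; field_simp
    have hup : 0 < u / T.toReal := by positivity
    rw [e1]
    refine (ENNReal.rpow_le_rpow h2 hup.le).trans ?_
    refine (rpow_sum_le_sum_rpow S _ hup ((div_le_one hTp).2 huT)).trans ?_
    rw [Finset.mul_sum]
    apply Finset.sum_le_sum
    intro Q _
    by_cases hx : x ∈ Q.set
    · rw [Set.indicator_of_mem hx, Set.indicator_of_mem hx, hGe, ← ENNReal.rpow_mul,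
        ← ENNReal.mul_rpow_of_nonneg _ _ hu.le, mul_div_cancel₀ _ hTp.ne']
    · rw [Set.indicator_of_notMem hx, Set.indicator_of_notMem hx, ENNReal.zero_rpow_of_pos hup]
      exact bot_le
  have hPr : (∑ j, (p j)⁻¹)⁻¹.toReal = 1 / β := by rw [ENNReal.toReal_inv, one_div]
  have hpt2 : ∀ x, (Φ x * ENNReal.ofReal (∏ j, w j x)) ^ (1 / β) ≤
      K ^ (1 / β) * ((∑ Q ∈ S, Q.set.indicator (fun _ => G Q ^ u) x) ^ (1 / (u * β)) *
        (ENNReal.ofReal (∏ j, w j x) ^ (1 / β))) := by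
    intro x
    have hbp : 0 ≤ 1 / β := by positivity
    have hbp2 : 0 ≤ 1 / (u * β) := by positivity
    rw [ENNReal.mul_rpow_of_nonneg _ _ hbp, ← mul_assoc]
    refine mul_le_mul_left ?_ _
    have e1 : Φ x ^ (1 / β) = (Φ x ^ u) ^ (1 / (u * β)) := by
      rw [← ENNReal.rpow_mul]; congr 1; field_simp
    rw [e1]
    refine (ENNReal.rpow_le_rpow (hpt x) hbp2).trans ?_
    rw [ENNReal.mul_rpow_of_nonneg _ _ hbp2, ← ENNReal.rpow_mul]
    apply le_of_eq
    congr 2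
    field_simp
  unfold wNorm
  rw [eNorm_of_ne_top hpfin, hPr, one_div_one_div]
  have hhint : ∫⁻ x, (Φ x * ENNReal.ofReal (∏ j, w j x)) ^ (1 / β) ≤ K ^ (1 / β) *
      ((Kd a b β u γ + 1) ^ (1 / (u * β)) * W ^ (γ / β) * (∏ j, N j) ^ (1 / β)) := by
    refine (lintegral_mono hpt2).trans ?_
    rw [lintegral_const_mul' _ _ (ENNReal.rpow_ne_top_of_nonneg (by positivity) hKt)]
    exact mul_le_mul_right key _
  refine (ENNReal.rpow_le_rpow hhint hβ0.le).trans (le_of_eq ?_)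
  rw [ENNReal.mul_rpow_of_nonneg _ _ hβ0.le, ENNReal.mul_rpow_of_nonneg _ _ hβ0.le,
    ENNReal.mul_rpow_of_nonneg _ _ hβ0.le]
  simp only [← ENNReal.rpow_mul]
  rw [one_div_mul_cancel hβ0.ne', ENNReal.rpow_one, ENNReal.rpow_one, div_mul_cancel₀ _ hβ0.ne',
    show 1 / (u * β) * β = 1 / u by field_simp]
  simp only [hN, wNorm]
  ring


lemma one_dim (c l h : ℝ) (hh : 0 < h) (hl : 3 * l ≤ h) (M : ℕ) :
    ∃ s : Bool, ∃ k : ℤ, (if s then h * 2 ^ M / 3 else 0) + h * k ≤ c ∧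
      c + l ≤ (if s then h * 2 ^ M / 3 else 0) + h * k + h := by
  by_contra hcon
  push Not at hcon
  have key : ∀ Δ : ℝ, ∃ k : ℤ, Δ + h * k ≤ c ∧ c < Δ + h * k + h := by
    intro Δ
    refine ⟨⌊(c - Δ) / h⌋, ?_, ?_⟩
    · have := Int.floor_le ((c - Δ) / h)
      rw [le_div_iff₀ hh] at this
      linarith
    · have := Int.lt_floor_add_one ((c - Δ) / h)
      rw [div_lt_iff₀ hh] at this
      linarith
  obtain ⟨k0, h1, h2⟩ := key 0
  obtain ⟨k1, h3, h4⟩ := key (h * 2 ^ M / 3)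
  have h5 := hcon false k0 (by simpa using h1)
  have h6 := hcon true k1 (by simpa using h3)
  simp only [Bool.false_eq_true, if_false, if_true] at h5 h6
  have h7 : 3 * ((k0:ℝ) - k1) - 2 ^ M < 1 := by
    by_contra hc
    push Not at hc
    nlinarith
  have h8 : -1 < 3 * ((k0:ℝ) - k1) - 2 ^ M := by
    by_contra hc
    push Not at hc
    nlinarith
  have h9 : 3 * (k0 - k1) - 2 ^ M < (1:ℤ) := by exact_mod_cast h7
  have h10 : (-1:ℤ) < 3 * (k0 - k1) - 2 ^ M := by exact_mod_cast h8
  have h11 : (3:ℤ) ∣ 2 ^ M := ⟨k0 - k1, by omega⟩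
  have h12 : (3:ℤ) ∣ 2 := Int.prime_three.dvd_of_dvd_pow h11
  omega

lemma cover_cubes {d : ℕ} (D : Finset (Cube d)) :
    ∃ (δ : ℝ) (hδ : 0 < δ) (s : (Fin d → Bool) → Fin d → ℝ),
      ∀ Q ∈ D, ∃ (ε : Fin d → Bool) (Q' : Cube d), InGrid (s ε) δ hδ Q' ∧ Q.set ⊆ Q'.set ∧
        Q'.side ≤ 6 * Q.side := by
  have hmin : ∃ δ : ℝ, 0 < δ ∧ ∀ Q ∈ D, δ ≤ Q.side := by
    rcases D.eq_empty_or_nonempty with h | h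
    · exact ⟨1, one_pos, by simp [h]⟩
    · obtain ⟨Q0, _, h0⟩ := D.exists_min_image Cube.side h
      exact ⟨Q0.side, Q0.side_pos, h0⟩
  obtain ⟨δ, hδ, hmin⟩ := hmin
  have hn : ∀ Q ∈ D, ∃ n : ℕ, 3 * Q.side ≤ δ * 2 ^ n ∧ δ * 2 ^ n ≤ 6 * Q.side := by
    classical
    intro Q hQ
    have hex : ∃ n : ℕ, 3 * Q.side ≤ δ * 2 ^ n := by
      obtain ⟨n, hn⟩ := pow_unbounded_of_one_lt (3 * Q.side / δ) (one_lt_two)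
      refine ⟨n, ?_⟩
      rw [div_lt_iff₀ hδ] at hn
      linarith
    refine ⟨Nat.find hex, Nat.find_spec hex, ?_⟩
    rcases hk : Nat.find hex with _ | k
    · have := hmin Q hQ
      have := Q.side_pos
      simp; linarith
    · have := Nat.find_min hex (m := k) (by omega)
      rw [pow_succ]
      linarith
  choose! n hn1 hn2 using hn
  set N := D.sup n with hN
  refine ⟨δ, hδ, fun ε i => if ε i then δ * 2 ^ N / 3 else 0, ?_⟩
  intro Q hQ
  have hle : n Q ≤ N := Finset.le_sup hQ
  have hpw : δ * 2 ^ N = δ * 2 ^ (n Q) * 2 ^ (N - n Q) := by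
    rw [mul_assoc, ← pow_add, Nat.add_sub_cancel' hle]
  choose ε k hk using fun i => one_dim (Q.corner i) Q.side (δ * 2 ^ (n Q)) (by positivity) (hn1 Q hQ) (N - n Q)
  refine ⟨ε, gcube _ δ hδ (n Q) k, ⟨n Q, k, rfl⟩, ?_, hn2 Q hQ⟩
  intro x hx i
  have h1 := hx i
  have h2 := hk i
  simp only [gcube, hpw]
  exact ⟨by linarith [h2.1, h1.1], by linarith [h2.2, h1.2]⟩

lemma latAvg_cover {d : ℕ} {Ω : Type*} {r : ℝ≥0∞} (hr : 0 < r ∧ r ≠ ∞)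
    (f : (Fin d → ℝ) → Ω → ℂ) (Q Q' : Cube d)
    (hs : Q.set ⊆ Q'.set) (h6 : Q'.side ≤ 6 * Q.side) (ω : Ω) :
    latAvg r f Q ω ≤ (6 ^ d : ℝ≥0∞) ^ (1 / r.toReal) * latAvg r f Q' ω := by
  unfold latAvg
  have hrp : 0 ≤ 1 / r.toReal := by positivity
  rw [← ENNReal.mul_rpow_of_nonneg _ _ hrp]
  apply ENNReal.rpow_le_rpow _ hrp
  have hv : Q'.vol ≤ 6 ^ d * Q.vol := by
    rw [Cube.vol_eq, Cube.vol_eq, ← mul_pow]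
    gcongr
    rw [show (6:ℝ≥0∞) = ENNReal.ofReal 6 by simp, ← ENNReal.ofReal_mul (by norm_num)]
    exact ENNReal.ofReal_le_ofReal h6
  have hi : (Q.vol)⁻¹ ≤ 6 ^ d * (Q'.vol)⁻¹ := by
    rw [← div_eq_mul_inv, ENNReal.le_div_iff_mul_le (Or.inl Q'.vol_ne_zero) (Or.inl Q'.vol_ne_top)]
    calc (Q.vol)⁻¹ * Q'.vol ≤ (Q.vol)⁻¹ * (6 ^ d * Q.vol) := mul_le_mul_right hv _
      _ = 6 ^ d * ((Q.vol)⁻¹ * Q.vol) := by ring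
      _ = 6 ^ d := by rw [ENNReal.inv_mul_cancel Q.vol_ne_zero Q.vol_ne_top, mul_one]
  rw [div_eq_mul_inv, div_eq_mul_inv]
  calc _ ≤ (∫⁻ y in Q'.set, (‖f y ω‖₊ : ℝ≥0∞) ^ r.toReal) * (6 ^ d * (Q'.vol)⁻¹) :=
        mul_le_mul' (lintegral_mono_set hs) hi
    _ = _ := by ring

lemma eNorm_iSup_le {α ι : Type*} [Fintype ι] [MeasurableSpace α] (μ : Measure α) {s : ℝ≥0∞}
    (hs0 : s ≠ 0) (hs : s ≠ ∞) (G : ι → α → ℝ≥0∞) (hG : ∀ i, Measurable (G i)) (B : ℝ≥0∞)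
    (hB : ∀ i, eNorm s μ (G i) ≤ B) :
    eNorm s μ (fun x => ⨆ i, G i x) ≤ (Fintype.card ι : ℝ≥0∞) ^ (1 / s.toReal) * B := by
  have hp : 0 < s.toReal := ENNReal.toReal_pos hs0 hs
  have h1 : ∫⁻ x, (⨆ i, G i x) ^ s.toReal ∂μ ≤ (Fintype.card ι : ℝ≥0∞) * B ^ s.toReal := by
    calc _ ≤ ∫⁻ x, ∑ i, G i x ^ s.toReal ∂μ := by
          apply lintegral_mono
          intro x
          have h2 : (⨆ i, G i x) ≤ (∑ i, G i x ^ s.toReal) ^ (1 / s.toReal) := by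
            apply iSup_le
            intro i
            calc G i x = (G i x ^ s.toReal) ^ (1 / s.toReal) := by
                  rw [← ENNReal.rpow_mul, mul_one_div_cancel hp.ne', ENNReal.rpow_one]
              _ ≤ _ := ENNReal.rpow_le_rpow (Finset.single_le_sum
                  (f := fun i => G i x ^ s.toReal) (fun _ _ => bot_le) (Finset.mem_univ i)) (by positivity)
          have h3 := ENNReal.rpow_le_rpow h2 hp.le
          rwa [← ENNReal.rpow_mul, one_div_mul_cancel hp.ne', ENNReal.rpow_one] at h3
      _ = ∑ i, ∫⁻ x, G i x ^ s.toReal ∂μ := lintegral_finsetSum _ fun i _ => (hG i).pow_const _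
      _ = ∑ i, (eNorm s μ (G i)) ^ s.toReal := by simp only [eNorm_pow_eq hs0 hs]
      _ ≤ ∑ i : ι, B ^ s.toReal := Finset.sum_le_sum fun i _ => ENNReal.rpow_le_rpow (hB i) hp.le
      _ = _ := by simp
  rw [eNorm_of_ne_top hs]
  refine (ENNReal.rpow_le_rpow h1 (by positivity)).trans (le_of_eq ?_)
  rw [ENNReal.mul_rpow_of_nonneg _ _ (by positivity), ← ENNReal.rpow_mul, mul_one_div_cancel hp.ne',
    ENNReal.rpow_one]

lemma latMax_cover {d m : ℕ} (r : Fin m → ℝ≥0∞) (hr : ∀ j, 0 < r j ∧ r j ≠ ∞) (D : Finset (Cube d)) :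
    ∃ (δ : ℝ) (hδ : 0 < δ) (s : (Fin d → Bool) → Fin d → ℝ) (D' : (Fin d → Bool) → Finset (Cube d)),
      (∀ ε, ∀ Q ∈ D' ε, InGrid (s ε) δ hδ Q) ∧
      ∀ (Ω : Type) (f : Fin m → (Fin d → ℝ) → Ω → ℂ) x ω,
        latMax r D f x ω ≤ (∏ j, (6 ^ d : ℝ≥0∞) ^ (1 / (r j).toReal)) * ⨆ ε, latMax r (D' ε) f x ω := by
  classical
  obtain ⟨δ, hδ, s, hs⟩ := cover_cubes D
  choose! ε π h1 h2 h3 using hs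
  refine ⟨δ, hδ, s, fun e => (D.filter fun Q => ε Q = e).image π, ?_, ?_⟩
  · intro e Q hQ
    simp only [Finset.mem_image, Finset.mem_filter] at hQ
    obtain ⟨Q0, ⟨hQ0, rfl⟩, rfl⟩ := hQ
    exact h1 Q0 hQ0
  · intro Ω f x ω
    unfold latMax
    refine iSup₂_le fun Q hQ => iSup_le fun hx => ?_
    calc ∏ j, latAvg (r j) (f j) Q ω ≤
        ∏ j, (6 ^ d : ℝ≥0∞) ^ (1 / (r j).toReal) * latAvg (r j) (f j) (π Q) ω :=
          Finset.prod_le_prod' fun j _ => latAvg_cover (hr j) (f j) Q (π Q) (h2 Q hQ) (h3 Q hQ) ω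
      _ = (∏ j, (6 ^ d : ℝ≥0∞) ^ (1 / (r j).toReal)) * ∏ j, latAvg (r j) (f j) (π Q) ω :=
          Finset.prod_mul_distrib
      _ ≤ _ := by
          refine mul_le_mul_right ?_ _
          refine le_iSup_of_le (ε Q) ?_
          refine le_iSup₂_of_le (π Q) (Finset.mem_image_of_mem _ (Finset.mem_filter.2 ⟨hQ, rfl⟩)) ?_
          exact le_iSup_of_le (h2 Q hQ hx) le_rfl

/-- weighted bounds for the lattice multisublinear maximal operator
with values in `L^t(Ω)`. -/
theorem statement11 (d m : ℕ) (hd : 1 ≤ d) (hm : 1 ≤ m)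
    (r : Fin m → ℝ≥0∞) (hr : ∀ j, 0 < r j ∧ r j ≠ ∞)
    (t : Fin m → ℝ≥0∞) (hrt : ∀ j, r j < t j) (htfin : (∑ j, (t j)⁻¹)⁻¹ ≠ ∞)
    (q : ℝ≥0∞) (hq1 : (∑ j, (r j)⁻¹)⁻¹ ≤ q) (hq2 : q ≤ (∑ j, (t j)⁻¹)⁻¹)
    (p : Fin m → ℝ≥0∞) (hrp : ∀ j, r j < p j) (hpfin : (∑ j, (p j)⁻¹)⁻¹ ≠ ∞) :
    ∃ C : ℝ≥0∞, 0 < C ∧ C ≠ ∞ ∧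
      ∀ (Ω : Type) [MeasurableSpace Ω] (μ : Measure Ω) [SigmaFinite μ],
      ∀ (w : Fin m → (Fin d → ℝ) → ℝ),
        (∀ j, Measurable (w j)) → (∀ j x, 0 < w j x) →
        aConst p r ∞ w ≠ ∞ →
        ∀ (D : Finset (Cube d)) (f : Fin m → (Fin d → ℝ) → Ω → ℂ),
          (∀ j, Measurable (Function.uncurry (f j))) →
          wNorm (∑ j, (p j)⁻¹)⁻¹ (fun x => ∏ j, w j x)
              (fun x => eNorm (∑ j, (t j)⁻¹)⁻¹ μ (latMax r D f x)) ≤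
            C * aConst p r ∞ w ^
                ((max (⨆ j, (r j)⁻¹ / ((r j)⁻¹ - (p j)⁻¹))
                  ((∑ j, (p j)⁻¹)⁻¹ / q)).toReal) *
              ∏ j, wNorm (p j) (w j) (fun x => eNorm (t j) μ (nn (f j x))) := by
  obtain ⟨C, hC0, hCt, hC⟩ := grid_bound d m hm r hr t hrt htfin q hq1 hq2 p hrp hpfin
  have hT0 : (∑ j, (t j)⁻¹)⁻¹ ≠ 0 := by
    rw [ne_eq, ENNReal.inv_eq_zero]
    exact (ENNReal.sum_lt_top.2 fun j _ => (ENNReal.inv_ne_top.2 ((hr j).1.trans (hrt j)).ne').lt_top).ne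
  have hP0 : (∑ j, (p j)⁻¹)⁻¹ ≠ 0 := by
    rw [ne_eq, ENNReal.inv_eq_zero]
    exact (ENNReal.sum_lt_top.2 fun j _ => (ENNReal.inv_ne_top.2 ((hr j).1.trans (hrp j)).ne').lt_top).ne
  set T := (∑ j, (t j)⁻¹)⁻¹ with hT
  set P := (∑ j, (p j)⁻¹)⁻¹ with hP
  set n : ℝ≥0∞ := (Fintype.card (Fin d → Bool) : ℝ≥0∞) with hn
  have hn0 : n ≠ 0 := by
    rw [hn, Nat.cast_ne_zero]; exact Fintype.card_ne_zero
  have hnt : n ≠ ∞ := ENNReal.natCast_ne_top _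
  set c : ℝ≥0∞ := ∏ j, (6 ^ d : ℝ≥0∞) ^ (1 / (r j).toReal) with hc
  have h6 : (6 ^ d : ℝ≥0∞) ≠ ∞ := ENNReal.pow_ne_top (by simp)
  have hct : c ≠ ∞ := ENNReal.prod_ne_top fun j _ => ENNReal.rpow_ne_top_of_nonneg (by positivity) h6
  have hc0 : c ≠ 0 := Finset.prod_ne_zero_iff.2 fun j _ => (ENNReal.rpow_pos (by positivity) h6).ne'
  have hnT : n ^ (1 / T.toReal) ≠ ∞ := ENNReal.rpow_ne_top_of_nonneg (by positivity) hnt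
  have hnP : n ^ (1 / P.toReal) ≠ ∞ := ENNReal.rpow_ne_top_of_nonneg (by positivity) hnt
  have hnT0 : n ^ (1 / T.toReal) ≠ 0 := (ENNReal.rpow_pos (pos_iff_ne_zero.2 hn0) hnt).ne'
  have hnP0 : n ^ (1 / P.toReal) ≠ 0 := (ENNReal.rpow_pos (pos_iff_ne_zero.2 hn0) hnt).ne'
  refine ⟨(c * n ^ (1 / T.toReal)) * n ^ (1 / P.toReal) * C, ?_, ?_, ?_⟩
  · exact pos_iff_ne_zero.2 (mul_ne_zero (mul_ne_zero (mul_ne_zero hc0 hnT0) hnP0) hC0)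
  · exact ENNReal.mul_ne_top (ENNReal.mul_ne_top (ENNReal.mul_ne_top hct hnT) hnP) hCt
  intro Ω _ μ _ w hw hw0 hWt D f hf
  obtain ⟨δ, hδ, s, D', hD', hcov⟩ := latMax_cover r hr D
  have hA : ∀ Q, Measurable (fun ω => ∏ j, latAvg (r j) (f j) Q ω) := by
    intro Q
    apply Finset.measurable_prod
    intro j _
    refine (measurable_av (fun y ω => (nn (f j y) ω) ^ (r j).toReal) ?_ Q).pow_const _
    exact (measurable_nn (f j) (hf j)).pow_const _
  have hm1 : ∀ ε x, Measurable (latMax r (D' ε) f x) := fun ε x =>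
    measurable_mx3 (D' ε) (fun Q ω => ∏ j, latAvg (r j) (f j) Q ω) hA x
  have hm2 : ∀ ε, Measurable (fun x => eNorm T μ (latMax r (D' ε) f x)) := fun ε =>
    measurable_eNorm T μ _ (measurable_mx2 (D' ε) (fun Q ω => ∏ j, latAvg (r j) (f j) Q ω) hA)
  set B := aConst p r ∞ w ^ ((max (⨆ j, (r j)⁻¹ / ((r j)⁻¹ - (p j)⁻¹)) (P / q)).toReal) *
      ∏ j, wNorm (p j) (w j) (fun x => eNorm (t j) μ (nn (f j x))) with hB
  have hgb : ∀ ε, eNorm P volume (fun x => eNorm T μ (latMax r (D' ε) f x) *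
      ENNReal.ofReal (∏ j, w j x)) ≤ C * B := by
    intro ε
    have := hC Ω μ w hw hw0 hWt (s ε) δ hδ (D' ε) (hD' ε) f hf
    rw [hB, ← mul_assoc]
    exact this
  have hpt : ∀ x, eNorm T μ (latMax r D f x) ≤
      (c * n ^ (1 / T.toReal)) * ⨆ ε, eNorm T μ (latMax r (D' ε) f x) := by
    intro x
    calc eNorm T μ (latMax r D f x) ≤ eNorm T μ (fun ω => c * ⨆ ε, latMax r (D' ε) f x ω) :=
          eNorm_mono T μ (fun ω => hcov Ω f x ω)
      _ = c * eNorm T μ (fun ω => ⨆ ε, latMax r (D' ε) f x ω) := eNorm_const_mul hT0 μ _ hct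
      _ ≤ c * (n ^ (1 / T.toReal) * ⨆ ε, eNorm T μ (latMax r (D' ε) f x)) := by
          refine mul_le_mul_right ?_ _
          exact eNorm_iSup_le μ hT0 htfin (fun ε => latMax r (D' ε) f x) (fun ε => hm1 ε x) _
            (fun ε => le_iSup (fun ε => eNorm T μ (latMax r (D' ε) f x)) ε)
      _ = _ := by rw [mul_assoc]
  have hfinal : wNorm P (fun x => ∏ j, w j x) (fun x => eNorm T μ (latMax r D f x)) ≤
      (c * n ^ (1 / T.toReal)) * (n ^ (1 / P.toReal) * (C * B)) := by
    unfold wNorm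
    calc _ ≤ eNorm P volume (fun x => (c * n ^ (1 / T.toReal)) *
          ⨆ ε, eNorm T μ (latMax r (D' ε) f x) * ENNReal.ofReal (∏ j, w j x)) := by
          apply eNorm_mono P volume
          intro x
          rw [← ENNReal.iSup_mul, ← mul_assoc]
          exact mul_le_mul_left (hpt x) _
      _ = (c * n ^ (1 / T.toReal)) * eNorm P volume (fun x =>
          ⨆ ε, eNorm T μ (latMax r (D' ε) f x) * ENNReal.ofReal (∏ j, w j x)) :=
          eNorm_const_mul hP0 volume _ (ENNReal.mul_ne_top hct hnT)
      _ ≤ _ := by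
          refine mul_le_mul_right ?_ _
          refine eNorm_iSup_le volume hP0 hpfin (fun ε x => eNorm T μ (latMax r (D' ε) f x) *
            ENNReal.ofReal (∏ j, w j x)) (fun ε => ?_) _ hgb
          exact (hm2 ε).mul (Finset.measurable_prod _ fun j _ => hw j).ennreal_ofReal
  refine hfinal.trans (le_of_eq ?_)
  rw [hB]
  ring

end
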